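/- Let G be a finite group satisfying the two-prime hypothesis with normal subgroups N ≤ M such that M/N ≅ PSL_2(11) and the centralizer of M/N in G/N is trivial. Then |cd(G)| ≤ 18. -/

import Mathlib

open CategoryTheory

/-- The set of degrees of the complex irreducible characters of `G`. -/
def charDegrees (G : Type) [Group G] : Set ℕ :=
  {n | ∃ V : FDRep ℂ G, Simple V ∧ Module.finrank ℂ V = n}

/-- `G` satisfies the two-prime hypothesis: for any distinct irreducible character degrees
`a`, `b`, the gcd `gcd a b` has at most two prime divisors counted with multiplicity. -/
def TwoPrimeHypothesis (G : Type) [Group G] : Prop :=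
  ∀ a ∈ charDegrees G, ∀ b ∈ charDegrees G, a ≠ b →
    (Nat.gcd a b).primeFactorsList.length ≤ 2

/-- `PSL₂(F)`: the quotient of `SL₂(F)` by its center. -/
abbrev PSL2 (F : Type) [Field F] : Type :=
  Matrix.SpecialLinearGroup (Fin 2) F ⧸
    Subgroup.center (Matrix.SpecialLinearGroup (Fin 2) F)


set_option linter.unusedSectionVars false
set_option linter.unusedSimpArgs false
set_option linter.unusedVariables false

set_option linter.style.haveILetI false
section CharacterBasics
/-- `f` is a character of `H`. -/
def IsCh (H : Type) [Group H] (f : H → ℂ) : Prop := ∃ V : FDRep ℂ H, V.character = f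
/-- `f` is an irreducible character of `H`. -/
def IsIr (H : Type) [Group H] (f : H → ℂ) : Prop :=
  ∃ V : FDRep ℂ H, Simple V ∧ V.character = f
variable {H K : Type} [Group H] [Group K]
lemma IsIr.isCh {f : H → ℂ} (h : IsIr H f) : IsCh H f := by
  obtain ⟨V, _, h⟩ := h
  exact ⟨V, h⟩
lemma IsCh.conj {f : H → ℂ} (h : IsCh H f) (g x : H) : f (g * x * g⁻¹) = f x := by
  obtain ⟨V, rfl⟩ := h
  exact FDRep.char_conj V x g
lemma IsCh.one {f : H → ℂ} (h : IsCh H f) : ∃ n : ℕ, f 1 = n := by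
  obtain ⟨V, rfl⟩ := h
  exact ⟨_, FDRep.char_one V⟩
lemma IsCh.mul {f g : H → ℂ} (hf : IsCh H f) (hg : IsCh H g) :
    IsCh H (fun x => f x * g x) := by
  obtain ⟨V, rfl⟩ := hf
  obtain ⟨W, rfl⟩ := hg
  exact ⟨MonoidalCategory.tensorObj V W, FDRep.char_tensor V W⟩
lemma isCh_of_rep {V : Type} [AddCommGroup V] [Module ℂ V] [FiniteDimensional ℂ V]
    (ρ : Representation ℂ H V) : IsCh H ρ.character :=
  ⟨FDRep.of ρ, rfl⟩
lemma IsCh.comp {f : H → ℂ} (h : IsCh H f) (φ : K →* H) : IsCh K (fun x => f (φ x)) := by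
  obtain ⟨V, rfl⟩ := h
  exact isCh_of_rep (V := V) (MonoidHom.comp V.ρ φ)
lemma isCh_lin (μ : H →* ℂˣ) : IsCh H (fun x => (μ x : ℂ)) := by
  have h := isCh_of_rep (V := ℂ)
    (((Algebra.lmul ℂ ℂ : ℂ →ₐ[ℂ] Module.End ℂ ℂ) : ℂ →* Module.End ℂ ℂ).comp
      ((Units.coeHom ℂ).comp μ))
  convert h using 1
  ext x
  simp [Representation.character]
  rw [LinearMap.trace_eq_matrix_trace ℂ (Module.Basis.singleton Unit ℂ)]
  simp [Matrix.trace, LinearMap.toMatrix_apply]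
variable [Fintype H]
lemma isIr_iff {f : H → ℂ} :
    IsIr H f ↔ IsCh H f ∧ ∑ g : H, f g * f g⁻¹ = Nat.card H := by
  constructor
  · rintro ⟨V, hV, rfl⟩
    exact ⟨⟨V, rfl⟩, (FDRep.simple_iff_char_is_norm_one V).1 hV⟩
  · rintro ⟨⟨V, rfl⟩, h⟩
    exact ⟨V, (FDRep.simple_iff_char_is_norm_one V).2 h, rfl⟩
lemma IsIr.orth {f f' : H → ℂ} (h : IsIr H f) (h' : IsIr H f') (hne : f ≠ f') :
    ∑ g : H, f g * f' g⁻¹ = 0 := by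
  classical
  obtain ⟨V, hV, rfl⟩ := h
  obtain ⟨W, hW, rfl⟩ := h'
  have := invertibleOfNonzero (NeZero.ne (Nat.card H : ℂ))
  have h1 := FDRep.char_orthonormal V W
  rw [if_neg (by rintro ⟨i⟩; exact hne (FDRep.char_iso i))] at h1
  have h2 : (Nat.card H : ℂ)⁻¹ ≠ 0 := inv_ne_zero (NeZero.ne _)
  rcases mul_eq_zero.1 (h1.trans (by simp)) with h | h
  · exact absurd h h2
  · exact h
lemma IsCh.ip_nat {f f' : H → ℂ} (h : IsCh H f) (h' : IsCh H f') :
    ∃ n : ℕ, ∑ g : H, f g * f' g⁻¹ = n * Nat.card H := by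
  obtain ⟨V, rfl⟩ := h
  obtain ⟨W, rfl⟩ := h'
  have := invertibleOfNonzero (NeZero.ne (Nat.card H : ℂ))
  have h1 := FDRep.scalar_product_char_eq_finrank_equivariant W V
  refine ⟨Module.finrank ℂ (W ⟶ V), ?_⟩
  rw [← h1]
  field_simp
lemma IsIr.one_pos {f : H → ℂ} (h : IsIr H f) : ∃ n : ℕ, 0 < n ∧ f 1 = n := by
  obtain ⟨V, hV, rfl⟩ := h
  refine ⟨_, ?_, FDRep.char_one V⟩
  rw [Nat.pos_iff_ne_zero]
  intro h0
  have h1 := (FDRep.simple_iff_char_is_norm_one V).1 hV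
  have h2 : ∀ g, V.character g = 0 := by
    intro g
    have : Subsingleton V := Module.finrank_zero_iff.1 h0
    have : V.ρ g = 0 := Subsingleton.elim _ _
    simp [FDRep.character, this]
  rw [Finset.sum_eq_zero (fun g _ => by rw [h2, zero_mul])] at h1
  exact (NeZero.ne (Nat.card H : ℂ)) h1.symm
lemma isIr_lin (μ : H →* ℂˣ) : IsIr H (fun x => (μ x : ℂ)) := by
  rw [isIr_iff]
  refine ⟨isCh_lin μ, ?_⟩
  simp
lemma IsIr.twist {f : H → ℂ} (h : IsIr H f) (μ : H →* ℂˣ) :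
    IsIr H (fun x => f x * (μ x : ℂ)) := by
  rw [isIr_iff] at h ⊢
  refine ⟨h.1.mul (isCh_lin μ), ?_⟩
  rw [← h.2]
  refine Finset.sum_congr rfl fun g _ => ?_
  have : (μ g : ℂ) * (μ g⁻¹ : ℂ) = 1 := by simp
  linear_combination (f g * f g⁻¹) * this
lemma IsIr.compEquiv {f : H → ℂ} [Fintype K] (h : IsIr H f) (φ : K ≃* H) :
    IsIr K (fun x => f (φ x)) := by
  rw [isIr_iff] at h ⊢
  refine ⟨h.1.comp φ.toMonoidHom, ?_⟩
  rw [Nat.card_congr φ.toEquiv, ← h.2]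
  simp only [map_inv]
  exact Fintype.sum_equiv φ.toEquiv _ _ (fun x => rfl)
open scoped MonoidAlgebra in
lemma irr_acts_zero (f : H → ℂ) (hf : ∀ g x, f (g * x * g⁻¹) = f x)
    (h0 : ∀ χ, IsIr H χ → ∑ g : H, f g * χ g⁻¹ = 0)
    {V : Type} [AddCommGroup V] [Module ℂ V] [FiniteDimensional ℂ V]
    (ρ : Representation ℂ H V) (hρ : ρ.IsIrreducible) :
    ∑ x : H, f x • ρ x⁻¹ = 0 := by
  classical
  have := invertibleOfNonzero (NeZero.ne (Nat.card H : ℂ))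
  have hir : IsIr H ρ.character := by
    rw [isIr_iff]
    refine ⟨isCh_of_rep ρ, ?_⟩
    have h1 := Representation.char_orthonormal ρ ρ
    rw [if_pos ⟨Representation.Equiv.refl ρ⟩] at h1
    field_simp at h1
    exact h1
  let Z : V →ₗ[ℂ] V := ∑ x : H, f x • ρ x⁻¹
  have hcomm : ∀ (g : H) (v : V), Z (ρ g v) = ρ g (Z v) := by
    intro g v
    simp only [Z, LinearMap.sum_apply, LinearMap.smul_apply, _root_.map_sum, map_smul]
    refine Fintype.sum_equiv (MulAut.conj g⁻¹).toEquiv _ _ fun x => ?_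
    have e1 : f ((MulAut.conj g⁻¹).toEquiv x) = f x := by
      simpa using hf g⁻¹ x
    rw [e1]
    congr 1
    rw [← Module.End.mul_apply, ← Module.End.mul_apply, ← map_mul, ← map_mul]
    congr 2
    simp [mul_assoc]
  let Zi : Representation.IntertwiningMap ρ ρ :=
    LinearMap.intertwiningMap_of_isIntertwiningMap (f := Z) ρ ρ hcomm
  obtain ⟨c, hc⟩ :=
    (Representation.IsIrreducible.algebraMap_intertwiningMap_bijective_of_isAlgClosed
      (ρ := ρ)).2 Zi
  have hZ : Z = c • LinearMap.id := by
    have h2 : Zi.toLinearMap = (c • (1 : Representation.IntertwiningMap ρ ρ)).toLinearMap := by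
      rw [← hc]; rfl
    exact h2
  have htr : LinearMap.trace ℂ V Z = 0 := by
    rw [← h0 _ hir]
    simp [Z, Representation.character]
  have hdim : (Module.finrank ℂ V : ℂ) ≠ 0 := by
    obtain ⟨n, hn, h1⟩ := hir.one_pos
    rw [Representation.char_one] at h1
    rw [h1]
    exact_mod_cast hn.ne'
  rw [hZ, map_smul, LinearMap.trace_id, smul_eq_mul] at htr
  rcases mul_eq_zero.1 htr with h | h
  · change Z = 0
    rw [hZ, h, zero_smul]
  · exact absurd h hdim
open scoped MonoidAlgebra in
lemma monAlg_finite : Module.Finite ℂ ℂ[H] := by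
  classical
  refine Module.Finite.of_surjective
    (M := H → ℂ) (∑ x : H, (LinearMap.toSpanSingleton ℂ ℂ[H] (MonoidAlgebra.single x 1)).comp
      (LinearMap.proj x)) ?_
  intro z
  refine ⟨fun x => z.coeff x, ?_⟩
  apply MonoidAlgebra.coeff_injective
  ext y
  simp [LinearMap.sum_apply, Finsupp.finsetSum_apply, Finsupp.single_apply]
open scoped MonoidAlgebra in
lemma simple_acts_zero (f : H → ℂ) (hf : ∀ g x, f (g * x * g⁻¹) = f x)
    (h0 : ∀ χ, IsIr H χ → ∑ g : H, f g * χ g⁻¹ = 0)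
    (S : Type) [AddCommGroup S] [Module ℂ[H] S] [Module ℂ S] [IsScalarTower ℂ ℂ[H] S]
    [hS : IsSimpleModule ℂ[H] S] (s : S) :
    (∑ x : H, MonoidAlgebra.single x⁻¹ (f x) : ℂ[H]) • s = 0 := by
  classical
  have hfin : Module.Finite ℂ ℂ[H] := monAlg_finite
  have hfd : FiniteDimensional ℂ S := Module.Finite.trans ℂ[H] _
  let ρ : Representation ℂ H S := Representation.ofModule' S
  have hρ : ∀ z : ℂ[H], ∀ v : S, ρ.asAlgebraHom z v = z • v := by
    intro z v
    have : ρ.asAlgebraHom = Algebra.lsmul ℂ ℂ S := by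
      simp [ρ, Representation.asAlgebraHom_def, Representation.ofModule']
    rw [this]; rfl
  have hirr : ρ.IsIrreducible := by
    rw [Representation.irreducible_iff_isSimpleModule_asModule]
    let E : ρ.asModule ≃ₗ[ℂ[H]] S :=
      { ρ.asModuleEquiv.toAddEquiv with
        map_smul' := by
          intro r x
          simp only [RingHom.id_apply]
          rw [← hρ]
          exact Representation.asModuleEquiv_map_smul ρ r x }
    exact IsSimpleModule.congr E
  have h1 := irr_acts_zero f hf h0 ρ hirr
  have h2 : ρ.asAlgebraHom (∑ x : H, MonoidAlgebra.single x⁻¹ (f x) : ℂ[H]) = 0 := by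
    rw [← h1]
    simp
  rw [← hρ, h2]
  rfl
open scoped MonoidAlgebra in
lemma ir_complete (f : H → ℂ) (hf : ∀ g x, f (g * x * g⁻¹) = f x)
    (h0 : ∀ χ, IsIr H χ → ∑ g : H, f g * χ g⁻¹ = 0) : f = 0 := by
  classical
  let z : ℂ[H] := ∑ x : H, MonoidAlgebra.single x⁻¹ (f x)
  have hk : NeZero (Nat.card H : ℂ) := inferInstance
  have key : ∀ S : Submodule ℂ[H] ℂ[H], IsSimpleModule ℂ[H] S → ∀ s ∈ S, z * s = 0 := by
    intro S hS s hs
    have h3 := simple_acts_zero f hf h0 S ⟨s, hs⟩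
    exact congrArg Subtype.val h3
  have hall : ∀ s : ℂ[H], z * s = 0 := by
    intro s
    have hs : s ∈ sSup { m : Submodule ℂ[H] ℂ[H] | IsSimpleModule ℂ[H] m } := by
      rw [IsSemisimpleModule.sSup_simples_eq_top]; trivial
    rw [sSup_eq_iSup'] at hs
    induction hs using Submodule.iSup_induction' with
    | mem i x hx => exact key i.1 i.2 x hx
    | zero => simp
    | add x y _ _ hx hy => rw [mul_add, hx, hy, add_zero]
  have hz : z = 0 := by simpa using hall 1
  ext x
  have h4 := congrArg (fun y : ℂ[H] => y.coeff x⁻¹) hz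
  simp only [z] at h4
  simpa [Finsupp.single_apply, Finsupp.finsetSum_apply] using h4
end CharacterBasics

section Ambient
variable {X : Type} [Group X] [Fintype X]
/-- `f` is (the extension by zero of) an irreducible character of the subgroup `A`. -/
def Irr (A : Subgroup X) (f : X → ℂ) : Prop :=
  (∀ x, x ∉ A → f x = 0) ∧ IsIr A (fun a => f a)
/-- The unnormalised bilinear pairing. -/
noncomputable def ip (f g : X → ℂ) : ℂ := ∑ x : X, f x * g x⁻¹
/-- Conjugate of a function. -/
def cj (b : X) (f : X → ℂ) : X → ℂ := fun x => f (b * x * b⁻¹)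
lemma sum_supp (A : Subgroup X) [Fintype A] (F : X → ℂ) (h : ∀ x, x ∉ A → F x = 0) :
    ∑ x : X, F x = ∑ a : A, F a := by
  classical
  rw [← Finset.sum_subset (Finset.subset_univ (Finset.univ.filter (· ∈ A)))
    (fun x _ hx => h x (by simpa using hx))]
  exact Finset.sum_subtype _ (by simp) F
lemma ip_comm (f g : X → ℂ) : ip f g = ip g f := by
  unfold ip
  refine Fintype.sum_equiv (Equiv.inv X) _ _ fun x => ?_
  simp [mul_comm]
lemma ip_supp_left (A : Subgroup X) [Fintype A] (f g : X → ℂ) (h : ∀ x, x ∉ A → f x = 0) :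
    ip f g = ∑ a : A, f a * g (a⁻¹ : A) := by
  unfold ip
  rw [sum_supp A _ (fun x hx => by rw [h x hx, zero_mul])]
  rfl
lemma ip_supp_right (A : Subgroup X) [Fintype A] (f g : X → ℂ) (h : ∀ x, x ∉ A → g x = 0) :
    ip f g = ∑ a : A, f a * g (a⁻¹ : A) := by
  unfold ip
  rw [sum_supp A _ (fun x hx => by rw [h x⁻¹ (by simpa using hx), mul_zero])]
  rfl
lemma ip_add_left (f f' g : X → ℂ) : ip (fun x => f x + f' x) g = ip f g + ip f' g := by
  simp [ip, add_mul, Finset.sum_add_distrib]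
lemma ip_sum_left {ι : Type*} (s : Finset ι) (c : ι → ℂ) (f : ι → X → ℂ) (g : X → ℂ) :
    ip (fun x => ∑ i ∈ s, c i * f i x) g = ∑ i ∈ s, c i * ip (f i) g := by
  simp only [ip, Finset.sum_mul, Finset.mul_sum]
  rw [Finset.sum_comm]
  exact Finset.sum_congr rfl fun i _ => Finset.sum_congr rfl fun x _ => by ring
lemma ip_cj_left (b : X) (f g : X → ℂ) : ip (cj b f) g = ip f (cj b⁻¹ g) := by
  unfold ip cj
  refine Fintype.sum_equiv (MulAut.conj b).toEquiv _ _ fun x => ?_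
  simp [mul_assoc]
lemma cj_one (f : X → ℂ) : cj 1 f = f := by
  ext x; simp [cj]
lemma cj_cj (a b : X) (f : X → ℂ) : cj a (cj b f) = cj (b * a) f := by
  ext x; simp [cj, mul_assoc]
variable {A B : Subgroup X}
lemma Irr.norm {f : X → ℂ} (h : Irr A f) : ip f f = Nat.card A := by
  classical
  rw [ip_supp_left A f f h.1, ← (isIr_iff.1 h.2).2]
lemma Irr.orth {f g : X → ℂ} (h : Irr A f) (h' : Irr A g) (hne : f ≠ g) : ip f g = 0 := by
  classical
  rw [ip_supp_left A f g h.1]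
  refine h.2.orth h'.2 ?_
  intro he
  apply hne
  ext x
  by_cases hx : x ∈ A
  · exact congrFun he ⟨x, hx⟩
  · rw [h.1 x hx, h'.1 x hx]
lemma Irr.ip_eq [DecidableEq (X → ℂ)] {f g : X → ℂ} (h : Irr A f) (h' : Irr A g) :
    ip f g = if f = g then (Nat.card A : ℂ) else 0 := by
  split_ifs with e
  · subst e; exact h.norm
  · exact h.orth h' e
lemma Irr.cls {f : X → ℂ} (h : Irr A f) {b : X} (hb : b ∈ A) (x : X) :
    f (b * x * b⁻¹) = f x := by
  by_cases hx : x ∈ A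
  · exact h.2.isCh.conj ⟨b, hb⟩ ⟨x, hx⟩
  · rw [h.1 x hx, h.1]
    intro h2
    apply hx
    have := A.mul_mem (A.mul_mem (A.inv_mem hb) h2) hb
    simpa [mul_assoc] using this
lemma Irr.cj_mem {f : X → ℂ} (h : Irr A f) {b : X} (hb : b ∈ A) : cj b f = f := by
  ext x; exact h.cls hb x
/-- The degree as a natural number. -/
noncomputable def dg (f : X → ℂ) : ℕ := ⌊(f 1).re⌋₊
lemma Irr.dg_spec {f : X → ℂ} (h : Irr A f) : f 1 = dg f ∧ 0 < dg f := by
  classical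
  obtain ⟨n, hn, h1⟩ := h.2.one_pos
  have h2 : f 1 = n := h1
  have : dg f = n := by simp [dg, h2]
  rw [this]
  exact ⟨h2, hn⟩
lemma card_ne (A : Subgroup X) : (Nat.card A : ℂ) ≠ 0 := by
  exact_mod_cast (Nat.card_pos (α := A)).ne'
lemma irr_linInd (A : Subgroup X) : LinearIndependent ℂ (fun f : {f : X → ℂ | Irr A f} => f.1) := by
  classical
  rw [linearIndependent_iff']
  intro s c hc i hi
  have h1 : ip (fun x => ∑ j ∈ s, c j * j.1 x) i.1 = 0 := by
    have : (fun x => ∑ j ∈ s, c j * j.1 x) = 0 := by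
      rw [← hc]; ext x; simp
    rw [this]; simp [ip]
  rw [ip_sum_left] at h1
  rw [Finset.sum_eq_single i] at h1
  · rw [i.2.norm] at h1
    exact (mul_eq_zero.1 h1).resolve_right (card_ne A)
  · intro j _ hj
    rw [Irr.orth j.2 i.2 (fun h => hj (Subtype.ext h)), mul_zero]
  · intro h; exact absurd hi h
lemma irr_finite (A : Subgroup X) : {f : X → ℂ | Irr A f}.Finite :=
  (irr_linInd A).setFinite
/-- The finite set of irreducible characters of a subgroup. -/
noncomputable def irr (A : Subgroup X) : Finset (X → ℂ) := (irr_finite A).toFinset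
lemma mem_irr {f : X → ℂ} : f ∈ irr A ↔ Irr A f := by simp [irr]
lemma isIr_iff_irr (χ : A → ℂ) (h : IsIr A χ) : ∃ f, Irr A f ∧ ∀ a : A, f a = χ a := by
  classical
  refine ⟨fun x => if hx : x ∈ A then χ ⟨x, hx⟩ else 0, ⟨fun x hx => by simp [hx], ?_⟩, ?_⟩
  · simpa using h
  · intro a; simp
lemma irr_expand (f : X → ℂ) (h0 : ∀ x, x ∉ A → f x = 0)
    (hc : ∀ b ∈ A, ∀ x ∈ A, f (b * x * b⁻¹) = f x) (x : X) :
    f x = ∑ χ ∈ irr A, (ip f χ / Nat.card A) * χ x := by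
  classical
  let D : X → ℂ := fun x => f x - ∑ χ ∈ irr A, (ip f χ / Nat.card A) * χ x
  have hD : (fun a : A => D a) = 0 := by
    apply ir_complete
    · intro g y
      simp only [D, Subgroup.coe_mul, Subgroup.coe_inv]
      rw [hc g g.2 y y.2]
      congr 1
      exact Finset.sum_congr rfl fun χ hχ => by rw [(mem_irr.1 hχ).cls g.2]
    · intro χ0 h
      obtain ⟨χ, hχ, hχ0⟩ := isIr_iff_irr χ0 h
      have h1 : ∑ g : A, D g * χ0 g⁻¹ = ip D χ := by
        rw [ip_supp_right A _ _ hχ.1]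
        exact Finset.sum_congr rfl fun g _ => by rw [hχ0]
      rw [h1]
      have h2 : ip D χ = ip f χ - ip (fun x => ∑ χ ∈ irr A, (ip f χ / Nat.card A) * χ x) χ := by
        simp [D, ip, sub_mul]
      rw [h2, ip_sum_left, Finset.sum_eq_single χ]
      · rw [hχ.norm]; field_simp [card_ne A]; simp
      · intro b hb hne
        rw [Irr.orth (mem_irr.1 hb) hχ hne, mul_zero]
      · intro h; exact absurd (mem_irr.2 hχ) h
  by_cases hx : x ∈ A
  · have := congrFun hD ⟨x, hx⟩
    exact sub_eq_zero.1 this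
  · rw [h0 x hx, Finset.sum_eq_zero]
    intro χ hχ
    rw [(mem_irr.1 hχ).1 x hx, mul_zero]
lemma Irr.ip_nat {χ lam : X → ℂ} (hAB : A ≤ B) (hχ : Irr B χ) (hl : Irr A lam) :
    ∃ n : ℕ, ip χ lam = n * Nat.card A := by
  classical
  obtain ⟨n, hn⟩ := IsCh.ip_nat (hχ.2.isCh.comp (Subgroup.inclusion hAB)) hl.2.isCh
  refine ⟨n, ?_⟩
  rw [ip_supp_right A _ _ hl.1, ← hn]
  rfl
/-- Multiplicity of `lam ∈ Irr A` in the restriction of `χ`. -/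
noncomputable def mlt (A : Subgroup X) (χ lam : X → ℂ) : ℕ := ⌊(ip χ lam / Nat.card A).re⌋₊
lemma mlt_of_eq {χ lam : X → ℂ} {n : ℕ} (h : ip χ lam = n * Nat.card A) : mlt A χ lam = n := by
  simp only [mlt]
  rw [h, mul_div_cancel_right₀ _ (card_ne A)]
  simp
lemma mlt_spec {χ lam : X → ℂ} (hAB : A ≤ B) (hχ : Irr B χ) (hl : Irr A lam) :
    ip χ lam = mlt A χ lam * Nat.card A := by
  obtain ⟨n, hn⟩ := Irr.ip_nat hAB hχ hl
  rw [mlt_of_eq hn, hn]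
lemma mlt_congr {χ χ' lam lam' : X → ℂ} (h : ip χ lam = ip χ' lam') :
    mlt A χ lam = mlt A χ' lam' := by
  simp [mlt, h]
open Classical in
lemma gram_ip (A B : Subgroup X) {lam lam' : X → ℂ} (h' : ∀ x, x ∉ B → lam' x = 0) :
    ∑ χ ∈ irr B, ip χ lam * ip χ lam' =
      ∑ b ∈ Finset.univ.filter (· ∈ B), ip (cj b lam') lam := by
  set F : X → ℂ := fun x => ∑ b ∈ Finset.univ.filter (· ∈ B), 1 * cj b lam' x with hF
  have hinv : ∀ b, b ∈ B → ∀ x, b * x * b⁻¹ ∈ B → x ∈ B := by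
    intro b hb x h2
    have := B.mul_mem (B.mul_mem (B.inv_mem hb) h2) hb
    simpa [mul_assoc] using this
  have h1 : ∀ χ ∈ irr B, ip F χ = Nat.card B * ip χ lam' := by
    intro χ hχ
    rw [hF, ip_sum_left]
    rw [Finset.sum_congr rfl (g := fun _ => ip χ lam')]
    · simp [Nat.card_eq_fintype_card, Fintype.card_subtype]
    · intro b hb
      rw [one_mul, ip_cj_left, (mem_irr.1 hχ).cj_mem (B.inv_mem (by simpa using hb)), ip_comm]
  have h2 : F = fun x => ∑ χ ∈ irr B, ip χ lam' * χ x := by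
    ext x
    rw [irr_expand (A := B) F]
    · refine Finset.sum_congr rfl fun χ hχ => ?_
      rw [h1 χ hχ, mul_div_cancel_left₀ _ (card_ne B)]
    · intro x hx
      simp only [hF]
      refine Finset.sum_eq_zero fun b hb => ?_
      rw [one_mul]
      exact h' _ fun h2 => hx (hinv b (by simpa using hb) x h2)
    · intro g hg x _
      simp only [hF]
      refine Finset.sum_bij (fun b _ => b * g) ?_ ?_ ?_ ?_
      · intro b hb; simpa using B.mul_mem (by simpa using hb) hg
      · intro a _ b _ h; exact mul_right_cancel h
      · intro b hb
        refine ⟨b * g⁻¹, by simpa using B.mul_mem (by simpa using hb) (B.inv_mem hg), by simp⟩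
      · intro b _; simp [cj, mul_assoc]
  have h3 : ip F lam = ∑ b ∈ Finset.univ.filter (· ∈ B), ip (cj b lam') lam := by
    rw [hF, ip_sum_left]; simp
  rw [← h3, h2, ip_sum_left]
  exact Finset.sum_congr rfl fun χ _ => by ring
open Classical in
lemma gram {A A' B : Subgroup X} (hA : A ≤ B) (hA' : A' ≤ B) {lam lam' : X → ℂ}
    (h : Irr A lam) (h' : Irr A' lam') :
    ((∑ χ ∈ irr B, mlt A χ lam * mlt A' χ lam' : ℕ) : ℂ) * Nat.card A * Nat.card A' =
      ∑ b ∈ Finset.univ.filter (· ∈ B), ip (cj b lam') lam := by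
  rw [← gram_ip A B (fun x hx => h'.1 x (fun h => hx (hA' h)))]
  push_cast
  rw [Finset.sum_mul, Finset.sum_mul]
  refine Finset.sum_congr rfl fun χ hχ => ?_
  rw [mlt_spec hA (mem_irr.1 hχ) h, mlt_spec hA' (mem_irr.1 hχ) h']
  ring
lemma Irr.conj {f : X → ℂ} (h : Irr A f) (b : X)
    (hb : ∀ x, b * x * b⁻¹ ∈ A ↔ x ∈ A) : Irr A (cj b f) := by
  classical
  refine ⟨fun x hx => h.1 _ (fun h2 => hx ((hb x).1 h2)), ?_⟩
  let φ : A ≃* A :=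
    { toFun := fun a => ⟨b * a * b⁻¹, (hb a).2 a.2⟩
      invFun := fun a => ⟨b⁻¹ * a * b, (hb _).1 (by simp [mul_assoc])⟩
      left_inv := fun a => by ext; simp [mul_assoc]
      right_inv := fun a => by ext; simp [mul_assoc]
      map_mul' := fun a c => by ext; simp [mul_assoc] }
  exact h.2.compEquiv φ
lemma Irr.ext_sub {N : Subgroup X} {f g : X → ℂ} (hf : Irr N f) (hg : Irr N g)
    (h : ∀ x ∈ N, f x = g x) : f = g := by
  ext x
  by_cases hx : x ∈ N
  · exact h x hx
  · rw [hf.1 x hx, hg.1 x hx]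
end Ambient

section Clifford
variable {X : Type} [Group X] [Fintype X] {A B N : Subgroup X}
open Classical in
/-- Order of the stabiliser of `θ` in `B`. -/
noncomputable def stc (B : Subgroup X) (θ : X → ℂ) : ℕ :=
  (Finset.univ.filter (fun b => b ∈ B ∧ cj b θ = θ)).card
lemma stc_pos (B : Subgroup X) (θ : X → ℂ) : 0 < stc B θ := by
  classical
  exact Finset.card_pos.2 ⟨1, by simp [B.one_mem, cj_one]⟩
lemma card_filter_mem [DecidablePred (· ∈ B)] :
    (Finset.univ.filter (· ∈ B)).card = Nat.card B := by
  classical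
  simp [Nat.card_eq_fintype_card, Fintype.card_subtype]
lemma stc_inv (B : Subgroup X) (θ : X → ℂ) (h : ∀ b ∈ B, cj b θ = θ) : stc B θ = Nat.card B := by
  classical
  rw [← card_filter_mem]
  unfold stc
  congr 1
  ext b
  simp only [Finset.mem_filter, Finset.mem_univ, true_and]
  exact ⟨fun h => h.1, fun hb => ⟨hb, h b hb⟩⟩
open Classical in
lemma gram_normal (hNB : N ≤ B) (hN : ∀ b ∈ B, ∀ x, b * x * b⁻¹ ∈ N ↔ x ∈ N)
    {θ θ' : X → ℂ} (h : Irr N θ) (h' : Irr N θ') :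
    (∑ χ ∈ irr B, mlt N χ θ * mlt N χ θ') * Nat.card N =
      (Finset.univ.filter (fun b => b ∈ B ∧ cj b θ' = θ)).card := by
  have h1 := gram hNB hNB h h'
  have h2 : ∑ b ∈ Finset.univ.filter (· ∈ B), ip (cj b θ') θ =
      (Finset.univ.filter (fun b => b ∈ B ∧ cj b θ' = θ)).card * (Nat.card N : ℂ) := by
    rw [Finset.sum_congr rfl (fun b hb => (h'.conj b (hN b (by simpa using hb))).ip_eq h)]
    rw [← Finset.sum_filter, Finset.filter_filter, Finset.sum_const, nsmul_eq_mul]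
  rw [h2] at h1
  have h3 := mul_right_cancel₀ (card_ne N) h1
  exact_mod_cast h3
lemma sum_sq_mlt (hNB : N ≤ B) (hN : ∀ b ∈ B, ∀ x, b * x * b⁻¹ ∈ N ↔ x ∈ N)
    {θ : X → ℂ} (h : Irr N θ) :
    (∑ χ ∈ irr B, mlt N χ θ * mlt N χ θ) * Nat.card N = stc B θ := by
  classical
  exact gram_normal hNB hN h h
lemma exists_over (hNB : N ≤ B) (hN : ∀ b ∈ B, ∀ x, b * x * b⁻¹ ∈ N ↔ x ∈ N)
    {θ : X → ℂ} (h : Irr N θ) : ∃ χ, Irr B χ ∧ mlt N χ θ ≠ 0 := by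
  by_contra hcon
  push Not at hcon
  have h1 := sum_sq_mlt hNB hN h
  rw [Finset.sum_eq_zero, zero_mul] at h1
  · exact (stc_pos B θ).ne h1
  · intro χ hχ
    rw [hcon χ (mem_irr.1 hχ), zero_mul]
lemma conj_of_under (hNB : N ≤ B) (hN : ∀ b ∈ B, ∀ x, b * x * b⁻¹ ∈ N ↔ x ∈ N)
    {θ θ' χ : X → ℂ} (h : Irr N θ) (h' : Irr N θ') (hχ : Irr B χ)
    (h1 : mlt N χ θ ≠ 0) (h2 : mlt N χ θ' ≠ 0) : ∃ b ∈ B, cj b θ' = θ := by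
  classical
  have h3 := gram_normal hNB hN h h'
  have h4 : 0 < ∑ χ ∈ irr B, mlt N χ θ * mlt N χ θ' :=
    Finset.sum_pos' (fun _ _ => Nat.zero_le _)
      ⟨χ, mem_irr.2 hχ, Nat.mul_pos (Nat.pos_of_ne_zero h1) (Nat.pos_of_ne_zero h2)⟩
  have h5 : 0 < (Finset.univ.filter (fun b => b ∈ B ∧ cj b θ' = θ)).card := by
    rw [← h3]; exact Nat.mul_pos h4 Nat.card_pos
  obtain ⟨b, hb⟩ := Finset.card_pos.1 h5
  simp only [Finset.mem_filter, Finset.mem_univ, true_and] at hb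
  exact ⟨b, hb.1, hb.2⟩
lemma mlt_cj {χ θ : X → ℂ} (hχ : Irr B χ) {b : X} (hb : b ∈ B) :
    mlt N χ (cj b θ) = mlt N χ θ := by
  apply mlt_congr
  rw [ip_comm, ip_cj_left, hχ.cj_mem (B.inv_mem hb), ip_comm]
open Classical in
lemma res_expand (hNB : N ≤ B) {χ : X → ℂ} (hχ : Irr B χ) {x : X} (hx : x ∈ N) :
    χ x = ∑ θ ∈ irr N, (mlt N χ θ : ℂ) * θ x := by
  have h1 := irr_expand (A := N) (fun x => if x ∈ N then χ x else 0)
    (fun x hx => by simp [hx])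
    (fun b hb y hy => by
      rw [if_pos hy, if_pos (N.mul_mem (N.mul_mem hb hy) (N.inv_mem hb)), hχ.cls (hNB hb)]) x
  simp only [if_pos hx] at h1
  rw [h1]
  refine Finset.sum_congr rfl fun θ hθ => ?_
  congr 1
  have h2 : ip (fun x => if x ∈ N then χ x else 0) θ = ip χ θ := by
    rw [ip_supp_right N _ _ (mem_irr.1 hθ).1, ip_supp_right N _ _ (mem_irr.1 hθ).1]
    exact Finset.sum_congr rfl fun a _ => by simp
  rw [h2, mlt_spec hNB hχ (mem_irr.1 hθ), mul_div_cancel_right₀ _ (card_ne N)]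
open Classical in
lemma clifford_val (hNB : N ≤ B) (hN : ∀ b ∈ B, ∀ x, b * x * b⁻¹ ∈ N ↔ x ∈ N)
    {θ χ : X → ℂ} (h : Irr N θ) (hχ : Irr B χ) (he : mlt N χ θ ≠ 0) {x : X} (hx : x ∈ N) :
    χ x * stc B θ = mlt N χ θ * ∑ b ∈ Finset.univ.filter (· ∈ B), θ (b * x * b⁻¹) := by
  have hsum : ∑ b ∈ Finset.univ.filter (· ∈ B), θ (b * x * b⁻¹) =
      ∑ θ' ∈ irr N,
        ((Finset.univ.filter (fun b => b ∈ B ∧ cj b θ = θ')).card : ℂ) * θ' x := by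
    have hmap : ∀ b ∈ Finset.univ.filter (· ∈ B), cj b θ ∈ irr N := by
      intro b hb
      exact mem_irr.2 (h.conj b (hN b (by simpa using hb)))
    rw [← Finset.sum_fiberwise_of_maps_to hmap]
    refine Finset.sum_congr rfl fun θ' _ => ?_
    rw [Finset.filter_filter, Finset.sum_congr rfl (g := fun _ => θ' x)]
    · rw [Finset.sum_const, nsmul_eq_mul]
    · intro b hb
      simp only [Finset.mem_filter, Finset.mem_univ, true_and] at hb
      rw [← hb.2]; rfl
  rw [hsum, res_expand hNB hχ hx, Finset.sum_mul, Finset.mul_sum]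
  refine Finset.sum_congr rfl fun θ' hθ' => ?_
  have key : mlt N χ θ' * stc B θ =
      mlt N χ θ * (Finset.univ.filter (fun b => b ∈ B ∧ cj b θ = θ')).card := by
    by_cases h0 : mlt N χ θ' = 0
    · rw [h0, zero_mul, eq_comm, mul_eq_zero]
      right
      rw [Finset.card_eq_zero, Finset.filter_eq_empty_iff]
      rintro b - ⟨hb, rfl⟩
      rw [mlt_cj hχ hb] at h0
      exact he h0
    · obtain ⟨b, hb, rfl⟩ := conj_of_under hNB hN (mem_irr.1 hθ') h hχ h0 he
      rw [mlt_cj hχ hb]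
      congr 1
      unfold stc
      refine Finset.card_bij (fun a _ => a * b) ?_ ?_ ?_
      · intro a ha
        simp only [Finset.mem_filter, Finset.mem_univ, true_and] at ha ⊢
        exact ⟨B.mul_mem ha.1 hb, by rw [← cj_cj, ha.2]⟩
      · intro a _ c _ hac; exact mul_right_cancel hac
      · intro c hc
        simp only [Finset.mem_filter, Finset.mem_univ, true_and] at hc
        refine ⟨c * b⁻¹, ?_, by simp⟩
        simp only [Finset.mem_filter, Finset.mem_univ, true_and]
        refine ⟨B.mul_mem hc.1 (B.inv_mem hb), ?_⟩
        rw [← cj_cj, hc.2, cj_cj, mul_inv_cancel, cj_one]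
  have key2 : (mlt N χ θ' : ℂ) * stc B θ =
      mlt N χ θ * (Finset.univ.filter (fun b => b ∈ B ∧ cj b θ = θ')).card := by
    exact_mod_cast key
  linear_combination (θ' x) * key2
lemma clifford_deg (hNB : N ≤ B) (hN : ∀ b ∈ B, ∀ x, b * x * b⁻¹ ∈ N ↔ x ∈ N)
    {θ χ : X → ℂ} (h : Irr N θ) (hχ : Irr B χ) (he : mlt N χ θ ≠ 0) :
    dg χ * stc B θ = mlt N χ θ * (Nat.card B * dg θ) := by
  classical
  have h1 := clifford_val hNB hN h hχ he N.one_mem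
  simp only [mul_one, mul_inv_cancel, Finset.sum_const, nsmul_eq_mul, card_filter_mem] at h1
  rw [h.dg_spec.1, hχ.dg_spec.1] at h1
  exact_mod_cast h1
lemma clifford_inv (hNB : N ≤ B) (hN : ∀ b ∈ B, ∀ x, b * x * b⁻¹ ∈ N ↔ x ∈ N)
    {θ χ : X → ℂ} (h : Irr N θ) (hχ : Irr B χ) (he : mlt N χ θ ≠ 0)
    (hinv : ∀ b ∈ B, cj b θ = θ) {x : X} (hx : x ∈ N) :
    χ x = mlt N χ θ * θ x := by
  classical
  have h1 := clifford_val hNB hN h hχ he hx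
  rw [stc_inv B θ hinv, Finset.sum_congr rfl (g := fun _ => θ x)] at h1
  · rw [Finset.sum_const, nsmul_eq_mul, card_filter_mem] at h1
    apply mul_right_cancel₀ (card_ne B)
    rw [h1]; ring
  · intro b hb
    exact congrFun (hinv b (by simpa using hb)) x
lemma exists_under (hNB : N ≤ B) {χ : X → ℂ} (hχ : Irr B χ) :
    ∃ θ, Irr N θ ∧ mlt N χ θ ≠ 0 := by
  by_contra hcon
  push Not at hcon
  have h1 := res_expand hNB hχ N.one_mem
  rw [Finset.sum_eq_zero] at h1
  · have := hχ.dg_spec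
    rw [h1] at this
    exact this.2.ne (by exact_mod_cast this.1)
  · intro θ hθ
    rw [hcon θ (mem_irr.1 hθ)]; simp
lemma mlt_ext (hNA : N ≤ A) {lam θ : X → ℂ} (h : Irr N θ)
    (hr : ∀ x ∈ N, lam x = θ x) : mlt N lam θ = 1 := by
  classical
  apply mlt_of_eq
  rw [← h.norm, ip_supp_right N _ _ h.1, ip_supp_right N _ _ h.1]
  simp only [Nat.cast_one, one_mul]
  exact Finset.sum_congr rfl fun a _ => by rw [hr a a.2]
/-- `ω` is a linear character of `A` with kernel `N` and order `p`. -/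
structure Lin (A N : Subgroup X) (p : ℕ) (ω : X → ℂ) : Prop where
  mul : ∀ a ∈ A, ∀ b ∈ A, ω (a * b) = ω a * ω b
  one_iff : ∀ a ∈ A, ω a = 1 ↔ a ∈ N
  pow : ∀ a ∈ A, ω a ^ p = 1
/-- Twist by a power of a linear character. -/
def tw (ω : X → ℂ) (i : ℕ) (f : X → ℂ) : X → ℂ := fun x => f x * ω x ^ i
lemma tw_zero (ω : X → ℂ) (f : X → ℂ) : tw ω 0 f = f := by ext x; simp [tw]
lemma tw_tw (ω : X → ℂ) (i j : ℕ) (f : X → ℂ) : tw ω i (tw ω j f) = tw ω (i + j) f := by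
  ext x; simp [tw, pow_add]; ring
lemma Lin.ne_zero {p : ℕ} {ω : X → ℂ} (hω : Lin A N p ω) {a : X} (ha : a ∈ A) : ω a ≠ 0 := by
  intro h0
  have h1 := hω.mul a ha a⁻¹ (A.inv_mem ha)
  have h3 := hω.mul 1 A.one_mem a ha
  rw [h0, zero_mul, mul_inv_cancel] at h1
  have h2 := (hω.one_iff 1 A.one_mem).2 N.one_mem
  rw [h2] at h1
  exact one_ne_zero h1
/-- The corresponding homomorphism. -/
noncomputable def Lin.hom {p : ℕ} {ω : X → ℂ} (hω : Lin A N p ω) : A →* ℂˣ where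
  toFun a := Units.mk0 (ω a) (hω.ne_zero a.2)
  map_one' := by
    ext
    exact (hω.one_iff 1 A.one_mem).2 N.one_mem
  map_mul' a b := by
    ext
    exact hω.mul a a.2 b b.2
lemma Lin.twist {p : ℕ} {ω : X → ℂ} (hω : Lin A N p ω) {f : X → ℂ} (hf : Irr A f) (i : ℕ) :
    Irr A (tw ω i f) := by
  classical
  refine ⟨fun x hx => by simp [tw, hf.1 x hx], ?_⟩
  have := hf.2.twist (hω.hom ^ i)
  simpa [tw, Lin.hom] using this
lemma Lin.tw_mod {p : ℕ} {ω : X → ℂ} (hω : Lin A N p ω) {f : X → ℂ} (hf : ∀ x, x ∉ A → f x = 0)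
    {i j : ℕ} (hij : i ≡ j [MOD p]) : tw ω i f = tw ω j f := by
  ext x
  by_cases hx : x ∈ A
  · have h1 : ∀ n, ω x ^ n = ω x ^ (n % p) := by
      intro n
      conv_lhs => rw [← Nat.div_add_mod n p, pow_add, pow_mul, hω.pow x hx, one_pow, one_mul]
    simp only [tw]
    rw [h1 i, h1 j, hij]
  · simp [tw, hf x hx]
lemma Lin.on_N {p : ℕ} {ω : X → ℂ} (hω : Lin A N p ω) (hNA : N ≤ A) (f : X → ℂ) (i : ℕ) :
    ∀ x ∈ N, tw ω i f x = f x := by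
  intro x hx
  simp [tw, (hω.one_iff x (hNA hx)).2 hx]
lemma prime_ext {p : ℕ} (hp : p.Prime) (hNA : N ≤ A)
    (hN : ∀ b ∈ A, ∀ x, b * x * b⁻¹ ∈ N ↔ x ∈ N) (hcard : Nat.card A = p * Nat.card N)
    {ω : X → ℂ} (hω : Lin A N p ω) {θ χ : X → ℂ} (hθ : Irr N θ) (hinv : ∀ b ∈ A, cj b θ = θ)
    (hχ : Irr A χ) (he : mlt N χ θ ≠ 0) :
    (∀ x ∈ N, χ x = θ x) ∧ (∀ χ', Irr A χ' → mlt N χ' θ ≠ 0 → ∃ i < p, χ' = tw ω i χ) ∧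
      (∀ i j, tw ω i χ = tw ω j χ → i ≡ j [MOD p]) := by
  classical
  set e := mlt N χ θ with hedef
  have hres : ∀ x ∈ N, χ x = e * θ x := fun x hx => clifford_inv hNA hN hθ hχ he hinv hx
  have hNpos : 0 < Nat.card N := Nat.card_pos
  -- freeness of twisting
  have hfree0 : ∀ k, tw ω k χ = χ → p ∣ k := by
    intro k hk
    by_contra hpk
    have hvan : ∀ x, x ∉ N → χ x = 0 := by
      intro x hx
      by_cases hxA : x ∈ A
      · have h1 := congrFun hk x
        simp only [tw] at h1
        by_contra h0
        have h2 : ω x ^ k = 1 := mul_left_cancel₀ h0 (by rw [h1, mul_one])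
        have h3 : orderOf (ω x) ∣ k := orderOf_dvd_of_pow_eq_one h2
        have h4 : orderOf (ω x) ∣ p := orderOf_dvd_of_pow_eq_one (hω.pow x hxA)
        rcases (Nat.dvd_prime hp).1 h4 with h5 | h5
        · exact hx ((hω.one_iff x hxA).1 (orderOf_eq_one_iff.1 h5))
        · exact hpk (h5 ▸ h3)
      · exact hχ.1 x hxA
    have h1 : ip χ χ = (e : ℂ) ^ 2 * Nat.card N := by
      rw [← hθ.norm, ip_supp_left N _ _ hvan, ip_supp_left N _ _ hθ.1, Finset.mul_sum]
      refine Finset.sum_congr rfl fun a _ => ?_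
      rw [hres a a.2, hres _ (a⁻¹).2]; ring
    rw [hχ.norm, hcard] at h1
    have h2 : p * Nat.card N = e ^ 2 * Nat.card N := by exact_mod_cast h1
    have h3 := Nat.eq_of_mul_eq_mul_right hNpos h2
    exact (hp.not_isSquare) ⟨e, by rw [h3, sq]⟩
  have hp0 : 0 < p := hp.pos
  have hfree : ∀ i j, tw ω i χ = tw ω j χ → i ≡ j [MOD p] := by
    intro i j hij
    obtain ⟨m, hm⟩ : ∃ m, m + j ≡ 0 [MOD p] :=
      ⟨p * j - j, by
        rw [Nat.sub_add_cancel (Nat.le_mul_of_pos_left j hp0)]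
        exact (Nat.modEq_zero_iff_dvd.2 (dvd_mul_right p j))⟩
    have h1 : tw ω (m + i) χ = χ := by
      rw [← tw_tw, hij, tw_tw, hω.tw_mod hχ.1 hm, tw_zero]
    have h2 : m + i ≡ m + j [MOD p] :=
      (Nat.modEq_zero_iff_dvd.2 (hfree0 _ h1)).trans hm.symm
    exact Nat.ModEq.add_left_cancel' m h2
  have hsum := sum_sq_mlt hNA hN hθ
  rw [stc_inv A θ hinv, hcard] at hsum
  have hsum2 := Nat.eq_of_mul_eq_mul_right hNpos hsum
  have hmt : ∀ i, mlt N (tw ω i χ) θ = e := by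
    intro i
    apply mlt_congr
    rw [ip_supp_right N _ _ hθ.1, ip_supp_right N _ _ hθ.1]
    exact Finset.sum_congr rfl fun a _ => by rw [hω.on_N hNA χ i a a.2]
  let I : Finset (X → ℂ) := (Finset.range p).image (fun i => tw ω i χ)
  have hI : I ⊆ irr A := by
    intro f hf
    obtain ⟨i, _, rfl⟩ := Finset.mem_image.1 hf
    exact mem_irr.2 (hω.twist hχ i)
  have hIsum : ∑ f ∈ I, mlt N f θ * mlt N f θ = p * (e * e) := by
    rw [Finset.sum_image]
    · simp [hmt]
    · intro i hi j hj hij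
      have := hfree i j hij
      have hi' : i < p := by simpa using hi
      have hj' : j < p := by simpa using hj
      exact Nat.ModEq.eq_of_lt_of_lt this hi' hj'
  have hle : p * (e * e) ≤ p := by
    rw [← hIsum, ← hsum2]
    exact Finset.sum_le_sum_of_subset hI
  have he1 : e = 1 := by
    have h1 : e * e ≤ 1 := Nat.le_of_mul_le_mul_left (by simpa using hle) hp0
    have : e ≤ 1 := by nlinarith
    omega
  refine ⟨fun x hx => by rw [hres x hx, he1]; simp, ?_, hfree⟩
  intro χ' hχ' he'
  by_contra hcon
  have hnot : χ' ∉ I := by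
    intro h
    obtain ⟨i, hi, rfl⟩ := Finset.mem_image.1 h
    exact hcon ⟨i, by simpa using hi, rfl⟩
  have h1 : ∑ f ∈ insert χ' I, mlt N f θ * mlt N f θ ≤ p := by
    rw [← hsum2]
    apply Finset.sum_le_sum_of_subset
    intro f hf
    rcases Finset.mem_insert.1 hf with rfl | hf
    · exact mem_irr.2 hχ'
    · exact hI hf
  rw [Finset.sum_insert hnot, hIsum, he1] at h1
  have : 0 < mlt N χ' θ * mlt N χ' θ :=
    Nat.mul_pos (Nat.pos_of_ne_zero he') (Nat.pos_of_ne_zero he')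
  omega
/-- If all twists are summed we get the multiplicity of the smaller character. -/
lemma mlt_sum_tw {p : ℕ} (hp : p.Prime) (hNA : N ≤ A) (hAB : A ≤ B)
    (hcard : Nat.card A = p * Nat.card N)
    {ω : X → ℂ} (hω : Lin A N p ω) {θ lam ψ : X → ℂ} (hθ : Irr N θ) (hl : Irr A lam)
    (hr : ∀ x ∈ N, lam x = θ x) (hψ : Irr B ψ) :
    mlt N ψ θ = ∑ i ∈ Finset.range p, mlt A ψ (tw ω i lam) := by
  classical
  have h1 : ∀ x, ∑ i ∈ Finset.range p, tw ω i lam x = p * θ x := by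
    intro x
    by_cases hx : x ∈ N
    · rw [Finset.sum_congr rfl (fun i _ => hω.on_N hNA lam i x hx), hr x hx]; simp
    · rw [hθ.1 x hx, mul_zero]
      by_cases hxA : x ∈ A
      · simp only [tw]
        rw [← Finset.mul_sum]
        have h2 : ω x ≠ 1 := fun h => hx ((hω.one_iff x hxA).1 h)
        rw [geom_sum_eq h2, hω.pow x hxA]; simp
      · simp [tw, hl.1 x hxA]
  have h2 : ∑ i ∈ Finset.range p, ip ψ (tw ω i lam) = p * ip ψ θ := by
    unfold ip
    rw [Finset.sum_comm, Finset.mul_sum]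
    refine Finset.sum_congr rfl fun x _ => ?_
    rw [← Finset.mul_sum, h1]; ring
  rw [Finset.sum_congr rfl (fun i _ => mlt_spec hAB hψ (hω.twist hl i)),
    mlt_spec (hNA.trans hAB) hψ hθ, ← Finset.sum_mul, hcard] at h2
  have h3 : (∑ i ∈ Finset.range p, mlt A ψ (tw ω i lam)) * (p * Nat.card N) =
      mlt N ψ θ * (p * Nat.card N) := by
    have h4 : ((∑ i ∈ Finset.range p, mlt A ψ (tw ω i lam) : ℕ) : ℂ) * ((p * Nat.card N : ℕ) : ℂ) =
      (mlt N ψ θ : ℂ) * ((p * Nat.card N : ℕ) : ℂ) := by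
      push_cast at h2 ⊢
      rw [h2]; ring
    exact_mod_cast h4
  exact (Nat.eq_of_mul_eq_mul_right (Nat.mul_pos hp.pos Nat.card_pos) h3).symm
end Clifford

section PiGram
variable {X Q : Type} [Group X] [Fintype X] [Group Q] [Fintype Q] (π : X →* Q)
lemma card_pi (hπ : Function.Surjective π) (P : Q → Prop) [DecidablePred P]
    [DecidablePred (fun b : X => P (π b))] :
    (Finset.univ.filter (fun b : X => P (π b))).card =
      Nat.card π.ker * (Finset.univ.filter P).card := by
  classical
  have h1 : ∀ x ∈ Finset.univ.filter (fun b : X => P (π b)), π x ∈ Finset.univ.filter P := by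
    intro x hx; simpa using hx
  rw [Finset.card_eq_sum_card_fiberwise h1, Finset.sum_congr rfl (g := fun _ => Nat.card π.ker)]
  · rw [Finset.sum_const, smul_eq_mul, mul_comm]
  · intro q hq
    obtain ⟨y, rfl⟩ := hπ q
    rw [← card_filter_mem]
    refine Finset.card_bij (fun x _ => x * y⁻¹) ?_ ?_ ?_
    · intro x hx
      simp only [Finset.mem_filter, Finset.mem_univ, true_and] at hx ⊢
      rw [MonoidHom.mem_ker, map_mul, hx.2, ← map_mul, mul_inv_cancel, map_one]
    · intro a _ b _ h; exact mul_right_cancel h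
    · intro n hn
      simp only [Finset.mem_filter, Finset.mem_univ, true_and, MonoidHom.mem_ker] at hn hq
      refine ⟨n * y, ?_, by simp⟩
      simp [hn, hq]
/-- stabiliser in `X` -/
def stabX (θ : X → ℂ) : Subgroup X where
  carrier := {b | cj b θ = θ}
  one_mem' := cj_one θ
  mul_mem' := by
    intro a b ha hb
    simp only [Set.mem_ofPred_eq] at *
    rw [← cj_cj, ha, hb]
  inv_mem' := by
    intro a ha
    simp only [Set.mem_ofPred_eq] at *
    conv_lhs => rw [← ha]
    rw [cj_cj, mul_inv_cancel, cj_one]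
lemma mem_stabX {θ : X → ℂ} {b : X} : b ∈ stabX θ ↔ cj b θ = θ := Iff.rfl
/-- stabiliser in `Q` -/
def stq (θ : X → ℂ) : Subgroup Q := (stabX θ).map π
variable {π}
lemma mem_stq {θ : X → ℂ} (hθ : Irr π.ker θ) (b : X) : π b ∈ stq π θ ↔ cj b θ = θ := by
  constructor
  · rintro ⟨a, ha, hab⟩
    have h1 : b * a⁻¹ ∈ π.ker := by rw [MonoidHom.mem_ker]; simp [hab]
    have h2 := hθ.cj_mem h1
    have h3 : b = (b * a⁻¹) * a := by group
    rw [h3, ← cj_cj, h2]; exact ha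
  · intro h; exact ⟨b, h, rfl⟩
lemma stc_top (hπ : Function.Surjective π) {θ : X → ℂ} (hθ : Irr π.ker θ) :
    stc ⊤ θ = Nat.card π.ker * Nat.card (stq π θ) := by
  classical
  unfold stc
  rw [← card_filter_mem (B := stq π θ), ← card_pi π hπ]
  congr 1
  ext b
  simp [mem_stq hθ]
lemma ker_nrm (b x : X) : b * x * b⁻¹ ∈ π.ker ↔ x ∈ π.ker := by
  simp [MonoidHom.mem_ker]
lemma sum_sq_top (hπ : Function.Surjective π) {θ : X → ℂ} (hθ : Irr π.ker θ) :
    ∑ ψ ∈ irr (⊤ : Subgroup X), mlt π.ker ψ θ * mlt π.ker ψ θ = Nat.card (stq π θ) := by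
  have h1 := sum_sq_mlt (B := ⊤) le_top (fun b _ x => ker_nrm (π := π) b x) hθ
  rw [stc_top hπ hθ, mul_comm] at h1
  exact Nat.eq_of_mul_eq_mul_left Nat.card_pos h1
lemma card_X (hπ : Function.Surjective π) : Nat.card X = Nat.card π.ker * Nat.card Q := by
  classical
  have := card_pi π hπ (fun _ => True)
  simpa [Nat.card_eq_fintype_card] using this
lemma deg_top (hπ : Function.Surjective π) {θ ψ : X → ℂ} (hθ : Irr π.ker θ) (hψ : Irr ⊤ ψ)
    (he : mlt π.ker ψ θ ≠ 0) :
    dg ψ * Nat.card (stq π θ) = mlt π.ker ψ θ * Nat.card Q * dg θ := by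
  have h1 := clifford_deg (B := ⊤) le_top (fun b _ x => ker_nrm (π := π) b x) hθ hψ he
  rw [stc_top hπ hθ, Subgroup.card_top, card_X hπ] at h1
  apply Nat.eq_of_mul_eq_mul_left (Nat.card_pos (α := π.ker))
  linarith [h1]
lemma sub_prime {N C A : Subgroup X} {p : ℕ} (hp : p.Prime) (hNC : N ≤ C) (hCA : C ≤ A)
    (hcard : Nat.card A = p * Nat.card N) : C = N ∨ C = A := by
  obtain ⟨a, ha⟩ := Subgroup.card_dvd_of_le hNC
  obtain ⟨b, hb⟩ := Subgroup.card_dvd_of_le hCA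
  have hN : 0 < Nat.card N := Nat.card_pos
  have h1 : a * b = p := by
    apply Nat.eq_of_mul_eq_mul_left hN
    rw [mul_comm _ p, ← hcard, hb, ha, mul_assoc]
  rcases (Nat.dvd_prime hp).1 (Dvd.intro _ h1) with h | h
  · left
    subst h
    exact (Subgroup.eq_of_le_of_card_ge hNC (by rw [ha, mul_one])).symm
  · right
    subst h
    have : b = 1 := by
      have := hp.pos
      nlinarith [Nat.eq_of_mul_eq_mul_left this (h1.trans (mul_one _).symm)]
    exact Subgroup.eq_of_le_of_card_ge hCA (by rw [hb, this, mul_one])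
/-- `b` normalises `A` -/
def nrm (A : Subgroup X) (b : X) : Prop := ∀ x, b * x * b⁻¹ ∈ A ↔ x ∈ A
lemma inter_eq {N A : Subgroup X} {p : ℕ} (hp : p.Prime) (hNA : N ≤ A)
    (hcard : Nat.card A = p * Nat.card N) (hN : ∀ b x : X, b * x * b⁻¹ ∈ N ↔ x ∈ N)
    {b : X} (hb : ¬ nrm A b) (x : X) (hx : x ∈ A) (hx' : b * x * b⁻¹ ∈ A) : x ∈ N := by
  let C : Subgroup X := A ⊓ A.comap (MulAut.conj b).toMonoidHom
  have hC : N ≤ C := by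
    intro y hy
    exact ⟨hNA hy, by simpa using hNA ((hN b y).2 hy)⟩
  have hCA : C ≤ A := fun y hy => hy.1
  rcases sub_prime hp hC hCA hcard with h | h
  · rw [← h]; exact ⟨hx, by simpa using hx'⟩
  · exfalso
    apply hb
    have h1 : A ≤ A.comap (MulAut.conj b).toMonoidHom := by
      intro y hy; rw [← h] at hy; exact hy.2
    have h2 : A = A.comap (MulAut.conj b).toMonoidHom := by
      apply Subgroup.eq_of_le_of_card_ge h1
      have : A.comap (MulAut.conj b).toMonoidHom = A.map (MulAut.conj b).symm.toMonoidHom :=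
        (Subgroup.map_equiv_eq_comap_symm (MulAut.conj b).symm A).symm
      rw [this]
      exact (Subgroup.card_map_of_injective (MulAut.conj b).symm.injective).le
    intro y
    constructor
    · intro hy; rw [h2]; simpa using hy
    · intro hy; simpa using h1 hy
open Classical in
lemma prime_gram {N A : Subgroup X} {p : ℕ} (hp : p.Prime) (hNA : N ≤ A)
    (hcard : Nat.card A = p * Nat.card N) (hN : ∀ b x : X, b * x * b⁻¹ ∈ N ↔ x ∈ N)
    {θ lam lam' : X → ℂ} (hθ : Irr N θ) (hl : Irr A lam) (hl' : Irr A lam')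
    (hr : ∀ x ∈ N, lam x = θ x) (hr' : ∀ x ∈ N, lam' x = θ x) :
    (∑ ψ ∈ irr (⊤ : Subgroup X), mlt A ψ lam * mlt A ψ lam') * p * p * Nat.card N =
      (Finset.univ.filter (fun b : X => cj b θ = θ ∧ ¬ nrm A b)).card +
      p * (Finset.univ.filter (fun b : X => nrm A b ∧ cj b lam' = lam)).card := by
  have h1 := gram (B := ⊤) (le_top : A ≤ ⊤) (le_top : A ≤ ⊤) hl hl'
  have h2 : ∀ b : X, ip (cj b lam') lam =
      (if cj b θ = θ ∧ ¬ nrm A b then (Nat.card N : ℂ) else 0) +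
      (if nrm A b ∧ cj b lam' = lam then (Nat.card A : ℂ) else 0) := by
    intro b
    by_cases hb : nrm A b
    · rw [(hl'.conj b hb).ip_eq hl]
      simp [hb]
    · simp only [hb, not_false_eq_true, and_true, false_and, if_false, add_zero]
      rw [← (hθ.conj b (hN b)).ip_eq hθ]
      unfold ip
      refine Finset.sum_congr rfl fun x _ => ?_
      by_cases hx : x ∈ N
      · simp only [cj]
        rw [hr' _ ((hN b x).2 hx), hr _ (N.inv_mem hx)]
      · rw [hθ.1 x⁻¹ (fun h => hx (by simpa using N.inv_mem h)), mul_zero]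
        by_cases hxA : x ∈ A
        · have : b * x * b⁻¹ ∉ A := fun h => hx (inter_eq hp hNA hcard hN hb x hxA h)
          rw [cj, hl'.1 _ this, zero_mul]
        · rw [hl.1 x⁻¹ (fun h => hxA (by simpa using A.inv_mem h)), mul_zero]
  rw [Finset.sum_congr rfl (fun b _ => h2 b), Finset.sum_add_distrib, ← Finset.sum_filter,
    ← Finset.sum_filter, Finset.filter_filter, Finset.filter_filter, Finset.sum_const,
    Finset.sum_const, nsmul_eq_mul, nsmul_eq_mul, hcard] at h1
  simp only [Subgroup.mem_top, true_and] at h1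
  have h3 := card_ne N
  push_cast at h1
  have h4 : (((∑ ψ ∈ irr (⊤ : Subgroup X), mlt A ψ lam * mlt A ψ lam') * p * p * Nat.card N : ℕ) : ℂ) =
      (((Finset.univ.filter (fun b : X => cj b θ = θ ∧ ¬ nrm A b)).card +
      p * (Finset.univ.filter (fun b : X => nrm A b ∧ cj b lam' = lam)).card : ℕ) : ℂ) := by
    push_cast
    apply mul_right_cancel₀ h3
    linear_combination h1
  exact_mod_cast h4
lemma mem_comap_zp {c : Q} {x : X} :
    x ∈ (Subgroup.zpowers c).comap π ↔ ∃ i : ℕ, π x = c ^ i := by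
  rw [Subgroup.mem_comap, ← mem_powers_iff_mem_zpowers, Submonoid.mem_powers_iff]
  exact ⟨fun ⟨n, h⟩ => ⟨n, h.symm⟩, fun ⟨n, h⟩ => ⟨n, h.symm⟩⟩
lemma card_comap (hπ : Function.Surjective π) (S : Subgroup Q) :
    Nat.card (S.comap π) = Nat.card S * Nat.card π.ker := by
  classical
  rw [mul_comm, ← card_filter_mem (B := S), ← card_pi π hπ, ← card_filter_mem]
  rfl
lemma ker_le_comap (S : Subgroup Q) : π.ker ≤ S.comap π := by
  intro x hx
  rw [MonoidHom.mem_ker] at hx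
  simp [Subgroup.mem_comap, hx, S.one_mem]
lemma ex_lin {p : ℕ} (hp : 0 < p) {c : Q} (hc : orderOf c = p) :
    ∃ ω : X → ℂ, Lin ((Subgroup.zpowers c).comap π) π.ker p ω ∧
      ∀ x y (k : ℕ), x ∈ (Subgroup.zpowers c).comap π → π y = π x ^ k → ω y = ω x ^ k := by
  classical
  set ζ := Complex.exp (2 * Real.pi * Complex.I / p) with hζ
  have hprim : IsPrimitiveRoot ζ p := Complex.isPrimitiveRoot_exp p hp.ne'
  let ω : X → ℂ := fun x => if h : ∃ i : ℕ, π x = c ^ i then ζ ^ h.choose else 0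
  have hmod : ∀ i j : ℕ, c ^ i = c ^ j → ζ ^ i = ζ ^ j := by
    intro i j h
    rw [pow_eq_pow_iff_modEq, hc] at h
    rw [← pow_mod_orderOf, hprim.eq_orderOf.symm, h]
    conv_rhs => rw [← pow_mod_orderOf, hprim.eq_orderOf.symm]
  have hval : ∀ x (i : ℕ), π x = c ^ i → ω x = ζ ^ i := by
    intro x i h
    have hex : ∃ i : ℕ, π x = c ^ i := ⟨i, h⟩
    simp only [ω, dif_pos hex]
    exact hmod _ _ (hex.choose_spec.symm.trans h)
  refine ⟨ω, ⟨?_, ?_, ?_⟩, ?_⟩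
  · intro a ha b hb
    obtain ⟨i, hi⟩ := mem_comap_zp.1 ha
    obtain ⟨j, hj⟩ := mem_comap_zp.1 hb
    rw [hval a i hi, hval b j hj, hval (a * b) (i + j) (by rw [map_mul, hi, hj, pow_add]), pow_add]
  · intro a ha
    obtain ⟨i, hi⟩ := mem_comap_zp.1 ha
    rw [hval a i hi, MonoidHom.mem_ker, hi, hprim.pow_eq_one_iff_dvd, ← hc, orderOf_dvd_iff_pow_eq_one]
  · intro a ha
    obtain ⟨i, hi⟩ := mem_comap_zp.1 ha
    rw [hval a i hi, ← pow_mul, mul_comm, pow_mul, hprim.pow_eq_one, one_pow]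
  · intro x y k hx hy
    obtain ⟨i, hi⟩ := mem_comap_zp.1 hx
    rw [hval x i hi, hval y (i * k) (by rw [hy, hi, pow_mul]), pow_mul]
lemma nrm_comap (hπ : Function.Surjective π) (S : Subgroup Q) (b : X) :
    nrm (S.comap π) b ↔ nrm S (π b) := by
  unfold nrm
  constructor
  · intro h q
    obtain ⟨x, rfl⟩ := hπ q
    simpa using h x
  · intro h x
    simpa using h (π x)
end PiGram

section PrimeGram
variable {X Q : Type} [Group X] [Fintype X] [Group Q] [Fintype Q] {π : X →* Q}
lemma nrm_of_le {S : Subgroup Q} {q : Q} (h : ∀ x ∈ S, q * x * q⁻¹ ∈ S) : nrm S q := by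
  have h1 : S.map (MulAut.conj q).toMonoidHom ≤ S := by
    rintro _ ⟨x, hx, rfl⟩
    simpa using h x hx
  have h2 : S.map (MulAut.conj q).toMonoidHom = S := by
    apply Subgroup.eq_of_le_of_card_ge h1
    exact (Subgroup.card_map_of_injective (MulAut.conj q).injective).ge
  intro x
  constructor
  · intro hx
    rw [← h2] at hx
    obtain ⟨y, hy, hxy⟩ := hx
    have : y = x := by simpa using hxy
    rwa [← this]
  · exact h x
lemma conj_pow_k {q c : Q} {k : ℕ} (h : q * c * q⁻¹ = c ^ k) (i : ℕ) :
    q * c ^ i * q⁻¹ = c ^ (k * i) := by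
  rw [← conj_pow, h, pow_mul]
lemma nrm_zp {q c : Q} {k : ℕ} (h : q * c * q⁻¹ = c ^ k) : nrm (Subgroup.zpowers c) q := by
  apply nrm_of_le
  intro x hx
  rw [← mem_powers_iff_mem_zpowers, Submonoid.mem_powers_iff] at hx ⊢
  obtain ⟨i, rfl⟩ := hx
  exact ⟨k * i, (conj_pow_k h i).symm⟩
lemma exists_k {q c : Q} (h : nrm (Subgroup.zpowers c) q) :
    ∃ k < orderOf c, q * c * q⁻¹ = c ^ k := by
  have h1 := (h c).2 (Subgroup.mem_zpowers c)
  rw [← mem_powers_iff_mem_zpowers, Submonoid.mem_powers_iff] at h1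
  obtain ⟨i, hi⟩ := h1
  refine ⟨i % orderOf c, Nat.mod_lt _ (orderOf_pos c), ?_⟩
  rw [pow_mod_orderOf, hi]
/-- Extension data: `lam` extends `θ` to the preimage of the group generated by `c`. -/
structure ED (π : X →* Q) (θ : X → ℂ) (c : Q) (p : ℕ) (ω lam : X → ℂ) : Prop where
  surj : Function.Surjective π
  hp : p.Prime
  ord : orderOf c = p
  hθ : Irr π.ker θ
  cst : c ∈ stq π θ
  lin : Lin ((Subgroup.zpowers c).comap π) π.ker p ω
  pw : ∀ x y (k : ℕ), x ∈ (Subgroup.zpowers c).comap π → π y = π x ^ k → ω y = ω x ^ k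
  hirr : Irr ((Subgroup.zpowers c).comap π) lam
  res : ∀ x ∈ π.ker, lam x = θ x
variable {θ : X → ℂ} {c : Q} {p : ℕ} {ω lam : X → ℂ}
lemma stab_A (hθ : Irr π.ker θ) (cst : c ∈ stq π θ) :
    ∀ b ∈ (Subgroup.zpowers c).comap π, cj b θ = θ := by
  intro b hb
  rw [← mem_stq hθ]
  exact (Subgroup.zpowers_le.2 cst) hb
lemma card_A (hπ : Function.Surjective π) (hc : orderOf c = p) :
    Nat.card ((Subgroup.zpowers c).comap π) = p * Nat.card π.ker := by
  rw [card_comap hπ, Nat.card_zpowers, hc]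
lemma exists_ED (hπ : Function.Surjective π) (hp : p.Prime) (hc : orderOf c = p)
    (hθ : Irr π.ker θ) (cst : c ∈ stq π θ) : ∃ ω lam, ED π θ c p ω lam := by
  obtain ⟨ω, h1, h2⟩ := ex_lin (π := π) hp.pos hc
  obtain ⟨lam, h3, h4⟩ := exists_over (B := (Subgroup.zpowers c).comap π) (ker_le_comap _)
    (fun b _ x => ker_nrm b x) hθ
  exact ⟨ω, lam, hπ, hp, hc, hθ, cst, h1, h2, h3,
    (prime_ext hp (ker_le_comap _) (fun b _ x => ker_nrm b x) (card_A hπ hc) h1 hθ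
      (stab_A hθ cst) h3 h4).1⟩
lemma ED.inj (h : ED π θ c p ω lam) {i j : ℕ} (hij : tw ω i lam = tw ω j lam) : i ≡ j [MOD p] := by
  refine (prime_ext h.hp (ker_le_comap _) (fun b _ x => ker_nrm b x) (card_A h.surj h.ord) h.lin h.hθ
      (stab_A h.hθ h.cst) h.hirr ?_).2.2 i j hij
  rw [mlt_ext (ker_le_comap (π := π) (Subgroup.zpowers c)) h.hθ h.res]; exact one_ne_zero
lemma ED.tw_iff (h : ED π θ c p ω lam) {i j : ℕ} : tw ω i lam = tw ω j lam ↔ i ≡ j [MOD p] :=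
  ⟨h.inj, fun hij => h.lin.tw_mod h.hirr.1 hij⟩
lemma ED.twist (h : ED π θ c p ω lam) (i : ℕ) : ED π θ c p ω (tw ω i lam) :=
  ⟨h.surj, h.hp, h.ord, h.hθ, h.cst, h.lin, h.pw, h.lin.twist h.hirr i, fun x hx => by
    rw [h.lin.on_N (ker_le_comap _) lam i x hx, h.res x hx]⟩
lemma ED.cj0 (h : ED π θ c p ω lam) {b : X} (hb : nrm (Subgroup.zpowers c) (π b))
    (hs : cj b θ = θ) : ∃ j < p, cj b lam = tw ω j lam := by
  have hr : ∀ x ∈ π.ker, cj b lam x = θ x := by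
    intro x hx
    have := h.res _ ((ker_nrm b x).2 hx)
    rw [cj, this, ← congrFun hs x]; rfl
  refine (prime_ext h.hp (ker_le_comap _) (fun b _ x => ker_nrm b x) (card_A h.surj h.ord) h.lin h.hθ
      (stab_A h.hθ h.cst) h.hirr ?_).2.1 _ (h.hirr.conj b ((nrm_comap h.surj _ b).2 hb)) ?_
  · rw [mlt_ext (ker_le_comap (π := π) (Subgroup.zpowers c)) h.hθ h.res]; exact one_ne_zero
  · rw [mlt_ext (ker_le_comap (π := π) (Subgroup.zpowers c)) h.hθ hr]; exact one_ne_zero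
lemma ED.cj_tw (h : ED π θ c p ω lam) {b : X} {k : ℕ} (hk : π b * c * (π b)⁻¹ = c ^ k) (i : ℕ) :
    cj b (tw ω i lam) = tw ω (k * i) (cj b lam) := by
  ext x
  by_cases hx : x ∈ (Subgroup.zpowers c).comap π
  · have h1 : ω (b * x * b⁻¹) = ω x ^ k := by
      apply h.pw x _ k hx
      obtain ⟨n, hn⟩ := mem_comap_zp.1 hx
      rw [map_mul, map_mul, map_inv, hn, conj_pow_k hk, ← pow_mul, mul_comm]
    simp only [cj, tw, h1, ← pow_mul]
  · have h2 : b * x * b⁻¹ ∉ (Subgroup.zpowers c).comap π := fun h' =>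
      hx (((nrm_comap h.surj _ b).2 (nrm_zp hk) x).1 h')
    simp [cj, tw, h.hirr.1 _ h2]
open Classical in
lemma ED.gram (h : ED π θ c p ω lam) (i j : ℕ) :
    (∑ ψ ∈ irr (⊤ : Subgroup X), mlt ((Subgroup.zpowers c).comap π) ψ (tw ω i lam) *
        mlt ((Subgroup.zpowers c).comap π) ψ (tw ω j lam)) * p * p * Nat.card π.ker =
      Nat.card π.ker *
        (Finset.univ.filter (fun q : Q => q ∈ stq π θ ∧ ¬ nrm (Subgroup.zpowers c) q)).card +
      p * (Finset.univ.filter (fun b : X => nrm (Subgroup.zpowers c) (π b) ∧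
        cj b (tw ω j lam) = tw ω i lam)).card := by
  rw [prime_gram h.hp (ker_le_comap _) (card_A h.surj h.ord) ker_nrm h.hθ (h.twist i).hirr
    (h.twist j).hirr (h.twist i).res (h.twist j).res, ← card_pi π h.surj]
  simp only [mem_stq h.hθ, nrm_comap h.surj]
lemma ED.sum (h : ED π θ c p ω lam) {ψ : X → ℂ} (hψ : Irr ⊤ ψ) :
    mlt π.ker ψ θ = ∑ i ∈ Finset.range p, mlt ((Subgroup.zpowers c).comap π) ψ (tw ω i lam) :=
  mlt_sum_tw h.hp (ker_le_comap _) le_top (card_A h.surj h.ord) h.lin h.hθ h.hirr h.res hψ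
lemma ED.stab_of (h : ED π θ c p ω lam) {b : X} {i : ℕ} (hb : cj b (tw ω i lam) = tw ω i lam) :
    cj b θ = θ := by
  ext x
  by_cases hx : x ∈ π.ker
  · have h1 := congrFun hb x
    rw [cj, (h.twist i).res _ ((ker_nrm b x).2 hx), (h.twist i).res x hx] at h1
    exact h1
  · rw [h.hθ.1 x hx, cj, h.hθ.1 _ (fun h' => hx ((ker_nrm b x).1 h'))]
lemma c3_arith (a b c : ℕ) : (a + b + c) * (a + b + c) + (if 3 ∣ a + b + c then 0 else 2) ≤
    3 * (a * a + b * b + c * c) := by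
  zify
  have key : 3 * ((a:ℤ) * a + b * b + c * c) - (a + b + c) * (a + b + c) =
    (a - b) * (a - b) + (b - c) * (b - c) + (a - c) * (a - c) := by ring
  split_ifs with h
  · simp only [Nat.cast_zero, add_zero]; nlinarith [mul_self_nonneg ((a:ℤ) - b), mul_self_nonneg ((b:ℤ) - c), mul_self_nonneg ((a:ℤ) - c)]
  · have hsq : ∀ x : ℤ, x ≠ 0 → 1 ≤ x * x := fun x hx => by
      have := mul_self_pos.2 hx; omega
    have h0 := fun x : ℤ => mul_self_nonneg x
    have h1 := h0 (a - b); have h2 := h0 (b - c); have h3 := h0 (a - c)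
    by_cases e1 : (a:ℤ) - b = 0
    · by_cases e2 : (b:ℤ) - c = 0
      · exfalso; apply h; omega
      · have := hsq _ e2; have := hsq (a - c) (by omega); linarith
    · have g := hsq _ e1
      by_cases e2 : (b:ℤ) - c = 0
      · have := hsq (a - c) (by omega); linarith
      · have := hsq _ e2; linarith
open Classical in
lemma ED.c3 (h : ED π θ c 3 ω lam) :
    ((irr (⊤ : Subgroup X)).filter (fun ψ => ¬ 3 ∣ mlt π.ker ψ θ)).card ≤
      (Finset.univ.filter (fun q : Q => q ∈ stq π θ ∧ q * c = c * q)).card := by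
  set A := (Subgroup.zpowers c).comap π with hA
  set D := (Finset.univ.filter (fun q : Q => q ∈ stq π θ ∧ ¬ nrm (Subgroup.zpowers c) q)).card with hD
  set E := (Finset.univ.filter (fun q : Q => q ∈ stq π θ ∧ nrm (Subgroup.zpowers c) q)).card with hE
  set C := (Finset.univ.filter (fun q : Q => q ∈ stq π θ ∧ q * c = c * q)).card with hC
  have hDE : D + E = Nat.card (stq π θ) := by
    rw [← card_filter_mem, hD, hE, add_comm, ← Finset.filter_filter, ← Finset.filter_filter]
    exact Finset.card_filter_add_card_filter_not _
  have hfix : ∀ b : X, (∑ i ∈ Finset.range 3, if nrm (Subgroup.zpowers c) (π b) ∧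
        cj b (tw ω i lam) = tw ω i lam then 1 else 0) ≤
      (if π b ∈ stq π θ ∧ nrm (Subgroup.zpowers c) (π b) then 1 else 0) +
      2 * (if π b ∈ stq π θ ∧ π b * c = c * π b then 1 else 0) := by
    intro b
    by_cases hb : π b ∈ stq π θ ∧ nrm (Subgroup.zpowers c) (π b)
    · rw [if_pos hb]
      obtain ⟨k, hk3, hk⟩ := exists_k hb.2
      rw [h.ord] at hk3
      obtain ⟨j, hj3, hj⟩ := h.cj0 hb.2 ((mem_stq h.hθ b).1 hb.1)
      have hval : ∀ i, cj b (tw ω i lam) = tw ω i lam ↔ (k * i + j) % 3 = i % 3 := by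
        intro i
        rw [h.cj_tw hk, hj, tw_tw, h.tw_iff]; rfl
      simp only [hval, Finset.sum_range_succ, Finset.sum_range_zero, hb.2, true_and]
      have hk0 : k ≠ 0 := by
        rintro rfl
        rw [pow_zero, mul_inv_eq_one, mul_eq_left] at hk
        have := h.ord
        rw [hk, orderOf_one] at this
        omega
      by_cases hc : π b * c = c * π b
      · have hcc : π b ∈ stq π θ ∧ π b * c = c * π b := ⟨hb.1, hc⟩
        rw [if_pos hcc]
        split_ifs <;> omega
      · have hcc : ¬ (π b ∈ stq π θ ∧ π b * c = c * π b) := fun h' => hc h'.2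
        rw [if_neg hcc]
        have hk1 : k ≠ 1 := by
          rintro rfl
          rw [pow_one, mul_inv_eq_iff_eq_mul] at hk
          exact hc hk
        have hk2 : k = 2 := by omega
        subst hk2
        split_ifs <;> omega
    · rw [if_neg hb, Finset.sum_eq_zero]
      · omega
      · intro i _
        rw [if_neg]
        rintro ⟨h1, h2⟩
        exact hb ⟨(mem_stq h.hθ b).2 (h.stab_of h2), h1⟩
  have hsumfix : ∑ i ∈ Finset.range 3, (Finset.univ.filter (fun b : X => nrm (Subgroup.zpowers c) (π b) ∧
        cj b (tw ω i lam) = tw ω i lam)).card ≤ Nat.card π.ker * E + 2 * (Nat.card π.ker * C) := by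
    rw [hE, hC, ← card_pi π h.surj, ← card_pi π h.surj]
    simp only [Finset.card_filter]
    rw [Finset.sum_comm, Finset.mul_sum, ← Finset.sum_add_distrib]
    exact Finset.sum_le_sum fun b _ => hfix b
  have hG : ∀ i, (∑ ψ ∈ irr (⊤ : Subgroup X), mlt A ψ (tw ω i lam) * mlt A ψ (tw ω i lam)) * 9 *
      Nat.card π.ker = Nat.card π.ker * D + 3 * (Finset.univ.filter (fun b : X =>
        nrm (Subgroup.zpowers c) (π b) ∧ cj b (tw ω i lam) = tw ω i lam)).card := by
    intro i
    rw [← h.gram i i]; ring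
  have hψ : ∀ ψ ∈ irr (⊤ : Subgroup X), mlt π.ker ψ θ * mlt π.ker ψ θ +
      (if ¬ 3 ∣ mlt π.ker ψ θ then 1 else 0) * 2 ≤
      3 * (mlt A ψ (tw ω 0 lam) * mlt A ψ (tw ω 0 lam) + mlt A ψ (tw ω 1 lam) * mlt A ψ (tw ω 1 lam)
        + mlt A ψ (tw ω 2 lam) * mlt A ψ (tw ω 2 lam)) := by
    intro ψ hψ
    have h1 := h.sum (mem_irr.1 hψ)
    simp only [Finset.sum_range_succ, Finset.sum_range_zero, zero_add] at h1
    rw [h1]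
    refine le_trans (le_of_eq ?_) (c3_arith _ _ _)
    congr 1
    split_ifs <;> simp_all
  have hsum := Finset.sum_le_sum hψ
  rw [Finset.sum_add_distrib, sum_sq_top h.surj h.hθ, ← Finset.sum_mul, ← Finset.card_filter,
    ← Finset.mul_sum, Finset.sum_add_distrib, Finset.sum_add_distrib] at hsum
  simp only [Finset.sum_range_succ, Finset.sum_range_zero, zero_add] at hsumfix
  have g0 := hG 0; have g1 := hG 1; have g2 := hG 2
  have hNpos : 0 < Nat.card π.ker := Nat.card_pos
  generalize Nat.card π.ker = n at *
  have hsum2 := Nat.mul_le_mul_right (3 * n) hsum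
  have : n * (6 * ((irr (⊤ : Subgroup X)).filter (fun ψ => ¬ 3 ∣ mlt π.ker ψ θ)).card) ≤ n * (6 * C) := by
    rw [← hDE] at hsum2
    nlinarith
  have := Nat.le_of_mul_le_mul_left this hNpos
  omega
/-- some twist is invariant under `t` -/
lemma ED.fix_twist (h₁ : ED π θ c p ω lam) {t : Q} (tst : t ∈ stq π θ) {k : ℕ}
    (hk : t * c * t⁻¹ = c ^ k) (hk1 : ¬ k ≡ 1 [MOD p]) :
    ∃ i, ∀ b, π b = t → cj b (tw ω i lam) = tw ω i lam := by
  classical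
  obtain ⟨τ, rfl⟩ := h₁.surj t
  have := Fact.mk h₁.hp
  obtain ⟨j, -, hj⟩ := h₁.cj0 (nrm_zp hk) ((mem_stq h₁.hθ τ).1 tst)
  obtain ⟨i, hi⟩ : ∃ i : ℕ, k * i + j ≡ i [MOD p] := by
    have hne : (1 - k : ZMod p) ≠ 0 := by
      intro h0
      apply hk1
      rw [← ZMod.natCast_eq_natCast_iff]
      push_cast
      linear_combination -h0
    refine ⟨((j : ZMod p) / (1 - k)).val, ?_⟩
    rw [← ZMod.natCast_eq_natCast_iff]
    push_cast
    rw [ZMod.natCast_val, ZMod.cast_id]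
    field_simp
    ring
  refine ⟨i, ?_⟩
  set lam' := tw ω i lam with hlam
  have h : ED π θ c p ω lam' := h₁.twist i
  have hfix : cj τ lam' = lam' := by
    rw [hlam, h₁.cj_tw hk, hj, tw_tw]
    exact h₁.tw_iff.2 hi
  intro b hb
  have h1 : b * τ⁻¹ ∈ (Subgroup.zpowers c).comap π := by
    rw [Subgroup.mem_comap]; simp [hb, Subgroup.one_mem]
  have h3 : b = (b * τ⁻¹) * τ := by group
  rw [h3, ← cj_cj, h.hirr.cj_mem h1, hfix]
lemma ED.gram_fix (h : ED π θ c p ω lam) {t : Q} (tst : t ∈ stq π θ) {k d : ℕ}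
    (hk : t * c * t⁻¹ = c ^ k)
    (hfix' : ∀ b, π b = t → cj b lam = lam)
    (hN : ∀ q ∈ stq π θ, nrm (Subgroup.zpowers c) q → ∃ x, ∃ s < d, q = c ^ x * t ^ s)
    (hd : ∀ s < d, ∀ s' < d, ∀ x x' : ℕ, c ^ x * t ^ s = c ^ x' * t ^ s' → s = s') :
      (∀ i, ∀ ψ, Irr ⊤ ψ → mlt ((Subgroup.zpowers c).comap π) ψ (tw ω (k * i) lam) =
        mlt ((Subgroup.zpowers c).comap π) ψ (tw ω i lam)) ∧
      (∀ i j, (∑ ψ ∈ irr (⊤ : Subgroup X), mlt ((Subgroup.zpowers c).comap π) ψ (tw ω i lam) *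
        mlt ((Subgroup.zpowers c).comap π) ψ (tw ω j lam)) * (p * p) + p * d = Nat.card (stq π θ) +
        p * p * ((Finset.range d).filter (fun s => k ^ s * j ≡ i [MOD p])).card) := by
  classical
  obtain ⟨τ, rfl⟩ := h.surj t
  have hp := h.hp
  have hc := h.ord
  have hπ := h.surj
  have hθ := h.hθ
  have cst := h.cst
  have hfix : cj τ lam = lam := hfix' τ rfl
  have htw : ∀ i, cj τ (tw ω i lam) = tw ω (k * i) lam := by
    intro i
    rw [h.cj_tw hk, hfix]
  have htws : ∀ s i, cj (τ ^ s) (tw ω i lam) = tw ω (k ^ s * i) lam := by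
    intro s
    induction s with
    | zero => intro i; simp [cj_one]
    | succ s ih =>
      intro i
      rw [pow_succ, ← cj_cj, ih, htw]
      congr 1; ring
  refine ⟨?_, ?_⟩
  · intro i ψ hψ
    rw [← htw, mlt_cj hψ (Subgroup.mem_top τ)]
  · intro i j
    set D := (Finset.univ.filter (fun q : Q => q ∈ stq π θ ∧ ¬ nrm (Subgroup.zpowers c) q)).card with hD
    set E := (Finset.univ.filter (fun q : Q => q ∈ stq π θ ∧ nrm (Subgroup.zpowers c) q)).card with hE
    have hDE : D + E = Nat.card (stq π θ) := by
      rw [← card_filter_mem, hD, hE, add_comm, ← Finset.filter_filter, ← Finset.filter_filter]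
      exact Finset.card_filter_add_card_filter_not _
    have hcount : ∀ (R : ℕ → Prop) [DecidablePred R], (Finset.univ.filter (fun q : Q => ∃ x, ∃ s < d, q = c ^ x * π τ ^ s ∧ R s)).card =
        p * ((Finset.range d).filter R).card := by
      intro R _
      have : (Finset.univ.filter (fun q : Q => ∃ x, ∃ s < d, q = c ^ x * π τ ^ s ∧ R s)) =
          ((Finset.range p) ×ˢ ((Finset.range d).filter R)).image (fun z => c ^ z.1 * π τ ^ z.2) := by
        ext q
        simp only [Finset.mem_filter, Finset.mem_univ, true_and, Finset.mem_image, Finset.mem_product,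
          Finset.mem_range, Prod.exists]
        constructor
        · rintro ⟨x, s, hs, rfl, hR⟩
          refine ⟨x % p, s, ⟨Nat.mod_lt _ hp.pos, hs, hR⟩, ?_⟩
          rw [← hc, pow_mod_orderOf]
        · rintro ⟨x, s, ⟨hx, hs, hR⟩, rfl⟩
          exact ⟨x, s, hs, rfl, hR⟩
      rw [this, Finset.card_image_of_injOn, Finset.card_product, Finset.card_range]
      rintro ⟨x, s⟩ hxs ⟨x', s'⟩ hxs' heq
      simp only [Finset.coe_product, Set.mem_prod, Finset.mem_coe, Finset.mem_range, Finset.mem_filter] at hxs hxs' heq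
      have hss := hd s hxs.2.1 s' hxs'.2.1 x x' heq
      subst hss
      have hxx := mul_right_cancel heq
      rw [pow_eq_pow_iff_modEq, hc] at hxx
      have := Nat.ModEq.eq_of_lt_of_lt hxx hxs.1 hxs'.1
      rw [this]
    have hEc : E = p * d := by
      have := hcount (fun _ => True)
      simp only [and_true, Finset.filter_true, Finset.card_range] at this
      rw [← this, hE]
      congr 1
      ext q
      simp only [Finset.mem_filter, Finset.mem_univ, true_and]
      constructor
      · rintro ⟨h1, h2⟩; exact hN q h1 h2
      · rintro ⟨x, s, hs, rfl⟩
        refine ⟨Subgroup.mul_mem _ (Subgroup.pow_mem _ cst _) (Subgroup.pow_mem _ tst _), ?_⟩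
        have hm : c ^ x * π τ ^ s ∈ Subgroup.normalizer ((Subgroup.zpowers c : Subgroup Q) : Set Q) := by
          refine Subgroup.mul_mem _ (Subgroup.pow_mem _ (Subgroup.le_normalizer (Subgroup.mem_zpowers c)) _)
            (Subgroup.pow_mem _ ?_ _)
          rw [Subgroup.mem_normalizer_iff]
          exact fun y => (nrm_zp hk y).symm
        rw [Subgroup.mem_normalizer_iff] at hm
        exact fun y => (hm y).symm
    have hF : (Finset.univ.filter (fun b : X => nrm (Subgroup.zpowers c) (π b) ∧
        cj b (tw ω j lam) = tw ω i lam)).card = Nat.card π.ker *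
          (p * ((Finset.range d).filter (fun s => k ^ s * j ≡ i [MOD p])).card) := by
      have hval : ∀ b x s, π b = c ^ x * π τ ^ s → (cj b (tw ω j lam) = tw ω i lam ↔ k ^ s * j ≡ i [MOD p]) := by
        intro b x s hb
        have h1 : b * (τ ^ s)⁻¹ ∈ (Subgroup.zpowers c).comap π := by
          rw [Subgroup.mem_comap]; simp [hb, Subgroup.pow_mem, Subgroup.mem_zpowers]
        have h3 : b = (b * (τ ^ s)⁻¹) * τ ^ s := by group
        rw [h3, ← cj_cj, (h.twist j).hirr.cj_mem h1, htws, h.tw_iff]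
      rw [← hcount, ← card_pi π hπ]
      congr 1
      ext b
      simp only [Finset.mem_filter, Finset.mem_univ, true_and]
      constructor
      · rintro ⟨h1, h2⟩
        have hst : π b ∈ stq π θ := by
          rw [mem_stq hθ]
          ext x
          by_cases hx : x ∈ π.ker
          · have h5 := congrFun h2 x
            rw [cj, (h.twist j).res _ ((ker_nrm b x).2 hx), (h.twist i).res x hx] at h5
            exact h5
          · rw [hθ.1 x hx, cj, hθ.1 _ (fun h' => hx ((ker_nrm b x).1 h'))]
        obtain ⟨x, s, hs, hb⟩ := hN _ hst h1
        exact ⟨x, s, hs, hb, (hval b x s hb).1 h2⟩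
      · rintro ⟨x, s, hs, hb, hR⟩
        refine ⟨?_, (hval b x s hb).2 hR⟩
        have hE' : π b ∈ Finset.univ.filter (fun q : Q => ∃ x, ∃ s < d, q = c ^ x * π τ ^ s) := by
          simp only [Finset.mem_filter, Finset.mem_univ, true_and]; exact ⟨x, s, hs, hb⟩
        have hm : c ^ x * π τ ^ s ∈ Subgroup.normalizer ((Subgroup.zpowers c : Subgroup Q) : Set Q) := by
          refine Subgroup.mul_mem _ (Subgroup.pow_mem _ (Subgroup.le_normalizer (Subgroup.mem_zpowers c)) _)
            (Subgroup.pow_mem _ ?_ _)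
          rw [Subgroup.mem_normalizer_iff]
          exact fun y => (nrm_zp hk y).symm
        rw [Subgroup.mem_normalizer_iff, ← hb] at hm
        exact fun y => (hm y).symm
    have hg := h.gram i j
    rw [hF] at hg
    apply Nat.eq_of_mul_eq_mul_left (Nat.card_pos (α := π.ker))
    rw [← hDE, hEc]
    linarith [hg]
lemma gram_t (hπ : Function.Surjective π) (hp : p.Prime) (hc : orderOf c = p)
    (hθ : Irr π.ker θ) (cst : c ∈ stq π θ) {t : Q} (tst : t ∈ stq π θ) {k d : ℕ}
    (hk : t * c * t⁻¹ = c ^ k) (hk1 : ¬ k ≡ 1 [MOD p])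
    (hN : ∀ q ∈ stq π θ, nrm (Subgroup.zpowers c) q → ∃ x, ∃ s < d, q = c ^ x * t ^ s)
    (hd : ∀ s < d, ∀ s' < d, ∀ x x' : ℕ, c ^ x * t ^ s = c ^ x' * t ^ s' → s = s') :
    ∃ ω lam, ED π θ c p ω lam ∧ (∀ b, π b = t → cj b lam = lam) ∧
      (∀ i, ∀ ψ, Irr ⊤ ψ → mlt ((Subgroup.zpowers c).comap π) ψ (tw ω (k * i) lam) =
        mlt ((Subgroup.zpowers c).comap π) ψ (tw ω i lam)) ∧
      (∀ i j, (∑ ψ ∈ irr (⊤ : Subgroup X), mlt ((Subgroup.zpowers c).comap π) ψ (tw ω i lam) *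
        mlt ((Subgroup.zpowers c).comap π) ψ (tw ω j lam)) * (p * p) + p * d = Nat.card (stq π θ) +
        p * p * ((Finset.range d).filter (fun s => k ^ s * j ≡ i [MOD p])).card) := by
  obtain ⟨ω, lam₁, h₁⟩ := exists_ED hπ hp hc hθ cst
  obtain ⟨i, hi⟩ := h₁.fix_twist tst hk hk1
  exact ⟨ω, _, h₁.twist i, hi, (h₁.twist i).gram_fix tst hk hi hN hd⟩
end PrimeGram

section Arith
variable {ι : Type} [DecidableEq ι]
lemma sum_one_sq {S : Finset ι} {f : ι → ℕ} (h : ∑ x ∈ S, f x * f x = 1) :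
    ∃ x ∈ S, f x = 1 ∧ ∀ y ∈ S, y ≠ x → f y = 0 := by
  have h1 : ∃ x ∈ S, f x * f x ≠ 0 := by
    by_contra hc
    push Not at hc
    rw [Finset.sum_eq_zero hc] at h
    omega
  obtain ⟨x, hx, hfx⟩ := h1
  rw [← Finset.add_sum_erase S _ hx] at h
  have h2 : ∑ y ∈ S.erase x, f y * f y = 0 := by omega
  have h3 : f x * f x = 1 := by omega
  rw [Finset.sum_eq_zero_iff] at h2
  refine ⟨x, hx, Nat.eq_one_of_mul_eq_one_left h3, fun y hy hne => ?_⟩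
  simpa using h2 y (Finset.mem_erase.2 ⟨hne, hy⟩)
lemma sum_two_sq {S : Finset ι} {f : ι → ℕ} (h : ∑ x ∈ S, f x * f x = 2) :
    ∃ x ∈ S, ∃ z ∈ S, x ≠ z ∧ f x = 1 ∧ f z = 1 ∧ ∀ y ∈ S, y ≠ x → y ≠ z → f y = 0 := by
  have h1 : ∃ x ∈ S, f x * f x ≠ 0 := by
    by_contra hc
    push Not at hc
    rw [Finset.sum_eq_zero hc] at h
    omega
  obtain ⟨x, hx, hfx⟩ := h1
  rw [← Finset.add_sum_erase S _ hx] at h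
  have h3 : f x = 1 := by
    have : f x ≠ 0 := by rintro h0; simp [h0] at hfx
    by_contra h4
    have h5 : 2 ≤ f x := by omega
    have h6 := Nat.mul_le_mul h5 h5
    omega
  rw [h3] at h
  obtain ⟨z, hz, hfz, hrest⟩ := sum_one_sq (S := S.erase x) (f := f) (by omega)
  rw [Finset.mem_erase] at hz
  exact ⟨x, hx, z, hz.2, Ne.symm hz.1, h3, hfz,
    fun y hy h1 h2 => hrest y (Finset.mem_erase.2 ⟨h1, hy⟩) h2⟩
lemma sum_single {S : Finset ι} {f g : ι → ℕ} {x : ι} (hx : x ∈ S)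
    (h : ∀ y ∈ S, y ≠ x → f y = 0) : ∑ y ∈ S, f y * g y = f x * g x := by
  apply Finset.sum_eq_single_of_mem x hx
  intro y hy hne
  rw [h y hy hne, zero_mul]
lemma sum_pair' {S : Finset ι} {f g : ι → ℕ} {x z : ι} (hx : x ∈ S) (hz : z ∈ S) (hne : x ≠ z)
    (h : ∀ y ∈ S, y ≠ x → y ≠ z → f y = 0) : ∑ y ∈ S, f y * g y = f x * g x + f z * g z := by
  rw [← Finset.add_sum_erase S _ hx, sum_single (Finset.mem_erase.2 ⟨hne.symm, hz⟩)]
  intro y hy h2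
  rw [Finset.mem_erase] at hy
  exact h y hy.2 hy.1 h2
lemma four_le {S : Finset ι} {f : ι → ℕ} {x y z w v : ι} (hx : x ∈ S) (hy : y ∈ S) (hz : z ∈ S)
    (hw : w ∈ S) (hv : v ∈ S) (h1 : x ≠ y) (h2 : x ≠ z) (h3 : x ≠ w) (h4 : y ≠ z) (h5 : y ≠ w)
    (h6 : z ≠ w) (h7 : v ≠ x) (h8 : v ≠ y) (h9 : v ≠ z) (h10 : v ≠ w) :
    f x + f y + f z + f w + f v ≤ ∑ y ∈ S, f y := by
  have hs : ({x, y, z, w, v} : Finset ι) ⊆ S := by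
    intro t ht
    simp only [Finset.mem_insert, Finset.mem_singleton] at ht
    rcases ht with rfl | rfl | rfl | rfl | rfl <;> assumption
  refine le_trans (le_of_eq ?_) (Finset.sum_le_sum_of_subset hs)
  rw [Finset.sum_insert, Finset.sum_insert, Finset.sum_insert, Finset.sum_insert, Finset.sum_singleton]
  · ring
  all_goals simp_all [Ne, eq_comm]
set_option maxHeartbeats 1000000 in
lemma alg_full {S : Finset ι} {e b c : ι → ℕ} {α : ℕ → ι → ℕ}
    (h00 : ∑ x ∈ S, α 0 x * α 0 x = 2) (h11 : ∑ x ∈ S, α 1 x * α 1 x = 1)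
    (h22 : ∑ x ∈ S, α 2 x * α 2 x = 1) (h14 : ∑ x ∈ S, α 1 x * α 4 x = 1)
    (h44 : ∑ x ∈ S, α 4 x * α 4 x = 1) (h33 : ∑ x ∈ S, α 3 x * α 3 x = 1)
    (h23 : ∑ x ∈ S, α 2 x * α 3 x = 1) (h01 : ∑ x ∈ S, α 0 x * α 1 x = 0)
    (h02 : ∑ x ∈ S, α 0 x * α 2 x = 0) (h12 : ∑ x ∈ S, α 1 x * α 2 x = 0)
    (he0 : ∑ x ∈ S, α 0 x * e x = 12) (he1 : ∑ x ∈ S, α 1 x * e x = 12)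
    (he2 : ∑ x ∈ S, α 2 x * e x = 12)
    (hbb : ∑ x ∈ S, b x * b x = 6) (hcc : ∑ x ∈ S, c x * c x = 6) (hbc : ∑ x ∈ S, b x * c x = 5)
    (he : ∀ x ∈ S, e x = (α 0 x + α 1 x + α 2 x + α 3 x + α 4 x) + 5 * b x + 5 * c x)
    (hab : ∑ x ∈ S, (α 0 x + α 1 x + α 2 x + α 3 x + α 4 x) * b x = 5)
    (hac : ∑ x ∈ S, (α 0 x + α 1 x + α 2 x + α 3 x + α 4 x) * c x = 5) :
    (∀ x ∈ S, e x = 0 ∨ e x = 1 ∨ e x = 5 ∨ e x = 6 ∨ e x = 10 ∨ e x = 11 ∨ e x = 12) ∧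
    (∃ x ∈ S, α 1 x = 1 ∧ e x = 12 ∧ ∀ y ∈ S, y ≠ x → α 1 y = 0) := by
  obtain ⟨x1, hx1, hα1, hα1'⟩ := sum_one_sq h11
  obtain ⟨x2, hx2, hα2, hα2'⟩ := sum_one_sq h22
  obtain ⟨p, hp, q, hq, hpq, hαp, hαq, hα0'⟩ := sum_two_sq h00
  have k4 : α 4 x1 = 1 := by
    rw [sum_single hx1 hα1', hα1, one_mul] at h14; exact h14
  have k3 : α 3 x2 = 1 := by
    rw [sum_single hx2 hα2', hα2, one_mul] at h23; exact h23
  have k4' : ∀ y ∈ S, y ≠ x1 → α 4 y = 0 := by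
    obtain ⟨z, hz, hz1, hz2⟩ := sum_one_sq h44
    have : x1 = z := by
      by_contra hne
      have := hz2 x1 hx1 hne
      omega
    rw [this]; exact hz2
  have k3' : ∀ y ∈ S, y ≠ x2 → α 3 y = 0 := by
    obtain ⟨z, hz, hz1, hz2⟩ := sum_one_sq h33
    have : x2 = z := by
      by_contra hne
      have := hz2 x2 hx2 hne
      omega
    rw [this]; exact hz2
  have n12 : x1 ≠ x2 := by
    rintro rfl
    rw [sum_single hx1 hα1', hα1, hα2] at h12
    omega
  rw [Finset.sum_eq_zero_iff] at h01 h02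
  have n1p : x1 ≠ p := by rintro rfl; have := h01 x1 hx1; rw [hαp, hα1] at this; omega
  have n1q : x1 ≠ q := by rintro rfl; have := h01 x1 hx1; rw [hαq, hα1] at this; omega
  have n2p : x2 ≠ p := by rintro rfl; have := h02 x2 hx2; rw [hαp, hα2] at this; omega
  have n2q : x2 ≠ q := by rintro rfl; have := h02 x2 hx2; rw [hαq, hα2] at this; omega
  set a : ι → ℕ := fun x => α 0 x + α 1 x + α 2 x + α 3 x + α 4 x with ha
  have a1 : a x1 = 2 := by
    simp only [ha, hα1, k4, hα0' x1 hx1 n1p n1q, hα2' x1 hx1 n12, k3' x1 hx1 n12]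
  have a2 : a x2 = 2 := by
    simp only [ha, hα2, k3, hα0' x2 hx2 n2p n2q, hα1' x2 hx2 n12.symm, k4' x2 hx2 n12.symm]
  have ap : a p = 1 := by
    simp only [ha, hαp, hα1' p hp n1p.symm, hα2' p hp n2p.symm, k3' p hp n2p.symm, k4' p hp n1p.symm]
  have aq : a q = 1 := by
    simp only [ha, hαq, hα1' q hq n1q.symm, hα2' q hq n2q.symm, k3' q hq n2q.symm, k4' q hq n1q.symm]
  have a0 : ∀ y ∈ S, y ≠ x1 → y ≠ x2 → y ≠ p → y ≠ q → a y = 0 := by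
    intro y hy h1 h2 h3 h4
    simp only [ha, hα0' y hy h3 h4, hα1' y hy h1, hα2' y hy h2, k3' y hy h2, k4' y hy h1]
  have e1 : e x1 = 12 := by rw [sum_single hx1 hα1', hα1, one_mul] at he1; exact he1
  have e2 : e x2 = 12 := by rw [sum_single hx2 hα2', hα2, one_mul] at he2; exact he2
  have epq : e p + e q = 12 := by
    rw [sum_pair' hp hq hpq hα0', hαp, hαq, one_mul, one_mul] at he0; exact he0
  have f1 := he x1 hx1
  have f2 := he x2 hx2
  have fp := he p hp
  have fq := he q hq
  change e x1 = a x1 + _ + _ at f1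
  change e x2 = a x2 + _ + _ at f2
  change e p = a p + _ + _ at fp
  change e q = a q + _ + _ at fq
  have hdecomp : ∀ g : ι → ℕ, ∑ x ∈ S, a x * g x = 2 * g x1 + 2 * g x2 + g p + g q := by
    intro g
    rw [← Finset.add_sum_erase S _ hx1, ← Finset.add_sum_erase _ _ (Finset.mem_erase.2 ⟨n12.symm, hx2⟩)]
    rw [sum_pair' (x := p) (z := q) (by simp [n1p.symm, n2p.symm, hp]) (by simp [n1q.symm, n2q.symm, hq]) hpq]
    · rw [a1, a2, ap, aq]; ring
    · intro y hy
      simp only [Finset.mem_erase] at hy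
      exact a0 y hy.2.2 hy.2.1 hy.1
  have gb : 2 * b x1 + 2 * b x2 + b p + b q = 5 := by rw [← hdecomp]; exact hab
  have gc : 2 * c x1 + 2 * c x2 + c p + c q = 5 := by rw [← hdecomp]; exact hac
  -- the sum of (b-c)^2
  have hdiff : ∑ x ∈ S, ((b x : ℤ) - c x) * (b x - c x) = 2 := by
    have hb' : ∑ x ∈ S, (b x : ℤ) * b x = 6 := by exact_mod_cast hbb
    have hc' : ∑ x ∈ S, (c x : ℤ) * c x = 6 := by exact_mod_cast hcc
    have hbc' : ∑ x ∈ S, (b x : ℤ) * c x = 5 := by exact_mod_cast hbc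
    have : ∀ x ∈ S, ((b x : ℤ) - c x) * (b x - c x) = (b x : ℤ) * b x + (c x : ℤ) * c x - 2 * ((b x : ℤ) * c x) := by
      intro x _; ring
    rw [Finset.sum_congr rfl this, Finset.sum_sub_distrib, Finset.sum_add_distrib, ← Finset.mul_sum, hb', hc', hbc']
    norm_num
  have hle : ∀ x ∈ S, ((b x : ℤ) - c x) * (b x - c x) ≤ 2 := by
    intro x hx
    rw [← hdiff]
    exact Finset.single_le_sum (f := fun x => ((b x : ℤ) - c x) * (b x - c x))
      (fun y _ => mul_self_nonneg _) hx
  have hb1 : b x1 = 1 ∧ c x1 = 1 := by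
    have := hle x1 hx1
    have h2 : b x1 + c x1 = 2 := by omega
    have h3 : c x1 = 2 - b x1 := by omega
    have h4 : b x1 ≤ 2 := by omega
    interval_cases hbx : b x1 <;> simp_all
  have hb2 : b x2 = 1 ∧ c x2 = 1 := by
    have := hle x2 hx2
    have h2 : b x2 + c x2 = 2 := by omega
    have h3 : c x2 = 2 - b x2 := by omega
    have h4 : b x2 ≤ 2 := by omega
    interval_cases hbx : b x2 <;> simp_all
  have hbpq : b p + b q = 1 := by omega
  have hcpq : c p + c q = 1 := by omega
  refine ⟨?_, x1, hx1, hα1, e1, hα1'⟩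
  intro y hy
  by_cases y1 : y = x1
  · subst y1; omega
  by_cases y2 : y = x2
  · subst y2; omega
  by_cases y3 : y = p
  · subst y3; omega
  by_cases y4 : y = q
  · subst y4; omega
  have hby : b y ≤ 1 := by
    have := four_le (f := fun x => b x * b x) hx1 hx2 hp hq hy n12 n1p n1q n2p n2q hpq y1 y2 y3 y4
    simp only [hbb, hb1.1, hb2.1] at this
    by_contra h
    have h6 : 2 ≤ b y := by omega
    have h7 := Nat.mul_le_mul h6 h6
    have h5 : b p * b p + b q * b q = 1 := by
      rcases (by omega : (b p = 0 ∧ b q = 1) ∨ (b p = 1 ∧ b q = 0)) with ⟨h1, h2⟩ | ⟨h1, h2⟩ <;> simp [h1, h2]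
    clear hab hac hdecomp hdiff hle he
    omega
  have hcy : c y ≤ 1 := by
    have := four_le (f := fun x => c x * c x) hx1 hx2 hp hq hy n12 n1p n1q n2p n2q hpq y1 y2 y3 y4
    simp only [hcc, hb1.2, hb2.2] at this
    by_contra h
    have h6 : 2 ≤ c y := by omega
    have h7 := Nat.mul_le_mul h6 h6
    have h5 : c p * c p + c q * c q = 1 := by
      rcases (by omega : (c p = 0 ∧ c q = 1) ∨ (c p = 1 ∧ c q = 0)) with ⟨h1, h2⟩ | ⟨h1, h2⟩ <;> simp [h1, h2]
    clear hab hac hdecomp hdiff hle he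
    omega
  have fy := he y hy
  change e y = a y + _ + _ at fy
  rw [a0 y hy y1 y2 y3 y4] at fy
  omega
lemma alg_60 {S : Finset ι} {e a b c : ι → ℕ}
    (haa : ∑ x ∈ S, a x * a x = 4) (hbb : ∑ x ∈ S, b x * b x = 3) (hcc : ∑ x ∈ S, c x * c x = 3)
    (hab : ∑ x ∈ S, a x * b x = 2) (hac : ∑ x ∈ S, a x * c x = 2) (hbc : ∑ x ∈ S, b x * c x = 2)
    (he : ∀ x ∈ S, e x = a x + 2 * b x + 2 * c x)
    (h3 : (S.filter (fun x => ¬ 3 ∣ e x)).card ≤ 3) :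
    (∀ x ∈ S, e x ≤ 6) ∧ ∃ x ∈ S, e x = 4 := by
  have hle : ∀ (f : ι → ℕ) (n : ℕ), ∑ x ∈ S, f x * f x = n → ∀ x ∈ S, f x * f x ≤ n := by
    intro f n h x hx
    rw [← h]
    exact Finset.single_le_sum (f := fun x => f x * f x) (fun _ _ => Nat.zero_le _) hx
  have ha2 : ∀ x ∈ S, a x ≤ 2 := fun x hx => by
    have := hle a 4 haa x hx; by_contra h; have : 3 ≤ a x := by omega
    nlinarith
  have hb1 : ∀ x ∈ S, b x ≤ 1 := fun x hx => by
    have := hle b 3 hbb x hx; by_contra h; have : 2 ≤ b x := by omega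
    nlinarith
  have hc1 : ∀ x ∈ S, c x ≤ 1 := fun x hx => by
    have := hle c 3 hcc x hx; by_contra h; have : 2 ≤ c x := by omega
    nlinarith
  refine ⟨fun x hx => by rw [he x hx]; have := ha2 x hx; have := hb1 x hx; have := hc1 x hx; omega, ?_⟩
  -- products
  have hbc2 : ∑ x ∈ S, (b x * c x) * (b x * c x) = 2 := by
    rw [← hbc]
    refine Finset.sum_congr rfl fun x hx => ?_
    have h1 := hb1 x hx; have h2 := hc1 x hx
    interval_cases b x <;> interval_cases c x <;> rfl
  obtain ⟨x, hx, y, hy, hxy, fx, fy, hrest⟩ := sum_two_sq (f := fun x => b x * c x) hbc2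
  have bx := Nat.eq_one_of_mul_eq_one_right fx
  have cx := Nat.eq_one_of_mul_eq_one_left fx
  have bY := Nat.eq_one_of_mul_eq_one_right fy
  have cY := Nat.eq_one_of_mul_eq_one_left fy
  have hS : ∀ g : ι → ℕ, ∑ t ∈ S, g t = g x + g y + ∑ t ∈ (S.erase x).erase y, g t := by
    intro g
    rw [← Finset.add_sum_erase S _ hx, ← Finset.add_sum_erase _ _ (Finset.mem_erase.2 ⟨hxy.symm, hy⟩), add_assoc]
  have hb' : ∑ t ∈ (S.erase x).erase y, b t * b t = 1 := by
    have := hS (fun t => b t * b t)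
    simp only [hbb, bx, bY] at this; omega
  have hc' : ∑ t ∈ (S.erase x).erase y, c t * c t = 1 := by
    have := hS (fun t => c t * c t)
    simp only [hcc, cx, cY] at this; omega
  obtain ⟨z, hz, bz, bz'⟩ := sum_one_sq hb'
  obtain ⟨w, hw, cw, cw'⟩ := sum_one_sq hc'
  have hab' : ∑ t ∈ (S.erase x).erase y, b t * a t = a z := by
    rw [sum_single hz bz', bz, one_mul]
  have hac' : ∑ t ∈ (S.erase x).erase y, c t * a t = a w := by
    rw [sum_single hw cw', cw, one_mul]
  have e1 : a x + a y + a z = 2 := by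
    have := hS (fun t => a t * b t)
    simp only [hab, bx, bY, mul_one] at this
    rw [Finset.sum_congr rfl (fun t _ => mul_comm (a t) (b t)), hab'] at this
    exact this.symm
  have e2 : a x + a y + a w = 2 := by
    have := hS (fun t => a t * c t)
    simp only [hac, cx, cY, mul_one] at this
    rw [Finset.sum_congr rfl (fun t _ => mul_comm (a t) (c t)), hac'] at this
    exact this.symm
  simp only [Finset.mem_erase] at hz hw
  have hzw : z ≠ w := by
    rintro rfl
    have := hrest z hz.2.2 hz.2.1 hz.1
    simp only [bz, cw] at this
    omega
  have cz : c z = 0 := by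
    have := hrest z hz.2.2 hz.2.1 hz.1
    simpa [bz] using this
  have bw : b w = 0 := by
    have := hrest w hw.2.2 hw.2.1 hw.1
    simpa [cw] using this
  by_contra hno
  push Not at hno
  have ex := he x hx; have ey := he y hy; have ez := he z hz.2.2; have ew := he w hw.2.2
  have nx := hno x hx; have ny := hno y hy
  rw [bx, cx] at ex
  rw [bY, cY] at ey
  rw [bz, cz] at ez
  rw [bw, cw] at ew
  have hsub : ({x, y, z, w} : Finset ι) ⊆ S.filter (fun x => ¬ 3 ∣ e x) := by
    intro t ht
    simp only [Finset.mem_insert, Finset.mem_singleton] at ht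
    rw [Finset.mem_filter]
    rcases ht with rfl | rfl | rfl | rfl
    · exact ⟨hx, by omega⟩
    · exact ⟨hy, by omega⟩
    · exact ⟨hz.2.2, by omega⟩
    · exact ⟨hw.2.2, by omega⟩
  have hcard := Finset.card_le_card hsub
  rw [Finset.card_insert_of_notMem, Finset.card_insert_of_notMem, Finset.card_insert_of_notMem,
    Finset.card_singleton] at hcard
  · omega
  · simpa using hzw
  · simp only [Finset.mem_insert, Finset.mem_singleton, not_or]; exact ⟨hz.1.symm, hw.1.symm⟩
  · simp only [Finset.mem_insert, Finset.mem_singleton, not_or]; exact ⟨hxy, hz.2.1.symm, hw.2.1.symm⟩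
lemma alg_12 {S : Finset ι} {e : ι → ℕ} (h : ∑ x ∈ S, e x * e x = 12)
    (h3 : (S.filter (fun x => ¬ 3 ∣ e x)).card ≤ 6) :
    (∀ x ∈ S, e x ≤ 3) ∧ ∃ x ∈ S, e x = 2 ∨ e x = 3 := by
  have hle : ∀ x ∈ S, e x ≤ 3 := by
    intro x hx
    have : e x * e x ≤ 12 := by
      rw [← h]
      exact Finset.single_le_sum (f := fun x => e x * e x) (fun _ _ => Nat.zero_le _) hx
    by_contra h; have : 4 ≤ e x := by omega
    nlinarith
  refine ⟨hle, ?_⟩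
  by_contra hno
  push Not at hno
  rw [Finset.card_filter] at h3
  have : ∑ x ∈ S, e x * e x ≤ ∑ x ∈ S, (if ¬ 3 ∣ e x then 1 else 0) := by
    refine Finset.sum_le_sum fun x hx => ?_
    have h1 := hle x hx
    have h2 := hno x hx
    have : e x = 0 ∨ e x = 1 := by omega
    rcases this with h | h <;> simp [h]
  omega
end Arith

section QDsec
/-- The facts about `PSL(2,11)` which are used. -/
structure QD (Q : Type) [Group Q] [Fintype Q] (u h w : Q) : Prop where
  card : Nat.card Q = 660
  u11 : u ^ 11 = 1
  h5 : h ^ 5 = 1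
  w2 : w * w = 1
  hu : h * u * h⁻¹ = u ^ 9
  wh : w * h * w⁻¹ = h⁻¹
  bru : ∀ q, (∃ i j : ℕ, q = u ^ i * h ^ j) ∨ (∃ i j k : ℕ, q = u ^ i * h ^ j * w * u ^ k)
  uw : u * w * u * w * u * w = 1
  wu : ∃ x y z : ℕ, ¬ 5 ∣ y ∧ w * u ^ 2 * w = u ^ x * h ^ y * w * u ^ z
  uwh : ∀ s : ℕ, (u * (w * h ^ s)) ^ 3 = 1 → 5 ∣ s
  c3 : ∃ c : Q, orderOf c = 3 ∧ Nat.card (Subgroup.centralizer {c}) = 6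
variable {Q : Type} [Group Q] [Fintype Q] {u h w : Q}
lemma QD.conj (D : QD Q u h w) (g : Q) : QD Q (g * u * g⁻¹) (g * h * g⁻¹) (g * w * g⁻¹) := by
  have hm : ∀ x y : Q, (g * x * g⁻¹) * (g * y * g⁻¹) = g * (x * y) * g⁻¹ := by intro x y; group
  have hi : ∀ x : Q, (g * x * g⁻¹)⁻¹ = g * x⁻¹ * g⁻¹ := by intro x; group
  have hpw : ∀ (x : Q) (n : ℕ), (g * x * g⁻¹) ^ n = g * x ^ n * g⁻¹ := fun x n => conj_pow
  refine ⟨D.card, ?_, ?_, ?_, ?_, ?_, ?_, ?_, ?_, ?_, D.c3⟩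
  · rw [hpw, D.u11]; group
  · rw [hpw, D.h5]; group
  · rw [hm, D.w2]; group
  · rw [hi, hm, hm, D.hu, hpw]
  · rw [hi, hm, hm, D.wh, hi]
  · intro q
    rcases D.bru (g⁻¹ * q * g) with ⟨i, j, hij⟩ | ⟨i, j, k, hij⟩
    · left; refine ⟨i, j, ?_⟩
      rw [hpw, hpw, hm, ← hij]; group
    · right; refine ⟨i, j, k, ?_⟩
      rw [hpw, hpw, hpw, hm, hm, hm, ← hij]; group
  · rw [hm, hm, hm, hm, hm, D.uw]; group
  · obtain ⟨x, y, z, h1, h2⟩ := D.wu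
    refine ⟨x, y, z, h1, ?_⟩
    rw [hpw, hpw, hpw, hpw, hm, hm, hm, hm, hm, h2]
  · intro s hs
    apply D.uwh s
    rw [hpw, hm, hm, hpw] at hs
    have := congrArg (fun x => g⁻¹ * x * g) hs
    simpa [mul_assoc] using this
lemma pow_mod_of {x : Q} {n : ℕ} (h : x ^ n = 1) (i : ℕ) : x ^ (i % n) = x ^ i := by
  conv_rhs => rw [← Nat.div_add_mod i n, pow_add, pow_mul, h, one_pow, one_mul]
lemma pow_congr_of {x : Q} {n : ℕ} (h : x ^ n = 1) {i j : ℕ} (hij : i ≡ j [MOD n]) : x ^ i = x ^ j := by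
  rw [← pow_mod_of h i, ← pow_mod_of h j, hij]
lemma QD.inj (D : QD Q u h w) : Function.Injective
    (fun z : (ZMod 11 × ZMod 5) ⊕ (ZMod 11 × ZMod 5 × ZMod 11) =>
      Sum.elim (fun a => u ^ a.1.val * h ^ a.2.val)
        (fun a => u ^ a.1.val * h ^ a.2.1.val * w * u ^ a.2.2.val) z) := by
  have hs : Function.Surjective (fun z : (ZMod 11 × ZMod 5) ⊕ (ZMod 11 × ZMod 5 × ZMod 11) =>
      Sum.elim (fun a => u ^ a.1.val * h ^ a.2.val)
        (fun a => u ^ a.1.val * h ^ a.2.1.val * w * u ^ a.2.2.val) z) := by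
    intro q
    rcases D.bru q with ⟨i, j, hij⟩ | ⟨i, j, k, hij⟩
    · refine ⟨Sum.inl (i, j), ?_⟩
      simp only [Sum.elim_inl, ZMod.val_natCast, pow_mod_of D.u11, pow_mod_of D.h5, hij]
    · refine ⟨Sum.inr (i, j, k), ?_⟩
      simp only [Sum.elim_inr, ZMod.val_natCast, pow_mod_of D.u11, pow_mod_of D.h5, hij]
  refine ((Fintype.bijective_iff_surjective_and_card _).2 ⟨hs, ?_⟩).1
  have := D.card
  rw [Nat.card_eq_fintype_card] at this
  rw [this]
  simp [ZMod.card]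
lemma QD.nf1 (D : QD Q u h w) {i j i' j' : ℕ} (he : u ^ i * h ^ j = u ^ i' * h ^ j') :
    i ≡ i' [MOD 11] ∧ j ≡ j' [MOD 5] := by
  have := D.inj (a₁ := Sum.inl ((i : ZMod 11), (j : ZMod 5))) (a₂ := Sum.inl ((i' : ZMod 11), (j' : ZMod 5)))
    (by simpa only [Sum.elim_inl, ZMod.val_natCast, pow_mod_of D.u11, pow_mod_of D.h5] using he)
  simpa [ZMod.natCast_eq_natCast_iff] using this
lemma QD.nf2 (D : QD Q u h w) {i j k i' j' k' : ℕ}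
    (he : u ^ i * h ^ j * w * u ^ k = u ^ i' * h ^ j' * w * u ^ k') :
    i ≡ i' [MOD 11] ∧ j ≡ j' [MOD 5] ∧ k ≡ k' [MOD 11] := by
  have := D.inj (a₁ := Sum.inr ((i : ZMod 11), (j : ZMod 5), (k : ZMod 11)))
    (a₂ := Sum.inr ((i' : ZMod 11), (j' : ZMod 5), (k' : ZMod 11)))
    (by simpa only [Sum.elim_inr, ZMod.val_natCast, pow_mod_of D.u11, pow_mod_of D.h5] using he)
  simpa [ZMod.natCast_eq_natCast_iff] using this
lemma QD.nf3 (D : QD Q u h w) {i j i' j' k' : ℕ} :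
    u ^ i * h ^ j ≠ u ^ i' * h ^ j' * w * u ^ k' := by
  intro he
  have := D.inj (a₁ := Sum.inl ((i : ZMod 11), (j : ZMod 5)))
    (a₂ := Sum.inr ((i' : ZMod 11), (j' : ZMod 5), (k' : ZMod 11)))
    (by simpa only [Sum.elim_inl, Sum.elim_inr, ZMod.val_natCast, pow_mod_of D.u11, pow_mod_of D.h5] using he)
  simp at this
lemma QD.ord_u (D : QD Q u h w) : orderOf u = 11 := by
  have hp : Fact (Nat.Prime 11) := ⟨by norm_num⟩
  apply orderOf_eq_prime D.u11
  intro h1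
  have := (D.nf1 (i := 1) (j := 0) (i' := 0) (j' := 0) (by simp [h1])).1
  exact absurd this (by decide)
lemma QD.ord_h (D : QD Q u h w) : orderOf h = 5 := by
  have hp : Fact (Nat.Prime 5) := ⟨by norm_num⟩
  apply orderOf_eq_prime D.h5
  intro h1
  have := (D.nf1 (i := 0) (j := 1) (i' := 0) (j' := 0) (by simp [h1])).2
  exact absurd this (by decide)
lemma QD.hpow (D : QD Q u h w) (j i : ℕ) : h ^ j * u ^ i = u ^ (9 ^ j * i) * h ^ j := by
  have h1 : ∀ i, h * u ^ i = u ^ (9 * i) * h := by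
    intro i
    have := conj_pow_k D.hu i
    rw [← this]; group
  induction j generalizing i with
  | zero => simp
  | succ j ih =>
    rw [pow_succ, mul_assoc, h1, ← mul_assoc, ih, mul_assoc]
    congr 2; ring
lemma QD.winv (D : QD Q u h w) : w⁻¹ = w := inv_eq_of_mul_eq_one_left D.w2
lemma QD.whpow (D : QD Q u h w) (j : ℕ) : w * h ^ j = h ^ (4 * j) * w := by
  have h1 : h⁻¹ = h ^ 4 := inv_eq_of_mul_eq_one_left (by rw [← pow_succ, D.h5])
  have h2 : w * h * w⁻¹ = h ^ 4 := by rw [D.wh, h1]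
  have := conj_pow_k h2 j
  rw [← this]; group
lemma QD.uh (D : QD Q u h w) (k : ℕ) : u ^ k * h = h * u ^ (5 * k) := by
  have h1 := D.hpow 1 (5 * k)
  rw [pow_one] at h1
  rw [h1]
  congr 1
  apply pow_congr_of D.u11
  rw [pow_one, ← mul_assoc]
  unfold Nat.ModEq; omega
lemma QD.nrm_u (D : QD Q u h w) {q : Q} (hq : nrm (Subgroup.zpowers u) q) :
    ∃ x, ∃ s < 5, q = u ^ x * h ^ s := by
  rcases D.bru q with ⟨i, j, hij⟩ | ⟨i, j, k, hij⟩
  · exact ⟨i, j % 5, Nat.mod_lt _ (by norm_num), by rw [pow_mod_of D.h5, hij]⟩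
  · exfalso
    obtain ⟨n, -, hn⟩ := exists_k hq
    have h1 : q * u = u ^ n * q := by rw [← hn]; group
    rw [hij] at h1
    have h2 : u ^ i * h ^ j * w * u ^ (k + 1) = u ^ (n + i) * h ^ j * w * u ^ k := by
      rw [pow_succ, pow_add]
      simpa only [mul_assoc] using h1
    have := (D.nf2 h2).2.2
    have h3 : 1 ≡ 0 [MOD 11] := Nat.ModEq.add_left_cancel' k this
    exact absurd h3 (by decide)
lemma QD.hd_u (D : QD Q u h w) : ∀ s < 5, ∀ s' < 5, ∀ x x' : ℕ,
    u ^ x * h ^ s = u ^ x' * h ^ s' → s = s' := by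
  intro s hs s' hs' x x' he
  exact Nat.ModEq.eq_of_lt_of_lt (D.nf1 he).2 hs hs'
lemma QD.nrm_h (D : QD Q u h w) {q : Q} (hq : nrm (Subgroup.zpowers h) q) :
    ∃ x, ∃ s < 2, q = h ^ x * w ^ s := by
  obtain ⟨n, -, hn⟩ := exists_k hq
  have h1 : q * h = h ^ n * q := by rw [← hn]; group
  rcases D.bru q with ⟨i, j, hij⟩ | ⟨i, j, k, hij⟩
  · refine ⟨j, 0, by norm_num, ?_⟩
    rw [hij] at h1 ⊢
    have h2 : u ^ i * h ^ (j + 1) = u ^ (9 ^ n * i) * h ^ (n + j) := by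
      rw [pow_succ, pow_add, ← mul_assoc, h1, ← mul_assoc, D.hpow, mul_assoc]
    obtain ⟨e1, e2⟩ := D.nf1 h2
    have e3 : 1 ≡ n [MOD 5] := by
      apply Nat.ModEq.add_left_cancel' j
      rw [add_comm j n]; exact e2
    have e4 : u ^ i = 1 := by
      have h9 : 9 ^ n % 11 = 9 := by
        have : n = 5 * (n / 5) + 1 := by
          have := e3; unfold Nat.ModEq at this; omega
        rw [this, pow_succ, pow_mul, Nat.mul_mod, Nat.pow_mod]; norm_num
      have h10 : i % 11 = 0 := by
        have := e1
        unfold Nat.ModEq at this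
        rw [Nat.mul_mod, h9] at this
        omega
      rw [← pow_mod_of D.u11, h10, pow_zero]
    rw [e4]; simp
  · refine ⟨j, 1, by norm_num, ?_⟩
    rw [hij] at h1 ⊢
    have h2 : u ^ i * h ^ (j + 4) * w * u ^ (5 * k) = u ^ (9 ^ n * i) * h ^ (n + j) * w * u ^ k := by
      calc u ^ i * h ^ (j + 4) * w * u ^ (5 * k) = u ^ i * h ^ j * (h ^ (4 * 1) * w) * u ^ (5 * k) := by
            rw [pow_add]; simp only [mul_assoc]
        _ = u ^ i * h ^ j * w * (h * u ^ (5 * k)) := by rw [← D.whpow, pow_one]; simp only [mul_assoc]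
        _ = u ^ i * h ^ j * w * u ^ k * h := by rw [← D.uh]; simp only [mul_assoc]
        _ = h ^ n * u ^ i * (h ^ j * w * u ^ k) := by rw [h1]; simp only [mul_assoc]
        _ = u ^ (9 ^ n * i) * h ^ (n + j) * w * u ^ k := by rw [D.hpow, pow_add]; simp only [mul_assoc]
    obtain ⟨e1, e2, e3⟩ := D.nf2 h2
    have e4 : u ^ k = 1 := by
      rw [← pow_mod_of D.u11]
      have : k % 11 = 0 := by unfold Nat.ModEq at e3; omega
      rw [this, pow_zero]
    have e5 : u ^ i = 1 := by
      have e6 : 4 ≡ n [MOD 5] := by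
        apply Nat.ModEq.add_left_cancel' j
        rw [add_comm j n]; exact e2
      have h9 : 9 ^ n % 11 = 5 := by
        have : n = 5 * (n / 5) + 4 := by
          unfold Nat.ModEq at e6; omega
        rw [this, pow_add, pow_mul, Nat.mul_mod, Nat.pow_mod]; norm_num
      have h10 : i % 11 = 0 := by
        have := e1
        unfold Nat.ModEq at this
        rw [Nat.mul_mod, h9] at this
        omega
      rw [← pow_mod_of D.u11, h10, pow_zero]
    rw [e4, e5]; simp
lemma QD.hd_h (D : QD Q u h w) : ∀ s < 2, ∀ s' < 2, ∀ x x' : ℕ,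
    h ^ x * w ^ s = h ^ x' * w ^ s' → s = s' := by
  have key : ∀ x x' : ℕ, h ^ x ≠ h ^ x' * w := by
    intro x x' he
    exact D.nf3 (i := 0) (j := x) (i' := 0) (j' := x') (k' := 0) (by simpa using he)
  intro s hs s' hs' x x' he
  interval_cases s <;> interval_cases s'
  · rfl
  · exact absurd (by simpa using he) (key x x')
  · exact absurd (by simpa using he.symm) (key x' x)
  · rfl
/-- subgroups containing `u` -/
lemma QD.sub_u (D : QD Q u h w) (S : Subgroup Q) (hu : u ∈ S) : S = ⊤ ∨ Nat.card S ∣ 55 := by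
  by_cases hB : ∀ q ∈ S, ∃ i j : ℕ, q = u ^ i * h ^ j
  · right
    -- B is a subgroup of order 55
    let B : Subgroup Q := Subgroup.normalizer ((Subgroup.zpowers u : Subgroup Q) : Set Q)
    have hmem : ∀ q, q ∈ B ↔ nrm (Subgroup.zpowers u) q := by
      intro q
      rw [Subgroup.mem_normalizer_iff]
      exact ⟨fun h y => (h y).symm, fun h y => (h y).symm⟩
    have hBmem : ∀ i j : ℕ, u ^ i * h ^ j ∈ B := by
      intro i j
      refine B.mul_mem (B.pow_mem ?_ _) (B.pow_mem ?_ _)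
      · exact Subgroup.le_normalizer (Subgroup.mem_zpowers u)
      · rw [hmem]; exact nrm_zp D.hu
    have hcard : Nat.card B = 55 := by
      classical
      let f : ZMod 11 × ZMod 5 → B := fun a => ⟨u ^ a.1.val * h ^ a.2.val, hBmem _ _⟩
      have hf : Function.Bijective f := by
        constructor
        · intro a b hab
          have := D.inj (a₁ := Sum.inl a) (a₂ := Sum.inl b) (by simpa [f] using hab)
          simpa using this
        · rintro ⟨q, hq⟩
          obtain ⟨x, s, hs, hqq⟩ := D.nrm_u ((hmem q).1 hq)
          refine ⟨((x : ZMod 11), (s : ZMod 5)), ?_⟩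
          simp only [f, ZMod.val_natCast, pow_mod_of D.u11, pow_mod_of D.h5, hqq]
      rw [← Nat.card_eq_of_bijective f hf, Nat.card_prod, Nat.card_zmod, Nat.card_zmod]
    rw [← hcard]
    apply Subgroup.card_dvd_of_le
    intro q hq
    obtain ⟨i, j, rfl⟩ := hB q hq
    exact hBmem i j
  · left
    push Not at hB
    obtain ⟨q, hqS, hq⟩ := hB
    rcases D.bru q with ⟨i, j, hij⟩ | ⟨i, j, k, hij⟩
    · exact absurd hij (hq i j)
    have h1 : h ^ j * w ∈ S := by
      have : h ^ j * w = (u ^ i)⁻¹ * q * (u ^ k)⁻¹ := by rw [hij]; group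
      rw [this]
      exact S.mul_mem (S.mul_mem (S.inv_mem (S.pow_mem hu _)) hqS) (S.inv_mem (S.pow_mem hu _))
    have h2 : ∀ m : ℕ, w * u ^ m * w ∈ S := by
      intro m
      have : w * u ^ m * w = (h ^ j * w)⁻¹⁻¹ * (u ^ (9 ^ j * m)) * (h ^ j * w)⁻¹ := by
        rw [inv_inv, mul_inv_rev, D.winv]
        have e1 : w * (h ^ j)⁻¹ = h ^ j * w := by
          rw [mul_inv_eq_iff_eq_mul, mul_assoc, D.whpow, ← mul_assoc, ← pow_add]
          have : h ^ (j + 4 * j) = 1 := by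
            rw [show j + 4 * j = 5 * j by ring, pow_mul, D.h5, one_pow]
          rw [this, one_mul]
        calc w * u ^ m * w = w * ((h ^ j)⁻¹ * (h ^ j * u ^ m)) * w := by group
          _ = (w * (h ^ j)⁻¹) * u ^ (9 ^ j * m) * (h ^ j * w) := by rw [D.hpow]; simp only [mul_assoc]
          _ = (h ^ j * w) * u ^ (9 ^ j * m) * (w * (h ^ j)⁻¹) := by rw [e1]
      rw [this]
      exact S.mul_mem (S.mul_mem (by simpa using h1) (S.pow_mem hu _)) (S.inv_mem h1)
    have h3 : w ∈ S := by
      have h4 := D.uw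
      have h5 : w = u * (w * u ^ 1 * w) * u := by
        rw [pow_one]
        have : u * (w * u * w) * u = (u * w * u * w * u * w) * w⁻¹ := by group
        rw [this, h4, one_mul, D.winv]
      rw [h5]
      exact S.mul_mem (S.mul_mem hu (h2 1)) hu
    obtain ⟨x, y, z, hy, hxy⟩ := D.wu
    have h4 : h ^ y ∈ S := by
      have : h ^ y = (u ^ x)⁻¹ * (w * u ^ 2 * w) * (u ^ z)⁻¹ * w⁻¹ := by rw [hxy]; group
      rw [this]
      exact S.mul_mem (S.mul_mem (S.mul_mem (S.inv_mem (S.pow_mem hu _)) (h2 2)) (S.inv_mem (S.pow_mem hu _))) (S.inv_mem h3)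
    have h5 : h ∈ S := by
      obtain ⟨n, hn⟩ : ∃ n, y * n ≡ 1 [MOD 5] := by
        have : y % 5 = 1 ∨ y % 5 = 2 ∨ y % 5 = 3 ∨ y % 5 = 4 := by omega
        unfold Nat.ModEq
        rcases this with h | h | h | h
        · exact ⟨1, by omega⟩
        · exact ⟨3, by omega⟩
        · exact ⟨2, by omega⟩
        · exact ⟨4, by omega⟩
      have := S.pow_mem h4 n
      rwa [← pow_mul, pow_congr_of D.h5 hn, pow_one] at this
    rw [eq_top_iff]
    intro q _
    rcases D.bru q with ⟨i, j, hij⟩ | ⟨i, j, k, hij⟩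
    · rw [hij]; exact S.mul_mem (S.pow_mem hu _) (S.pow_mem h5 _)
    · rw [hij]
      exact S.mul_mem (S.mul_mem (S.mul_mem (S.pow_mem hu _) (S.pow_mem h5 _)) h3) (S.pow_mem hu _)
end QDsec

section Syl
/-- a Sylow subgroup of prime order -/
lemma exists_sylow {R : Type} [Group R] [Finite R] {c : R} {p : ℕ} (hp : p.Prime) (hc : orderOf c = p)
    (h1 : ¬ p * p ∣ Nat.card R) : ∃ P : Sylow p R, (P : Subgroup R) = Subgroup.zpowers c := by
  have : Fact p.Prime := ⟨hp⟩
  have hd : p ∣ Nat.card R := hc ▸ orderOf_dvd_natCard c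
  have hf : (Nat.card R).factorization p = 1 := by
    have hne : Nat.card R ≠ 0 := Nat.card_pos.ne'
    have h2 := (hp.dvd_iff_one_le_factorization hne).1 hd
    have h3 : ¬ 2 ≤ (Nat.card R).factorization p := by
      intro h
      apply h1
      have := (hp.pow_dvd_iff_le_factorization hne).2 h
      rwa [pow_two] at this
    omega
  refine ⟨Sylow.ofCard (Subgroup.zpowers c) ?_, rfl⟩
  rw [hf, pow_one, Nat.card_zpowers, hc]
lemma sylow_conj {R : Type} [Group R] [Finite R] {c c' : R} {p : ℕ} (hp : p.Prime) (hc : orderOf c = p)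
    (hc' : orderOf c' = p) (h1 : ¬ p * p ∣ Nat.card R) :
    ∃ g : R, Subgroup.zpowers (g * c * g⁻¹) = Subgroup.zpowers c' := by
  have : Fact p.Prime := ⟨hp⟩
  obtain ⟨P, hP⟩ := exists_sylow hp hc h1
  obtain ⟨P', hP'⟩ := exists_sylow hp hc' h1
  obtain ⟨g, hg⟩ := MulAction.exists_smul_eq R P P'
  refine ⟨g, ?_⟩
  have h2 := congrArg (fun S : Sylow p R => (S : Subgroup R)) hg
  simp only [Sylow.coe_subgroup_smul] at h2
  rw [hP, hP', Subgroup.pointwise_smul_def] at h2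
  have h3 : Subgroup.map (MulAut.conj g).toMonoidHom (Subgroup.zpowers c) = Subgroup.zpowers c' := h2
  rw [MonoidHom.map_zpowers] at h3
  simpa using h3
lemma sylow_count0 {R : Type} [Group R] [Finite R] {c : R} {p : ℕ} (hp : p.Prime) (hc : orderOf c = p)
    (h1 : ¬ p * p ∣ Nat.card R) :
    ∃ n, Nat.card R = n * Nat.card {q : R // nrm (Subgroup.zpowers c) q} ∧ n ≡ 1 [MOD p] := by
  have : Fact p.Prime := ⟨hp⟩
  obtain ⟨P, hP⟩ := exists_sylow hp hc h1
  refine ⟨Nat.card (Sylow p R), ?_, card_sylow_modEq_one p R⟩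
  rw [Sylow.card_eq_index_normalizer P]
  have h2 : Nat.card {q : R // nrm (Subgroup.zpowers c) q} = Nat.card (Subgroup.normalizer (P : Set R)) := by
    apply Nat.card_congr
    apply Equiv.subtypeEquivRight
    intro q
    rw [Subgroup.mem_set_normalizer_iff]
    have : ∀ x, x ∈ P ↔ x ∈ Subgroup.zpowers c := by
      intro x; rw [← hP]; rfl
    unfold nrm
    simp only [SetLike.mem_coe, this]
    exact ⟨fun h y => (h y).symm, fun h y => (h y).symm⟩
  rw [h2, Subgroup.index_mul_card]
lemma burnside0 {R : Type} [Group R] [Finite R] {c : R} {p : ℕ} (hp : p.Prime) (hc : orderOf c = p)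
    (h1 : ¬ p * p ∣ Nat.card R) (hn : ∀ q, nrm (Subgroup.zpowers c) q → q * c = c * q) :
    ∃ K : Subgroup R, Nat.card K * p = Nat.card R := by
  have : Fact p.Prime := ⟨hp⟩
  obtain ⟨P, hP⟩ := exists_sylow hp hc h1
  have hmem : ∀ x, x ∈ P ↔ x ∈ Subgroup.zpowers c := by
    intro x; rw [← hP]; rfl
  have hle : Subgroup.normalizer (P : Set R) ≤ Subgroup.centralizer (P : Set R) := by
    intro q hq
    rw [Subgroup.mem_set_normalizer_iff] at hq
    rw [Subgroup.mem_centralizer_iff]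
    have h2 : q * c = c * q := by
      apply hn
      intro x
      have := hq x
      simp only [SetLike.mem_coe, hmem] at this
      exact this.symm
    intro x hx
    obtain ⟨i, rfl⟩ := Subgroup.mem_zpowers_iff.1 ((hmem x).1 hx)
    have : Commute q c := h2
    exact (this.zpow_right i).symm.eq
  refine ⟨(MonoidHom.transferSylow P hle).ker, ?_⟩
  have h2 := (MonoidHom.ker_transferSylow_isComplement' P hle).card_mul_card
  have h3 : Nat.card (P : Subgroup R) = p := by rw [hP, Nat.card_zpowers, hc]
  rw [h3] at h2
  exact h2
variable {Q : Type} [Group Q] [Fintype Q] {u h w : Q}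
lemma nrm_sub {T : Subgroup Q} {c : Q} (hcT : c ∈ T) (q : T) :
    nrm (Subgroup.zpowers (⟨c, hcT⟩ : T)) q ↔ nrm (Subgroup.zpowers c) (q : Q) := by
  constructor
  · intro hq
    obtain ⟨k, -, hk⟩ := @exists_k T _ (Fintype.ofFinite _) _ _ hq
    apply nrm_zp (k := k)
    have := congrArg (fun x : T => (x : Q)) hk
    simpa using this
  · intro hq
    obtain ⟨k, -, hk⟩ := exists_k hq
    apply @nrm_zp T _ (Fintype.ofFinite _) _ _ k
    apply Subtype.ext
    simpa using hk
lemma sylow_count {T : Subgroup Q} {c : Q} (hcT : c ∈ T) {p : ℕ} (hp : p.Prime) (hc : orderOf c = p)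
    (h1 : ¬ p * p ∣ Nat.card T) :
    ∃ n, Nat.card T = n * Nat.card {q : Q // q ∈ T ∧ nrm (Subgroup.zpowers c) q} ∧ n ≡ 1 [MOD p] := by
  obtain ⟨n, h2, h3⟩ := sylow_count0 (c := (⟨c, hcT⟩ : T)) hp (by rw [← hc]; exact Subgroup.orderOf_mk c hcT) h1
  refine ⟨n, ?_, h3⟩
  rw [h2]
  congr 1
  apply Nat.card_congr
  refine ⟨fun x => ⟨x.1.1, x.1.2, (nrm_sub hcT x.1).1 x.2⟩, fun x => ⟨⟨x.1, x.2.1⟩, (nrm_sub hcT _).2 x.2.2⟩,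
    fun x => rfl, fun x => rfl⟩
lemma burnside {T : Subgroup Q} {c : Q} (hcT : c ∈ T) {p : ℕ} (hp : p.Prime) (hc : orderOf c = p)
    (h1 : ¬ p * p ∣ Nat.card T) (hn : ∀ q ∈ T, nrm (Subgroup.zpowers c) q → q * c = c * q) :
    ∃ K : Subgroup Q, Nat.card K * p = Nat.card T := by
  obtain ⟨K, hK⟩ := burnside0 (c := (⟨c, hcT⟩ : T)) hp (by rw [← hc]; exact Subgroup.orderOf_mk c hcT) h1
    (fun q hq => Subtype.ext (hn q q.2 ((nrm_sub hcT q).1 hq)))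
  refine ⟨K.map T.subtype, ?_⟩
  rw [← hK]
  congr 1
  exact (Nat.card_congr (K.equivMapOfInjective _ T.subtype_injective).toEquiv).symm
lemma ex_ord {T : Subgroup Q} {p : ℕ} (hp : p.Prime) (h1 : p ∣ Nat.card T) : ∃ c ∈ T, orderOf c = p := by
  have : Fact p.Prime := ⟨hp⟩
  obtain ⟨c, hc⟩ := exists_prime_orderOf_dvd_card' p h1
  exact ⟨c, c.2, by rw [← hc, Subgroup.orderOf_coe]⟩
lemma QD.ex_h (D : QD Q u h w) {T : Subgroup Q} (h1 : 5 ∣ Nat.card T) :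
    ∃ u' h' w', QD Q u' h' w' ∧ h' ∈ T := by
  obtain ⟨c, hcT, hc⟩ := ex_ord (by norm_num) h1
  obtain ⟨g, hg⟩ := sylow_conj (by norm_num) D.ord_h hc (by rw [D.card]; norm_num)
  refine ⟨_, _, _, D.conj g, ?_⟩
  have : Subgroup.zpowers (g * h * g⁻¹) ≤ T := by rw [hg, Subgroup.zpowers_le]; exact hcT
  exact this (Subgroup.mem_zpowers _)
lemma QD.ex_u (D : QD Q u h w) {T : Subgroup Q} (h1 : 11 ∣ Nat.card T) :
    ∃ u' h' w', QD Q u' h' w' ∧ u' ∈ T := by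
  obtain ⟨c, hcT, hc⟩ := ex_ord (by norm_num) h1
  obtain ⟨g, hg⟩ := sylow_conj (by norm_num) D.ord_u hc (by rw [D.card]; norm_num)
  refine ⟨_, _, _, D.conj g, ?_⟩
  have : Subgroup.zpowers (g * u * g⁻¹) ≤ T := by rw [hg, Subgroup.zpowers_le]; exact hcT
  exact this (Subgroup.mem_zpowers _)
lemma QD.cent3 (D : QD Q u h w) {c : Q} (hc : orderOf c = 3) : Nat.card (Subgroup.centralizer {c}) = 6 := by
  obtain ⟨c0, h1, h2⟩ := D.c3
  obtain ⟨g, hg⟩ := sylow_conj (by norm_num) h1 hc (by rw [D.card]; norm_num)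
  rw [← h2]
  obtain ⟨i, hi⟩ : ∃ i : ℤ, (g * c0 * g⁻¹) ^ i = c := Subgroup.mem_zpowers_iff.1 (hg ▸ Subgroup.mem_zpowers c)
  obtain ⟨j, hj⟩ : ∃ i : ℤ, c ^ i = g * c0 * g⁻¹ := Subgroup.mem_zpowers_iff.1 (hg ▸ Subgroup.mem_zpowers _)
  have key : ∀ x, x ∈ Subgroup.centralizer {c} ↔ g⁻¹ * x * g ∈ Subgroup.centralizer {c0} := by
    intro x
    rw [Subgroup.mem_centralizer_singleton_iff, Subgroup.mem_centralizer_singleton_iff]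
    constructor
    · intro hx
      have h3 : Commute (c ^ j) x := Commute.zpow_left (show Commute c x by first | exact hx | exact hx.symm) j
      rw [hj] at h3
      have h4 := congrArg (fun y => g⁻¹ * y * g) h3.eq
      simp only [mul_assoc, inv_mul_cancel_left] at h4 ⊢
      first | (simpa using h4) | (simpa using h4.symm)
    · intro hx
      have h3 : Commute (g * c0 * g⁻¹) x := by
        have h4 := congrArg (fun y => g * y * g⁻¹) hx
        simp only [mul_assoc, mul_inv_cancel_left] at h4
        show g * c0 * g⁻¹ * x = x * (g * c0 * g⁻¹)
        simp only [mul_assoc]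
        first | (simpa using h4) | (simpa using h4.symm)
      have h4 := h3.zpow_left i
      rw [hi] at h4
      first | exact h4.eq | exact h4.eq.symm
  apply Nat.card_congr
  exact (MulAut.conj g⁻¹).toEquiv.subtypeEquiv (by intro x; rw [key]; simp)
lemma QD.card_nh (D : QD Q u h w) {T : Subgroup Q} (hT : h ∈ T) :
    (w ∈ T ∧ Nat.card {q : Q // q ∈ T ∧ nrm (Subgroup.zpowers h) q} = 10) ∨
    (Nat.card {q : Q // q ∈ T ∧ nrm (Subgroup.zpowers h) q} = 5) := by
  by_cases hw : w ∈ T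
  · left
    refine ⟨hw, ?_⟩
    have hn : ∀ a : ZMod 5 × Fin 2, h ^ (ZMod.val a.1) * w ^ a.2.val ∈ T ∧ nrm (Subgroup.zpowers h) (h ^ a.1.val * w ^ a.2.val) := by
      intro a
      refine ⟨T.mul_mem (T.pow_mem hT _) (T.pow_mem hw _), ?_⟩
      apply nrm_zp (k := 4 ^ a.2.val)
      have h4 := D.whpow 1
      rw [pow_one, mul_one] at h4
      obtain ⟨a1, a2⟩ := a
      fin_cases a2
      · simp only [Fin.zero_eta, Fin.val_zero, pow_zero, mul_one, pow_one]; group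
      · have e : h ^ a1.val * w * h = h ^ 4 * (h ^ a1.val * w) := by
          rw [mul_assoc, h4, ← mul_assoc, ← mul_assoc, ← pow_add, ← pow_add, add_comm]
        simp only [Fin.mk_one, Fin.val_one, pow_one]
        rw [e]; group
    let f : ZMod 5 × Fin 2 → {q : Q // q ∈ T ∧ nrm (Subgroup.zpowers h) q} := fun a => ⟨_, hn a⟩
    have hf : Function.Bijective f := by
      constructor
      · rintro ⟨a1, a2⟩ ⟨b1, b2⟩ hab
        have h1 : h ^ a1.val * w ^ a2.val = h ^ b1.val * w ^ b2.val := congrArg Subtype.val hab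
        have h2 := D.hd_h _ a2.2 _ b2.2 _ _ h1
        rw [h2] at h1
        have h3 := mul_right_cancel h1
        have h4 := (D.nf1 (i := 0) (i' := 0) (j := a1.val) (j' := b1.val) (by rw [h3])).2
        have h5 := Nat.ModEq.eq_of_lt_of_lt h4 (ZMod.val_lt _) (ZMod.val_lt _)
        have h6 : a1 = b1 := ZMod.val_injective 5 h5
        have h7 : a2 = b2 := Fin.ext h2
        rw [h6, h7]
      · rintro ⟨q, hq1, hq2⟩
        obtain ⟨x, s, hs, hq⟩ := D.nrm_h hq2
        refine ⟨((x : ZMod 5), ⟨s, hs⟩), ?_⟩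
        apply Subtype.ext
        simp only [f, ZMod.val_natCast, pow_mod_of D.h5, hq]
    rw [← Nat.card_eq_of_bijective f hf]
    simp
  · right
    have : Nat.card {q : Q // q ∈ T ∧ nrm (Subgroup.zpowers h) q} = Nat.card (Subgroup.zpowers h) := by
      apply Nat.card_congr
      apply Equiv.subtypeEquivRight
      intro q
      constructor
      · rintro ⟨hq1, hq2⟩
        obtain ⟨x, s, hs, hq⟩ := D.nrm_h hq2
        interval_cases s
        · rw [hq]; simp
        · exfalso
          apply hw
          have : w = (h ^ x)⁻¹ * q := by rw [hq]; simp
          rw [this]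
          exact T.mul_mem (T.inv_mem (T.pow_mem hT _)) hq1
      · intro hq
        have hle : Subgroup.zpowers h ≤ T := by rw [Subgroup.zpowers_le]; exact hT
        refine ⟨hle hq, fun x => ?_⟩
        have h1 := hq
        constructor
        · intro hx
          have := (Subgroup.zpowers h).mul_mem ((Subgroup.zpowers h).mul_mem ((Subgroup.zpowers h).inv_mem hq) hx) hq
          simpa [mul_assoc] using this
        · intro hx
          exact (Subgroup.zpowers h).mul_mem ((Subgroup.zpowers h).mul_mem hq hx) ((Subgroup.zpowers h).inv_mem hq)
    rw [this, Nat.card_zpowers, D.ord_h]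
/-- possible orders of subgroups containing an element of order five -/
lemma QD.no_order (D : QD Q u h w) (T : Subgroup Q) :
    Nat.card T ≠ 15 ∧ Nat.card T ≠ 20 := by
  have main : ∀ n, (n = 15 ∨ n = 20) → Nat.card T ≠ n := by
    intro n hn hT
    obtain ⟨u', h', w', D', hm⟩ := D.ex_h (T := T) (by omega)
    obtain ⟨k, h1, h2⟩ := sylow_count hm (by norm_num) D'.ord_h (by rw [hT]; omega)
    rcases D'.card_nh hm with ⟨-, h3⟩ | h3
    · rw [h3, hT] at h1; unfold Nat.ModEq at h2; omega
    · rw [h3, hT] at h1; unfold Nat.ModEq at h2; omega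
  exact ⟨main 15 (by simp), main 20 (by simp)⟩
lemma QD.no_30 (D : QD Q u h w) (T : Subgroup Q) : Nat.card T ≠ 30 := by
  intro hT
  obtain ⟨c, hcT, hc⟩ := ex_ord (T := T) (p := 2) (by norm_num) (by rw [hT]; norm_num)
  obtain ⟨K, hK⟩ := burnside hcT (by norm_num) hc (by rw [hT]; norm_num) (by
    intro q _ hq
    obtain ⟨k, hk, h1⟩ := exists_k hq
    rw [hc] at hk
    interval_cases k
    · exfalso
      have : c = 1 := by
        have := congrArg (fun y => q⁻¹ * y * q) h1
        simpa [mul_assoc] using this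
      rw [this] at hc; simp at hc
    · rw [pow_one] at h1
      exact mul_inv_eq_iff_eq_mul.1 h1)
  exact (D.no_order K).1 (by omega)
lemma QD.order60_w (D : QD Q u h w) {T : Subgroup Q} (hT : Nat.card T = 60) (hm : h ∈ T) : w ∈ T := by
  obtain ⟨k, h1, h2⟩ := sylow_count hm (by norm_num) D.ord_h (by rw [hT]; norm_num)
  rcases D.card_nh hm with ⟨hw, -⟩ | h3
  · exact hw
  · rw [h3, hT] at h1; unfold Nat.ModEq at h2; omega
lemma card_cent {T : Subgroup Q} {c : Q} : Nat.card {q : Q // q ∈ T ∧ q * c = c * q} =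
    Nat.card (T ⊓ Subgroup.centralizer {c} : Subgroup Q) := by
  apply Nat.card_congr
  apply Equiv.subtypeEquivRight
  intro q
  rw [Subgroup.mem_inf, Subgroup.mem_centralizer_singleton_iff]
lemma QD.cent_le (D : QD Q u h w) {T : Subgroup Q} {c : Q} (hc : orderOf c = 3) :
    Nat.card {q : Q // q ∈ T ∧ q * c = c * q} ∣ 6 := by
  rw [card_cent, ← D.cent3 hc]
  exact Subgroup.card_dvd_of_le inf_le_right
lemma QD.cent60 (D : QD Q u h w) {T : Subgroup Q} {c : Q} (hT : Nat.card T = 60) (hcT : c ∈ T)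
    (hc : orderOf c = 3) : Nat.card {q : Q // q ∈ T ∧ q * c = c * q} ≤ 3 := by
  by_contra hgt
  have hd := D.cent_le (T := T) hc
  have h6 : Nat.card {q : Q // q ∈ T ∧ q * c = c * q} = 6 := by
    have := Nat.le_of_dvd (by norm_num) hd
    interval_cases hh : Nat.card {q : Q // q ∈ T ∧ q * c = c * q} <;> omega
  -- the centraliser has index at most two in the normaliser
  obtain ⟨n, h1, h2⟩ := sylow_count hcT (by norm_num) hc (by rw [hT]; norm_num)
  have hsub : ∀ q, (q ∈ T ∧ q * c = c * q) → (q ∈ T ∧ nrm (Subgroup.zpowers c) q) := by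
    rintro q ⟨a, b⟩
    refine ⟨a, nrm_zp (k := 1) ?_⟩
    rw [b]; group
  have hle1 : 6 ≤ Nat.card {q : Q // q ∈ T ∧ nrm (Subgroup.zpowers c) q} := by
    rw [← h6]
    exact Nat.card_le_card_of_injective (fun x => ⟨x.1, hsub x.1 x.2⟩) (by
      intro x y hxy; simpa [Subtype.ext_iff] using hxy)
  by_cases hall : ∀ q ∈ T, nrm (Subgroup.zpowers c) q → q * c = c * q
  · obtain ⟨K, hK⟩ := burnside hcT (by norm_num) hc (by rw [hT]; norm_num) hall
    exact (D.no_order K).2 (by omega)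
  · push Not at hall
    obtain ⟨t, htT, htn, htc⟩ := hall
    have hinv : ∀ q, nrm (Subgroup.zpowers c) q → q * c ≠ c * q → q * c * q⁻¹ = c ^ 2 := by
      intro q hq hne
      obtain ⟨k, hk, h3⟩ := exists_k hq
      rw [hc] at hk
      interval_cases k
      · exfalso
        have : c = 1 := by
          have := congrArg (fun y => q⁻¹ * y * q) h3
          simpa [mul_assoc] using this
        rw [this] at hc; simp at hc
      · rw [pow_one] at h3
        exact absurd (mul_inv_eq_iff_eq_mul.1 h3) hne
      · exact h3
    have hle2 : Nat.card {q : Q // q ∈ T ∧ nrm (Subgroup.zpowers c) q} ≤ 12 := by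
      have hcov : ∀ q, (q ∈ T ∧ nrm (Subgroup.zpowers c) q) →
          (q ∈ T ∧ q * c = c * q) ∨ (t⁻¹ * q ∈ T ∧ (t⁻¹ * q) * c = c * (t⁻¹ * q)) := by
        rintro q ⟨a, b⟩
        by_cases hq : q * c = c * q
        · exact Or.inl ⟨a, hq⟩
        · right
          refine ⟨T.mul_mem (T.inv_mem htT) a, ?_⟩
          have e1 := hinv q b hq
          have e2 := hinv t htn htc
          have e3 : q * c * q⁻¹ = t * c * t⁻¹ := by rw [e1, e2]
          have e4 := congrArg (fun y => t⁻¹ * y * q) e3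
          simpa [mul_assoc] using e4
      classical
      have h7 : Nat.card {q : Q // q ∈ T ∧ nrm (Subgroup.zpowers c) q} ≤
          Nat.card ({q : Q // q ∈ T ∧ q * c = c * q} ⊕ {q : Q // q ∈ T ∧ q * c = c * q}) := by
        apply Nat.card_le_card_of_injective
          (fun x => if hx : x.1 ∈ T ∧ x.1 * c = c * x.1 then Sum.inl ⟨x.1, hx⟩ else
            Sum.inr ⟨t⁻¹ * x.1, (hcov x.1 x.2).resolve_left hx⟩)
        intro x y hxy
        apply Subtype.ext
        by_cases hx : x.1 ∈ T ∧ x.1 * c = c * x.1 <;> by_cases hy : y.1 ∈ T ∧ y.1 * c = c * y.1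
        · simpa [hx, hy] using hxy
        · simp [hx, hy] at hxy
        · simp [hx, hy] at hxy
        · simpa [hx, hy] using hxy
      rw [Nat.card_sum, h6] at h7
      exact h7
    rw [hT] at h1
    have hall6 : Nat.card {q : Q // q ∈ T ∧ nrm (Subgroup.zpowers c) q} = 6 := by
      unfold Nat.ModEq at h2
      interval_cases hh : Nat.card {q : Q // q ∈ T ∧ nrm (Subgroup.zpowers c) q} <;> omega
    -- then the two sets coincide
    have hbij : Function.Bijective (fun x : {q : Q // q ∈ T ∧ q * c = c * q} =>
        (⟨x.1, hsub x.1 x.2⟩ : {q : Q // q ∈ T ∧ nrm (Subgroup.zpowers c) q})) := by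
      apply Function.Injective.bijective_of_nat_card_le _ (by rw [h6, hall6])
      · intro x y hxy; simpa [Subtype.ext_iff] using hxy
    obtain ⟨x, hx⟩ := hbij.2 ⟨t, htT, htn⟩
    have hxt : x.1 = t := congrArg Subtype.val hx
    exact htc (hxt ▸ x.2.2)
/-- orders divisible by eleven -/
lemma QD.eleven (D : QD Q u h w) {T : Subgroup Q} (h1 : 11 ∣ Nat.card T) : T = ⊤ ∨ Nat.card T ∣ 55 := by
  obtain ⟨u', h', w', D', hm⟩ := D.ex_u h1
  exact D'.sub_u T hm
lemma QD.orders (D : QD Q u h w) (T : Subgroup Q) : T = ⊤ ∨ Nat.card T ∣ 55 ∨ Nat.card T = 60 ∨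
    Nat.card T = 12 ∨ Nat.card T = 10 ∨ Nat.card T ∣ 4 ∨ Nat.card T = 3 ∨ Nat.card T = 6 := by
  by_cases h11 : 11 ∣ Nat.card T
  · rcases D.eleven h11 with h1 | h1
    · exact Or.inl h1
    · exact Or.inr (Or.inl h1)
  · have hd : Nat.card T ∣ 660 := by rw [← D.card]; exact Subgroup.card_subgroup_dvd_card T
    have hd2 : Nat.card T ∣ 60 := by
      have hco : Nat.Coprime (Nat.card T) 11 := by
        rw [Nat.coprime_comm]; exact (Nat.Prime.coprime_iff_not_dvd (by norm_num)).2 h11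
      exact hco.dvd_of_dvd_mul_right (m := 60) (by simpa using hd)
    have h1 := D.no_order T
    have h2 := D.no_30 T
    have hmem : Nat.card T ∈ Nat.divisors 60 := by simp [hd2]
    have hdiv : Nat.divisors 60 = {1,2,3,4,5,6,10,12,15,20,30,60} := by decide +kernel
    rw [hdiv] at hmem
    simp only [Finset.mem_insert, Finset.mem_singleton] at hmem
    rcases hmem with h | h | h | h | h | h | h | h | h | h | h | h <;> rw [h] at h1 h2 ⊢ <;> simp at h1 h2 ⊢
end Syl

section SLsec
instance fact_prime_eleven : Fact (Nat.Prime 11) := ⟨by norm_num⟩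
abbrev S11 : Type := Matrix.SpecialLinearGroup (Fin 2) (ZMod 11)
def sU : S11 := ⟨!![1, 1; 0, 1], by rw [Matrix.det_fin_two_of]; decide⟩
def sH : S11 := ⟨!![3, 0; 0, 4], by rw [Matrix.det_fin_two_of]; decide⟩
def sW : S11 := ⟨!![0, -1; 1, 0], by rw [Matrix.det_fin_two_of]; decide⟩
def sG : S11 := ⟨!![0, -1; 1, -1], by rw [Matrix.det_fin_two_of]; decide⟩
lemma m22 {a b c d a' b' c' d' : ZMod 11} (h1 : a = a') (h2 : b = b') (h3 : c = c') (h4 : d = d') :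
    !![a, b; c, d] = !![a', b'; c', d'] := by rw [h1, h2, h3, h4]
lemma sU_pow (i : ℕ) : ((sU ^ i : S11) : Matrix (Fin 2) (Fin 2) (ZMod 11)) = !![1, (i : ZMod 11); 0, 1] := by
  induction i with
  | zero => simp [Matrix.one_fin_two]
  | succ n ih =>
    rw [pow_succ, Matrix.SpecialLinearGroup.coe_mul, ih]
    simp only [sU, Matrix.mul_fin_two]
    push_cast
    apply m22 <;> ring
lemma sH_pow (i : ℕ) : ((sH ^ i : S11) : Matrix (Fin 2) (Fin 2) (ZMod 11)) = !![3 ^ i, 0; 0, 4 ^ i] := by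
  induction i with
  | zero => simp [Matrix.one_fin_two]
  | succ n ih =>
    rw [pow_succ, Matrix.SpecialLinearGroup.coe_mul, ih]
    simp only [sH, Matrix.mul_fin_two]
    apply m22 <;> ring
lemma sl_eta (x : S11) : ∃ a b c d : ZMod 11, (x : Matrix (Fin 2) (Fin 2) (ZMod 11)) = !![a, b; c, d] ∧ a * d - b * c = 1 := by
  refine ⟨x 0 0, x 0 1, x 1 0, x 1 1, Matrix.eta_fin_two _, ?_⟩
  have := x.2
  rwa [Matrix.det_fin_two] at this
lemma bru_sl (x : S11) : (∃ i j : ℕ, x = sU ^ i * sH ^ j ∨ x = - (sU ^ i * sH ^ j)) ∨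
    (∃ i j k : ℕ, x = sU ^ i * sH ^ j * sW * sU ^ k ∨ x = - (sU ^ i * sH ^ j * sW * sU ^ k)) := by
  obtain ⟨a, b, c, d, hx, hd⟩ := sl_eta x
  have h12 : ∀ j : ℕ, (3 : ZMod 11) ^ j * 4 ^ j = 1 := by
    intro j; rw [← mul_pow, show (3 * 4 : ZMod 11) = 1 by decide, one_pow]
  have e1 : ∀ i j : ℕ, ((sU ^ i * sH ^ j : S11) : Matrix (Fin 2) (Fin 2) (ZMod 11)) =
      !![3 ^ j, (i : ZMod 11) * 4 ^ j; 0, 4 ^ j] := by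
    intro i j
    rw [Matrix.SpecialLinearGroup.coe_mul, sU_pow, sH_pow, Matrix.mul_fin_two]
    apply m22 <;> ring
  have e2 : ∀ i j k : ℕ, ((sU ^ i * sH ^ j * sW * sU ^ k : S11) : Matrix (Fin 2) (Fin 2) (ZMod 11)) =
      !![(i : ZMod 11) * 4 ^ j, (i : ZMod 11) * k * 4 ^ j - 3 ^ j; 4 ^ j, k * 4 ^ j] := by
    intro i j k
    rw [Matrix.SpecialLinearGroup.coe_mul, Matrix.SpecialLinearGroup.coe_mul, e1, sU_pow, sW,
      Matrix.mul_fin_two, Matrix.mul_fin_two]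
    apply m22 <;> ring
  have hcl : ∀ y : ZMod 11, y ≠ 0 → ∃ j : ℕ, y = 4 ^ j ∨ y = - 4 ^ j := by
    have : ∀ y : ZMod 11, y ≠ 0 → ∃ j : Fin 5, y = 4 ^ j.val ∨ y = - 4 ^ j.val := by decide
    intro y hy
    obtain ⟨j, hj⟩ := this y hy
    exact ⟨j, hj⟩
  by_cases hc : c = 0
  · left
    subst hc
    have hd0 : d ≠ 0 := by rintro rfl; simp at hd
    obtain ⟨j, hj⟩ := hcl d hd0
    have ha : a * d = 1 := by simpa using hd
    rcases hj with hj | hj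
    · refine ⟨(b * 3 ^ j).val, j, Or.inl (Subtype.ext ?_)⟩
      rw [hx, e1, ZMod.natCast_zmod_val, hj]
      have h1 : a = 3 ^ j := by
        have := h12 j
        calc a = a * (3 ^ j * 4 ^ j) := by rw [this, mul_one]
          _ = (a * d) * 3 ^ j := by rw [hj]; ring
          _ = 3 ^ j := by rw [ha, one_mul]
      rw [h1, mul_assoc, h12, mul_one]
    · refine ⟨(-(b * 3 ^ j)).val, j, Or.inr (Subtype.ext ?_)⟩
      rw [Matrix.SpecialLinearGroup.coe_neg, hx, e1, ZMod.natCast_zmod_val, hj]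
      have h1 : a = - 3 ^ j := by
        have := h12 j
        calc a = a * (3 ^ j * 4 ^ j) := by rw [this, mul_one]
          _ = - ((a * d) * 3 ^ j) := by rw [hj]; ring
          _ = - 3 ^ j := by rw [ha, one_mul]
      have h2 : b = - (-(b * 3 ^ j) * 4 ^ j) := by
        have := h12 j
        calc b = b * (3 ^ j * 4 ^ j) := by rw [this, mul_one]
          _ = _ := by ring
      rw [h1]
      ext p q
      fin_cases p <;> fin_cases q <;> simp
      simpa using h2
  · right
    obtain ⟨j, hj⟩ := hcl c hc
    rcases hj with hj | hj
    · refine ⟨(a * 3 ^ j).val, j, (d * 3 ^ j).val, Or.inl (Subtype.ext ?_)⟩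
      rw [hx, e2, ZMod.natCast_zmod_val, ZMod.natCast_zmod_val]
      have h1 := h12 j
      rw [hj] at hd ⊢
      apply m22
      · linear_combination (- a) * h1
      · linear_combination (-b - a * d * 3 ^ j) * h1 - 3 ^ j * hd
      · rfl
      · linear_combination (- d) * h1
    · refine ⟨(-(a * 3 ^ j)).val, j, (-(d * 3 ^ j)).val, Or.inr (Subtype.ext ?_)⟩
      rw [Matrix.SpecialLinearGroup.coe_neg, hx, e2, ZMod.natCast_zmod_val, ZMod.natCast_zmod_val]
      have h1 := h12 j
      rw [hj] at hd ⊢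
      ext p q
      fin_cases p <;> fin_cases q <;> simp
      · linear_combination (- a) * h1
      · linear_combination (-b + a * d * 3 ^ j) * h1 + 3 ^ j * hd
      · linear_combination (- d) * h1
lemma card_S11 : Nat.card S11 = 1320 := by
  have h1 := Matrix.card_GL_field (𝔽 := ZMod 11) 2
  have h2 : Nat.card (GL (Fin 2) (ZMod 11)) = 13200 := by
    rw [h1, ZMod.card]; decide
  have hs : Function.Surjective (Matrix.GeneralLinearGroup.det : GL (Fin 2) (ZMod 11) →* (ZMod 11)ˣ) := by
    intro a
    refine ⟨Matrix.GeneralLinearGroup.mk'' !![(a : ZMod 11), 0; 0, 1] (by simp), ?_⟩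
    ext
    show Matrix.det !![(a : ZMod 11), 0; 0, 1] = a
    simp
  have h3 := Subgroup.index_mul_card (Matrix.GeneralLinearGroup.det : GL (Fin 2) (ZMod 11) →* (ZMod 11)ˣ).ker
  rw [Subgroup.index_ker, MonoidHom.range_eq_top.2 hs, Subgroup.card_top, h2, Nat.card_units, Nat.card_zmod] at h3
  have h4 : Nat.card S11 = Nat.card (Matrix.GeneralLinearGroup.det : GL (Fin 2) (ZMod 11) →* (ZMod 11)ˣ).ker := by
    apply Nat.card_eq_of_bijective (fun x : S11 => (⟨Matrix.SpecialLinearGroup.toGL x, by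
      rw [MonoidHom.mem_ker]; ext; simp⟩ : (Matrix.GeneralLinearGroup.det : GL (Fin 2) (ZMod 11) →* (ZMod 11)ˣ).ker))
    constructor
    · intro x y hxy
      exact Matrix.SpecialLinearGroup.toGL_injective (congrArg Subtype.val hxy)
    · rintro ⟨y, hy⟩
      rw [MonoidHom.mem_ker] at hy
      have := congrArg Units.val hy
      refine ⟨⟨y.val, by simpa using this⟩, ?_⟩
      apply Subtype.ext
      ext i j
      rfl
  omega
lemma QD_of {Q : Type} [Group Q] [Fintype Q] (ρ : S11 →* Q) (hs : Function.Surjective ρ)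
    (hk : ∀ x, ρ x = 1 ↔ x = 1 ∨ x = -1) : QD Q (ρ sU) (ρ sH) (ρ sW) := by
  have hneg1 : ρ (-1) = 1 := (hk _).2 (Or.inr rfl)
  have hneg : ∀ x, ρ (-x) = ρ x := by
    intro x; rw [← neg_one_mul, map_mul, hneg1, one_mul]
  have hne : (1 : S11) ≠ -1 := by
    intro h; have := congrArg (fun x : S11 => x 0 0) h
    simp at this; exact absurd this (by decide +kernel)
  have hker : Nat.card ρ.ker = 2 := by
    have : (ρ.ker : Set S11) = {1, -1} := by
      ext x; simp [MonoidHom.mem_ker, hk]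
    rw [← SetLike.coe_sort_coe, this, Nat.card_coe_set_eq, Set.ncard_pair hne]
  have hsub : ∀ x y : S11, (x : Matrix (Fin 2) (Fin 2) (ZMod 11)) = y → x = y := fun x y h => Subtype.ext h
  have cm := @Matrix.SpecialLinearGroup.coe_mul (Fin 2) _ _ (ZMod 11) _
  have cn := @Matrix.SpecialLinearGroup.coe_neg (Fin 2) _ _ (ZMod 11) _ _
  have e5 : sH ^ 5 = 1 := by
    apply hsub; rw [sH_pow]; decide +kernel
  refine ⟨?_, ?_, ?_, ?_, ?_, ?_, ?_, ?_, ?_, ?_, ?_⟩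
  · have := card_comap hs ⊤
    rw [Subgroup.comap_top, Subgroup.card_top, Subgroup.card_top, card_S11, hker] at this
    omega
  · rw [← map_pow, hk]; left
    apply hsub; rw [sU_pow]; decide +kernel
  · rw [← map_pow, e5, map_one]
  · rw [← map_mul, hk]; right
    apply hsub; decide +kernel
  · rw [← map_inv, ← map_mul, ← map_mul, ← map_pow]; refine congrArg ρ ?_
    rw [mul_inv_eq_iff_eq_mul]
    apply hsub; rw [cm, cm, sU_pow, sU, sH, Matrix.mul_fin_two, Matrix.mul_fin_two]; decide +kernel
  · rw [← map_inv, ← map_mul, ← map_mul, ← map_inv]; refine congrArg ρ ?_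
    rw [mul_inv_eq_iff_eq_mul, eq_inv_mul_iff_mul_eq]
    apply hsub; decide +kernel
  · intro q
    obtain ⟨x, rfl⟩ := hs q
    rcases bru_sl x with ⟨i, j, h⟩ | ⟨i, j, k, h⟩
    · left; refine ⟨i, j, ?_⟩
      rcases h with h | h
      · rw [h, map_mul, map_pow, map_pow]
      · rw [h, hneg, map_mul, map_pow, map_pow]
    · right; refine ⟨i, j, k, ?_⟩
      rcases h with h | h
      · rw [h, map_mul, map_mul, map_mul, map_pow, map_pow, map_pow]
      · rw [h, hneg, map_mul, map_mul, map_mul, map_pow, map_pow, map_pow]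
  · simp only [← map_mul]
    rw [hk]
    have : sU * sW * sU * sW * sU * sW = -1 := by
      apply hsub
      simp only [cm, sU, sW, cn, Matrix.mul_fin_two, Matrix.SpecialLinearGroup.coe_one, Matrix.one_fin_two]
      decide +kernel
    exact Or.inr this
  · refine ⟨5, 3, 5, by norm_num, ?_⟩
    simp only [← map_mul, ← map_pow]
    rw [← hneg]
    refine congrArg ρ ?_
    apply hsub
    simp only [cm, cn, sU_pow, sH_pow, sW, Matrix.mul_fin_two]
    decide +kernel
  · intro s h1
    have hm : sH ^ s = sH ^ (s % 5) := by
      conv_lhs => rw [← Nat.div_add_mod s 5, pow_add, pow_mul, e5, one_pow, one_mul]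
    rw [← map_pow, hm, ← map_mul, ← map_mul, ← map_pow, hk] at h1
    have key : ∀ t < 5, ((sU * (sW * sH ^ t)) ^ 3 = 1 ∨ (sU * (sW * sH ^ t)) ^ 3 = -1) → t = 0 := by
      intro t ht h2
      have h3 : ((sU * (sW * sH ^ t)) ^ 3 : S11) 1 0 = 0 := by
        rcases h2 with h2 | h2
        · rw [h2]; rfl
        · rw [h2]; rfl
      rw [show ((sU * (sW * sH ^ t)) ^ 3 : S11) = (sU * (sW * sH ^ t)) * (sU * (sW * sH ^ t)) * (sU * (sW * sH ^ t)) by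
        rw [pow_succ, pow_two]] at h3
      simp only [cm, sH_pow, sU, sW, Matrix.mul_fin_two] at h3
      revert h3
      interval_cases t <;> decide +kernel
    have := key (s % 5) (Nat.mod_lt _ (by norm_num)) h1
    omega
  · have g3 : sG ^ 3 = 1 := by apply hsub; rw [pow_succ, pow_two]; decide +kernel
    have gne : ρ sG ≠ 1 := by
      rw [Ne, hk]
      rintro (h | h)
      · have := congrArg (fun x : S11 => x 0 0) h; exact absurd this (by decide +kernel)
      · have := congrArg (fun x : S11 => x 0 0) h; exact absurd this (by decide +kernel)
    have : Fact (Nat.Prime 3) := ⟨by norm_num⟩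
    refine ⟨ρ sG, orderOf_eq_prime (by rw [← map_pow, g3, map_one]) gne, ?_⟩
    have h1 := card_comap hs (Subgroup.centralizer {ρ sG})
    rw [hker] at h1
    have h2 : Nat.card ((Subgroup.centralizer {ρ sG}).comap ρ) =
        Nat.card {z : ZMod 11 × ZMod 11 // z.1 * z.1 - z.1 * z.2 + z.2 * z.2 = 1} := by
      have hcomm : ∀ x, x ∈ (Subgroup.centralizer {ρ sG}).comap ρ ↔ x * sG = sG * x := by
        intro x
        rw [Subgroup.mem_comap, Subgroup.mem_centralizer_singleton_iff, ← map_mul, ← map_mul]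
        constructor
        · intro h
          have h3 : ρ (x * sG * x⁻¹ * sG⁻¹) = 1 := by
            rw [map_mul, map_mul, map_inv, map_inv, h, map_mul]; group
          rcases (hk _).1 h3 with h4 | h4
          · rw [mul_inv_eq_iff_eq_mul, one_mul, mul_inv_eq_iff_eq_mul] at h4; exact h4
          · exfalso
            rw [mul_inv_eq_iff_eq_mul] at h4
            have h5 : (x * sG * x⁻¹) ^ 3 = 1 := by rw [conj_pow, g3]; group
            rw [h4] at h5
            have h6 : (-1 * sG : S11) ^ 3 = -1 := by
              rw [neg_one_mul, Odd.neg_pow (by decide +kernel), g3]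
            rw [h6] at h5
            exact hne h5.symm
        · intro h; rw [h]
      have hc2 : ∀ x : S11, x * sG = sG * x ↔ x 0 1 = - x 1 0 ∧ x 1 1 = x 0 0 - x 1 0 := by
        intro x
        obtain ⟨a, b, c, d, hx, hd⟩ := sl_eta x
        have h3 : x * sG = sG * x ↔ (!![a, b; c, d] * !![0, -1; 1, -1] : Matrix (Fin 2) (Fin 2) (ZMod 11)) =
            !![0, -1; 1, -1] * !![a, b; c, d] := by
          rw [← hx]
          exact ⟨fun h => congrArg Subtype.val h, fun h => Subtype.ext h⟩
        rw [h3, hx, Matrix.mul_fin_two, Matrix.mul_fin_two]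
        simp
        constructor
        · rintro ⟨h4, h5⟩
          refine ⟨h4.1, ?_⟩
          rw [← sub_eq_zero]
          have := h5.1
          linear_combination this
        · rintro ⟨rfl, rfl⟩
          refine ⟨⟨rfl, by ring⟩, by ring, by ring⟩
      apply Nat.card_eq_of_bijective (fun x : (Subgroup.centralizer {ρ sG}).comap ρ =>
        (⟨(x.1 0 0, x.1 1 0), by
          have h3 := (hc2 x.1).1 ((hcomm x.1).1 x.2)
          have h4 := x.1.2
          rw [Matrix.det_fin_two] at h4
          rw [h3.1, h3.2] at h4
          linear_combination h4⟩ :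
          {z : ZMod 11 × ZMod 11 // z.1 * z.1 - z.1 * z.2 + z.2 * z.2 = 1}))
      constructor
      · intro x y hxy
        simp only [Subtype.mk.injEq, Prod.mk.injEq] at hxy
        have hx := (hc2 x.1).1 ((hcomm x.1).1 x.2)
        have hy := (hc2 y.1).1 ((hcomm y.1).1 y.2)
        apply Subtype.ext
        ext i j
        fin_cases i <;> fin_cases j
        · exact hxy.1
        · show x.1 0 1 = y.1 0 1
          rw [hx.1, hy.1, hxy.2]
        · exact hxy.2
        · show x.1 1 1 = y.1 1 1
          rw [hx.2, hy.2, hxy.1, hxy.2]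
      · rintro ⟨⟨a, c⟩, hz⟩
        simp only at hz
        let x : S11 := ⟨!![a, -c; c, a - c], by rw [Matrix.det_fin_two_of, ← hz]; ring⟩
        refine ⟨⟨x, (hcomm x).2 ((hc2 x).2 ⟨rfl, rfl⟩)⟩, ?_⟩
        rfl
    have h3 : Nat.card {z : ZMod 11 × ZMod 11 // z.1 * z.1 - z.1 * z.2 + z.2 * z.2 = 1} = 12 := by
      rw [Nat.card_eq_fintype_card, Fintype.card_subtype]
      decide +kernel
    omega
/-- The group-theoretic data for any group isomorphic to `PSL(2,11)`. -/
lemma exists_QD (F : Type) [Field F] [Fintype F] (hF : Fintype.card F = 11)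
    {Q : Type} [Group Q] [Fintype Q]
    (e : Q ≃* (Matrix.SpecialLinearGroup (Fin 2) F ⧸ Subgroup.center (Matrix.SpecialLinearGroup (Fin 2) F))) :
    ∃ u h w, QD Q u h w := by
  have i1 : ZMod 11 ≃+* F := ZMod.ringEquivOfPrime F (by norm_num) hF
  let r : S11 →* Matrix.SpecialLinearGroup (Fin 2) F := Matrix.SpecialLinearGroup.map i1.toRingHom
  have hrs : Function.Surjective r := by
    intro y
    refine ⟨Matrix.SpecialLinearGroup.map i1.symm.toRingHom y, ?_⟩
    ext i j
    simp [r, Matrix.SpecialLinearGroup.map_apply_coe]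
  have hrc : ∀ x, r x ∈ Subgroup.center (Matrix.SpecialLinearGroup (Fin 2) F) ↔ x ∈ Subgroup.center S11 := by
    intro x
    have hri : Function.Injective r := by
      intro a b hab
      ext i j
      have := congrArg (fun z : Matrix.SpecialLinearGroup (Fin 2) F => z i j) hab
      simpa [r] using this
    rw [Subgroup.mem_center_iff, Subgroup.mem_center_iff]
    constructor
    · intro h g
      apply hri
      rw [map_mul, map_mul]; exact h _
    · intro h g
      obtain ⟨g, rfl⟩ := hrs g
      rw [← map_mul, ← map_mul, h]
  let ρ : S11 →* Q := e.symm.toMonoidHom.comp ((QuotientGroup.mk' _).comp r)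
  refine ⟨_, _, _, QD_of ρ ?_ ?_⟩
  · intro q
    obtain ⟨y, hy⟩ := QuotientGroup.mk'_surjective _ (e q)
    obtain ⟨x, hx⟩ := hrs y
    refine ⟨x, ?_⟩
    show e.symm (QuotientGroup.mk' _ (r x)) = q
    rw [hx, hy]; simp
  · intro x
    have h1 : ρ x = 1 ↔ x ∈ Subgroup.center S11 := by
      show e.symm (QuotientGroup.mk' _ (r x)) = 1 ↔ _
      rw [MulEquiv.map_eq_one_iff, ← hrc]
      exact QuotientGroup.eq_one_iff _
    rw [h1, Matrix.SpecialLinearGroup.mem_center_iff]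
    constructor
    · rintro ⟨a, ha, hx⟩
      have : a = 1 ∨ a = -1 := by
        simp at ha
        exact ha
      rcases this with rfl | rfl
      · left; apply Subtype.ext; rw [← hx]; simp
      · right; apply Subtype.ext; rw [← hx, Matrix.SpecialLinearGroup.coe_neg]; ext i j; fin_cases i <;> fin_cases j <;> simp
    · rintro (rfl | rfl)
      · exact ⟨1, by simp, by simp⟩
      · exact ⟨-1, by simp, by ext i j; fin_cases i <;> fin_cases j <;> simp [Matrix.SpecialLinearGroup.coe_neg]⟩
end SLsec

section MLevel
variable {X Q : Type} [Group X] [Fintype X] [Group Q] [Fintype Q] {π : X →* Q} {θ : X → ℂ} {u h w : Q}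
lemma case12 (hπ : Function.Surjective π) (D : QD Q u h w) (hθ : Irr π.ker θ)
    (hT : Nat.card (stq π θ) = 12) :
    (∀ ψ ∈ irr (⊤ : Subgroup X), mlt π.ker ψ θ ≤ 3) ∧
      ∃ ψ ∈ irr (⊤ : Subgroup X), mlt π.ker ψ θ = 2 ∨ mlt π.ker ψ θ = 3 := by
  classical
  obtain ⟨c, hcT, hc⟩ := ex_ord (T := stq π θ) (p := 3) (by norm_num) (by rw [hT]; norm_num)
  obtain ⟨ω, lam, E⟩ := exists_ED hπ (by norm_num) hc hθ hcT
  have h3 := E.c3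
  have h6 := D.cent_le (T := stq π θ) (c := c) hc
  refine alg_12 (by rw [sum_sq_top hπ hθ, hT]) (h3.trans ?_)
  rw [Nat.card_eq_fintype_card, Fintype.card_subtype] at h6
  convert Nat.le_of_dvd (by norm_num) h6
lemma case60 (hπ : Function.Surjective π) (D' : QD Q u h w) (hθ : Irr π.ker θ)
    (hT : Nat.card (stq π θ) = 60) :
    (∀ ψ ∈ irr (⊤ : Subgroup X), mlt π.ker ψ θ ≤ 6) ∧
      ∃ ψ ∈ irr (⊤ : Subgroup X), mlt π.ker ψ θ = 4 := by
  classical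
  obtain ⟨c, hcT, hc⟩ := ex_ord (T := stq π θ) (p := 3) (by norm_num) (by rw [hT]; norm_num)
  obtain ⟨ω₃, lam₃, E₃⟩ := exists_ED hπ (by norm_num) hc hθ hcT
  have h3 := E₃.c3
  have h6 := D'.cent60 (T := stq π θ) (c := c) hT hcT hc
  rw [Nat.card_eq_fintype_card, Fintype.card_subtype] at h6
  obtain ⟨u', h', w', D, hh⟩ := D'.ex_h (T := stq π θ) (by rw [hT]; norm_num)
  have hw := D.order60_w hT hh
  have h4 : w' * h' * w'⁻¹ = h' ^ 4 := by
    rw [D.wh]; exact inv_eq_of_mul_eq_one_left (by rw [← pow_succ, D.h5])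
  obtain ⟨ω, lam, E, -, hk, hg⟩ := gram_t hπ (p := 5) (by norm_num) D.ord_h hθ hh hw h4 (by decide)
    (fun q _ hq => D.nrm_h hq) D.hd_h
  rw [hT] at hg
  have ev : ∀ i j n, ((Finset.range 2).filter (fun s => 4 ^ s * j ≡ i [MOD 5])).card = n →
      ∑ ψ ∈ irr (⊤ : Subgroup X), mlt ((Subgroup.zpowers h').comap π) ψ (tw ω i lam) *
        mlt ((Subgroup.zpowers h').comap π) ψ (tw ω j lam) = 2 + n := by
    intro i j n hn
    have := hg i j
    rw [hn] at this
    omega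
  have g00 := ev 0 0 _ rfl
  have g11 := ev 1 1 _ rfl
  have g22 := ev 2 2 _ rfl
  have g01 := ev 0 1 _ rfl
  have g02 := ev 0 2 _ rfl
  have g12 := ev 1 2 _ rfl
  refine alg_60 (a := fun ψ => mlt ((Subgroup.zpowers h').comap π) ψ (tw ω 0 lam))
    (b := fun ψ => mlt ((Subgroup.zpowers h').comap π) ψ (tw ω 1 lam))
    (c := fun ψ => mlt ((Subgroup.zpowers h').comap π) ψ (tw ω 2 lam))
    g00 g11 g22 g01 g02 g12 ?_ (h3.trans ?_)
  · intro ψ hψ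
    rw [E.sum (mem_irr.1 hψ)]
    have k4 := hk 1 ψ (mem_irr.1 hψ)
    have k3 := hk 2 ψ (mem_irr.1 hψ)
    rw [E.lin.tw_mod E.hirr.1 (show 4 * 2 ≡ 3 [MOD 5] by decide)] at k3
    simp only [Finset.sum_range_succ, Finset.sum_range_zero]
    simp only [mul_one] at k4
    omega
  · convert h6
end MLevel

section Borel
variable {X Q : Type} [Group X] [Fintype X] [Group Q] [Fintype Q] {π : X →* Q} {θ : X → ℂ} {u h w : Q}
/-- The Borel subgroup of order `55`. -/
def QD.B (D : QD Q u h w) : Subgroup Q where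
  carrier := {q | ∃ i j : ℕ, q = u ^ i * h ^ j}
  one_mem' := ⟨0, 0, by simp⟩
  mul_mem' := by
    rintro _ _ ⟨i, j, rfl⟩ ⟨i', j', rfl⟩
    refine ⟨i + 9 ^ j * i', j + j', ?_⟩
    rw [pow_add, pow_add, mul_assoc, ← mul_assoc (h ^ j), D.hpow]
    simp only [mul_assoc]
  inv_mem' := by
    rintro _ ⟨i, j, rfl⟩
    refine ⟨9 ^ (4 * j) * (10 * i), 4 * j, ?_⟩
    rw [← D.hpow, mul_inv_rev]
    congr 1
    · apply inv_eq_of_mul_eq_one_left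
      rw [← pow_add, show 4 * j + j = 5 * j by ring, pow_mul, D.h5, one_pow]
    · apply inv_eq_of_mul_eq_one_left
      rw [← pow_add, show 10 * i + i = 11 * i by ring, pow_mul, D.u11, one_pow]
lemma QD.mem_B (D : QD Q u h w) {q : Q} : q ∈ D.B ↔ ∃ i j : ℕ, q = u ^ i * h ^ j := Iff.rfl
lemma QD.u_B (D : QD Q u h w) : u ∈ D.B := ⟨1, 0, by simp⟩
lemma QD.h_B (D : QD Q u h w) : h ∈ D.B := ⟨0, 1, by simp⟩
lemma QD.w_B (D : QD Q u h w) : w ∉ D.B := by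
  rintro ⟨i, j, hij⟩
  exact D.nf3 (i' := 0) (j' := 0) (k' := 0) (by rw [← hij]; simp)
lemma QD.card_B (D : QD Q u h w) : Nat.card D.B = 55 := by
  rcases D.sub_u D.B D.u_B with h1 | h1
  · exact absurd (by rw [h1]; trivial) D.w_B
  · have h2 : 11 ∣ Nat.card D.B := by
      rw [← D.ord_u, ← Subgroup.orderOf_mk u D.u_B]; exact orderOf_dvd_natCard _
    have h3 : 5 ∣ Nat.card D.B := by
      rw [← D.ord_h, ← Subgroup.orderOf_mk h D.h_B]; exact orderOf_dvd_natCard _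
    have h4 : 11 * 5 ∣ Nat.card D.B := Nat.Coprime.mul_dvd_of_dvd_of_dvd (by norm_num) h2 h3
    exact Nat.dvd_antisymm h1 h4
lemma QD.zu_le (D : QD Q u h w) : Subgroup.zpowers u ≤ D.B := by
  rw [Subgroup.zpowers_le]; exact D.u_B
lemma QD.zh_le (D : QD Q u h w) : Subgroup.zpowers h ≤ D.B := by
  rw [Subgroup.zpowers_le]; exact D.h_B
/-- A linear character of the Borel subgroup with kernel `⟨u⟩`. -/
structure LB (π : X →* Q) (u h : Q) (ωB : X → ℂ) : Prop where
  val : ∃ ζ : ℂ, IsPrimitiveRoot ζ 5 ∧ ∀ x (i j : ℕ), π x = u ^ i * h ^ j → ωB x = ζ ^ j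
lemma QD.ex_LB (D : QD Q u h w) (π : X →* Q) : ∃ ωB, LB π u h ωB := by
  classical
  set ζ := Complex.exp (2 * Real.pi * Complex.I / (5 : ℕ)) with hζ
  have hprim : IsPrimitiveRoot ζ 5 := Complex.isPrimitiveRoot_exp 5 (by norm_num)
  refine ⟨fun x => if hx : ∃ i j : ℕ, π x = u ^ i * h ^ j then ζ ^ hx.choose_spec.choose else 0, ζ,
    hprim, ?_⟩
  intro x i j hx
  have hx' : ∃ i j : ℕ, π x = u ^ i * h ^ j := ⟨i, j, hx⟩
  rw [dif_pos hx']
  have h1 := hx'.choose_spec.choose_spec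
  have h2 := hx.symm.trans h1
  exact (pow_eq_pow_of_modEq (D.nf1 h2).2 hprim.pow_eq_one).symm
lemma LB.linB (D : QD Q u h w) {ωB : X → ℂ} (L : LB π u h ωB) :
    Lin (D.B.comap π) ((Subgroup.zpowers u).comap π) 5 ωB := by
  obtain ⟨ζ, hζ, hv⟩ := L.val
  refine ⟨?_, ?_, ?_⟩
  · rintro a ⟨i, j, ha⟩ b ⟨i', j', hb⟩
    rw [hv a i j ha, hv b i' j' hb, ← pow_add]
    apply hv _ (i + 9 ^ j * i')
    rw [map_mul]
    change π a = _ at ha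
    change π b = _ at hb
    rw [ha, hb, pow_add, pow_add, mul_assoc, ← mul_assoc (h ^ j), D.hpow]
    simp only [mul_assoc]
  · rintro a ⟨i, j, ha⟩
    rw [hv a i j ha, hζ.pow_eq_one_iff_dvd, mem_comap_zp]
    change π a = _ at ha
    constructor
    · rintro ⟨k, rfl⟩
      exact ⟨i, by rw [ha, pow_mul, D.h5, one_pow, mul_one]⟩
    · rintro ⟨i', hi'⟩
      rw [ha] at hi'
      have := (D.nf1 (i' := i') (j' := 0) (by rw [hi']; simp)).2
      exact (Nat.modEq_zero_iff_dvd).1 this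
  · rintro a ⟨i, j, ha⟩
    rw [hv a i j ha, ← pow_mul, mul_comm, pow_mul, hζ.pow_eq_one, one_pow]
lemma LB.linH (D : QD Q u h w) {ωB : X → ℂ} (L : LB π u h ωB) :
    Lin ((Subgroup.zpowers h).comap π) π.ker 5 ωB := by
  have LB := L.linB D
  have hle : (Subgroup.zpowers h).comap π ≤ D.B.comap π := Subgroup.comap_mono D.zh_le
  refine ⟨fun a ha b hb => LB.mul a (hle ha) b (hle hb), ?_, fun a ha => LB.pow a (hle ha)⟩
  intro a ha
  rw [LB.one_iff a (hle ha), mem_comap_zp, MonoidHom.mem_ker]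
  constructor
  · rintro ⟨i, hi⟩
    obtain ⟨j, hj⟩ := mem_comap_zp.1 ha
    rw [hi] at hj
    have := (D.nf1 (i := i) (j := 0) (i' := 0) (j' := j) (by simpa using hj)).1
    rw [hi, pow_congr_of D.u11 this, pow_zero]
  · intro h1
    exact ⟨0, by rw [h1, pow_zero]⟩
lemma LB.pw (D : QD Q u h w) {ωB : X → ℂ} (L : LB π u h ωB) (x y : X) (k : ℕ)
    (hx : x ∈ (Subgroup.zpowers h).comap π) (hy : π y = π x ^ k) : ωB y = ωB x ^ k := by
  obtain ⟨ζ, hζ, hv⟩ := L.val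
  obtain ⟨j, hj⟩ := mem_comap_zp.1 hx
  rw [hv x 0 j (by simpa using hj), hv y 0 (j * k) (by rw [hy, hj]; simp [pow_mul]), pow_mul]
/-- restriction to an intermediate subgroup when the degrees agree -/
lemma res_eq {A B : Subgroup X} (hAB : A ≤ B) {f χ : X → ℂ} (hf : Irr B f) (hχ : Irr A χ)
    (hm : mlt A f χ ≠ 0) (hd : f 1 = χ 1) : ∀ x ∈ A, f x = χ x := by
  classical
  have h1 := res_expand hAB hf A.one_mem
  have h2 : dg f = ∑ η ∈ irr A, mlt A f η * dg η := by
    rw [hf.dg_spec.1] at h1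
    rw [Finset.sum_congr rfl (fun η hη => by rw [(mem_irr.1 hη).dg_spec.1])] at h1
    exact_mod_cast h1
  have hdd : dg f = dg χ := by
    rw [hf.dg_spec.1, hχ.dg_spec.1] at hd; exact_mod_cast hd
  rw [← Finset.add_sum_erase _ _ (mem_irr.2 hχ), hdd] at h2
  have hpos := hχ.dg_spec.2
  have h3 : dg χ ≤ mlt A f χ * dg χ := Nat.le_mul_of_pos_left _ (Nat.pos_of_ne_zero hm)
  have h4 : mlt A f χ = 1 := by
    have : mlt A f χ * dg χ ≤ 1 * dg χ := by omega
    have := Nat.le_of_mul_le_mul_right this hpos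
    omega
  have h5 : ∑ η ∈ (irr A).erase χ, mlt A f η * dg η = 0 := by omega
  rw [Finset.sum_eq_zero_iff] at h5
  intro x hx
  rw [res_expand hAB hf hx, ← Finset.add_sum_erase _ _ (mem_irr.2 hχ), h4, Finset.sum_eq_zero]
  · simp
  · intro η hη
    have h6 := h5 η hη
    have h7 := (mem_irr.1 (Finset.mem_of_mem_erase hη)).dg_spec.2
    have : mlt A f η = 0 := by
      rcases Nat.mul_eq_zero.1 h6 with h | h
      · exact h
      · omega
    rw [this]; simp
lemma QD.BwB (D : QD Q u h w) {q : Q} (hq : q ∈ D.B) (hq' : w * q * w⁻¹ ∈ D.B) :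
    q ∈ Subgroup.zpowers h := by
  obtain ⟨i, j, rfl⟩ := hq
  obtain ⟨i', j', h1⟩ := hq'
  have h2 : u ^ i * h ^ j = h ^ j * u ^ (5 ^ j * i) := by
    rw [D.hpow]
    congr 1
    apply pow_congr_of D.u11
    rw [← mul_assoc, ← mul_pow]
    have : (9 * 5) ^ j * i ≡ 1 ^ j * i [MOD 11] := (Nat.ModEq.pow j (by decide)).mul_right i
    rw [one_pow, one_mul] at this
    exact this.symm
  have h3 : u ^ 0 * h ^ (4 * j) * w * u ^ (5 ^ j * i) = u ^ i' * h ^ j' * w * u ^ 0 := by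
    rw [← h1, h2, pow_zero, one_mul, mul_one, ← D.whpow]; group
  have h4 := (D.nf2 h3).2.2
  rw [h2, pow_congr_of D.u11 h4, pow_zero, mul_one]
  exact Subgroup.pow_mem _ (Subgroup.mem_zpowers h) _
end Borel

section Full
variable {X Q : Type} [Group X] [Fintype X] [Group Q] [Fintype Q] {π : X →* Q} {θ : X → ℂ} {u h w : Q}
/-- Extension data in the case of an invariant character. -/
structure FD (π : X →* Q) (θ : X → ℂ) (D : QD Q u h w) (ω lam ωB lamh κ : X → ℂ) : Prop where
  top : stq π θ = ⊤
  E : ED π θ u 11 ω lam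
  fixh : ∀ b, π b = h → cj b lam = lam
  L : LB π u h ωB
  hκ : Irr (D.B.comap π) κ
  κU : ∀ x ∈ (Subgroup.zpowers u).comap π, κ x = lam x
  EH : ED π θ h 5 ωB lamh
  κH : ∀ x ∈ (Subgroup.zpowers h).comap π, κ x = lamh x
  fixw : ∀ b, π b = w → cj b lamh = lamh
variable {D : QD Q u h w} {ω lam ωB lamh κ : X → ℂ}
lemma FD.tw_iff (F : FD π θ D ω lam ωB lamh κ) {i j : ℕ} :
    tw ωB i κ = tw ωB j κ ↔ i ≡ j [MOD 5] := by
  refine ⟨fun h1 => F.EH.inj ?_, fun h1 => (F.L.linB D).tw_mod F.hκ.1 h1⟩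
  ext x
  by_cases hx : x ∈ (Subgroup.zpowers h).comap π
  · have := congrFun h1 x
    simp only [tw, F.κH x hx] at this ⊢
    exact this
  · simp [tw, F.EH.hirr.1 x hx]
lemma FD.ip_in (F : FD π θ D ω lam ωB lamh κ) (i j : ℕ) {b : X} (hb : b ∈ D.B.comap π) :
    ip (cj b (tw ωB j κ)) (tw ωB i κ) = if i ≡ j [MOD 5] then (Nat.card (D.B.comap π) : ℂ) else 0 := by
  classical
  have hj := (F.L.linB D).twist F.hκ j
  have hi := (F.L.linB D).twist F.hκ i
  rw [hj.cj_mem hb, hj.ip_eq hi]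
  simp only [F.tw_iff]
  by_cases h1 : i ≡ j [MOD 5]
  · rw [if_pos h1, if_pos h1.symm]
  · rw [if_neg h1, if_neg (fun h2 => h1 h2.symm)]
lemma FD.ip_out (F : FD π θ D ω lam ωB lamh κ) (i j : ℕ) {b : X} (hb : b ∉ D.B.comap π) :
    ip (cj b (tw ωB j κ)) (tw ωB i κ) =
      if 4 * j ≡ i [MOD 5] then (Nat.card ((Subgroup.zpowers h).comap π) : ℂ) else 0 := by
  classical
  have hj := (F.L.linB D).twist F.hκ j
  have hi := (F.L.linB D).twist F.hκ i
  rcases D.bru (π b) with ⟨i1, j1, h1⟩ | ⟨i1, j1, k1, h1⟩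
  · exact absurd ⟨i1, j1, h1⟩ hb
  obtain ⟨τ, hτ⟩ := F.E.surj w
  obtain ⟨b2, hb2⟩ := F.E.surj (u ^ k1)
  have m2 : b2 ∈ D.B.comap π := ⟨k1, 0, by simp [hb2]⟩
  have m1 : b * b2⁻¹ * τ⁻¹ ∈ D.B.comap π := ⟨i1, j1, by
    simp only [map_mul, map_inv, h1, hb2, hτ]; group⟩
  have e1 : b = (b * b2⁻¹ * τ⁻¹) * (τ * b2) := by group
  rw [e1, ← cj_cj, hj.cj_mem m1, ← cj_cj, ip_cj_left b2, hi.cj_mem ((D.B.comap π).inv_mem m2)]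
  have h4 : w * h * w⁻¹ = h ^ 4 := by
    rw [D.wh]; exact inv_eq_of_mul_eq_one_left (by rw [← pow_succ, D.h5])
  have e2 : ip (cj τ (tw ωB j κ)) (tw ωB i κ) = ip (tw ωB (4 * j) lamh) (tw ωB i lamh) := by
    unfold ip
    refine Finset.sum_congr rfl fun x _ => ?_
    have e3 : tw ωB (4 * j) lamh = cj τ (tw ωB j lamh) := by
      rw [F.EH.cj_tw (b := τ) (k := 4) (by rw [hτ]; exact h4), F.fixw τ hτ]
    by_cases hx : x ∈ (Subgroup.zpowers h).comap π
    · have hx' : τ * x * τ⁻¹ ∈ (Subgroup.zpowers h).comap π :=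
        ((nrm_comap F.E.surj _ τ).2 (by rw [hτ]; exact nrm_zp h4) x).2 hx
      have hx2 : x⁻¹ ∈ (Subgroup.zpowers h).comap π := Subgroup.inv_mem _ hx
      rw [e3]
      simp only [cj, tw, F.κH _ hx', F.κH _ hx2]
    · have z2 : tw ωB i lamh x⁻¹ = 0 := by
        simp [tw, F.EH.hirr.1 x⁻¹ (fun h' => hx (by simpa using Subgroup.inv_mem _ h'))]
      rw [z2, mul_zero]
      by_cases hxB : x ∈ D.B.comap π
      · by_cases hxB' : τ * x * τ⁻¹ ∈ D.B.comap π
        · exfalso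
          apply hx
          exact D.BwB hxB (by simpa [hτ] using hxB')
        · simp [cj, tw, F.hκ.1 _ hxB']
      · have : x⁻¹ ∉ D.B.comap π := fun h' => hxB (by simpa using Subgroup.inv_mem _ h')
        simp [tw, F.hκ.1 _ this]
  rw [e2, (F.EH.twist (4 * j)).hirr.ip_eq (F.EH.twist i).hirr]
  simp only [F.EH.tw_iff]
lemma FD.gramB (F : FD π θ D ω lam ωB lamh κ) (i j : ℕ) :
    ∑ ψ ∈ irr (⊤ : Subgroup X), mlt (D.B.comap π) ψ (tw ωB i κ) * mlt (D.B.comap π) ψ (tw ωB j κ) =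
      (if i ≡ j [MOD 5] then 1 else 0) + (if 4 * j ≡ i [MOD 5] then 1 else 0) := by
  classical
  have hj := (F.L.linB D).twist F.hκ j
  have hi := (F.L.linB D).twist F.hκ i
  have h1 := gram (B := ⊤) (le_top : D.B.comap π ≤ ⊤) (le_top : D.B.comap π ≤ ⊤) hi hj
  have h2 : ∀ b, ip (cj b (tw ωB j κ)) (tw ωB i κ) = if b ∈ D.B.comap π then
      (if i ≡ j [MOD 5] then (Nat.card (D.B.comap π) : ℂ) else 0) else
      (if 4 * j ≡ i [MOD 5] then (Nat.card ((Subgroup.zpowers h).comap π) : ℂ) else 0) := by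
    intro b
    by_cases hb : b ∈ D.B.comap π
    · rw [if_pos hb, F.ip_in i j hb]
    · rw [if_neg hb, F.ip_out i j hb]
  have c1 : (Finset.univ.filter (fun b : X => b ∈ D.B.comap π)).card = 55 * Nat.card π.ker := by
    rw [card_filter_mem, card_comap F.E.surj, D.card_B]
  have c2 : (Finset.univ.filter (fun b : X => b ∉ D.B.comap π)).card = 605 * Nat.card π.ker := by
    have := Finset.card_filter_add_card_filter_not (s := (Finset.univ : Finset X)) (fun b : X => b ∈ D.B.comap π)
    have h3 : (Finset.univ : Finset X).card = Nat.card π.ker * 660 := by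
      rw [Finset.card_univ, ← Nat.card_eq_fintype_card, card_X F.E.surj, D.card]
    omega
  have hfil : (Finset.univ.filter (fun b : X => b ∈ (⊤ : Subgroup X))) = Finset.univ := by simp
  rw [hfil, Finset.sum_congr rfl (fun b _ => h2 b), Finset.sum_ite, Finset.sum_const, Finset.sum_const,
    c1, c2, card_comap F.E.surj, card_comap F.E.surj, D.card_B, Nat.card_zpowers, D.ord_h] at h1
  have hK := card_ne π.ker
  set K := Nat.card π.ker
  push_cast [nsmul_eq_mul] at h1
  have h3 : (K : ℂ) * K * 3025 * ((∑ ψ ∈ irr (⊤ : Subgroup X), mlt (D.B.comap π) ψ (tw ωB i κ) * mlt (D.B.comap π) ψ (tw ωB j κ) : ℕ) : ℂ)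
     = (K : ℂ) * K * 3025 * (((if i ≡ j [MOD 5] then 1 else 0) + (if 4 * j ≡ i [MOD 5] then 1 else 0) : ℕ) : ℂ) := by
    push_cast
    split_ifs at h1 ⊢ <;> linear_combination h1
  exact_mod_cast mul_left_cancel₀ (mul_ne_zero (mul_ne_zero hK hK) (by norm_num)) h3
lemma FD.gramE (F : FD π θ D ω lam ωB lamh κ) (i : ℕ) :
    ∑ ψ ∈ irr (⊤ : Subgroup X), mlt (D.B.comap π) ψ (tw ωB i κ) * mlt π.ker ψ θ = 12 := by
  classical
  have hi := (F.L.linB D).twist F.hκ i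
  have h1 := gram (B := ⊤) (le_top : D.B.comap π ≤ ⊤) (le_top : π.ker ≤ ⊤) hi F.E.hθ
  have h2 : ∀ b, ip (cj b θ) (tw ωB i κ) = Nat.card π.ker := by
    intro b
    have : cj b θ = θ := (mem_stq F.E.hθ b).1 (by rw [F.top]; trivial)
    rw [this, ← F.E.hθ.norm, ip_supp_left π.ker _ _ F.E.hθ.1, ip_supp_left π.ker _ _ F.E.hθ.1]
    refine Finset.sum_congr rfl fun x _ => ?_
    have hk := (F.EH.twist i).res _ (x⁻¹).2
    rw [← hk]
    simp only [tw]
    rw [F.κH _ (ker_le_comap _ (x⁻¹).2)]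
  have hfil : (Finset.univ.filter (fun b : X => b ∈ (⊤ : Subgroup X))) = Finset.univ := by simp
  have h3 : (Finset.univ : Finset X).card = Nat.card π.ker * 660 := by
    rw [Finset.card_univ, ← Nat.card_eq_fintype_card, card_X F.E.surj, D.card]
  rw [hfil, Finset.sum_congr rfl (fun b _ => h2 b), Finset.sum_const, h3, card_comap F.E.surj, D.card_B] at h1
  have hK := card_ne π.ker
  set K := Nat.card π.ker
  push_cast [nsmul_eq_mul] at h1
  have h4 : (K : ℂ) * K * 55 * ((∑ ψ ∈ irr (⊤ : Subgroup X), mlt (D.B.comap π) ψ (tw ωB i κ) * mlt π.ker ψ θ : ℕ) : ℂ)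
     = (K : ℂ) * K * 55 * ((12 : ℕ) : ℂ) := by
    push_cast
    linear_combination h1
  exact_mod_cast mul_left_cancel₀ (mul_ne_zero (mul_ne_zero hK hK) (by norm_num)) h4
lemma FD.main (F : FD π θ D ω lam ωB lamh κ) :
    (∀ ψ ∈ irr (⊤ : Subgroup X), mlt π.ker ψ θ = 0 ∨ mlt π.ker ψ θ = 1 ∨ mlt π.ker ψ θ = 5 ∨
      mlt π.ker ψ θ = 6 ∨ mlt π.ker ψ θ = 10 ∨ mlt π.ker ψ θ = 11 ∨ mlt π.ker ψ θ = 12) ∧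
    ∃ ψ ∈ irr (⊤ : Subgroup X), mlt (D.B.comap π) ψ (tw ωB 1 κ) = 1 ∧ mlt π.ker ψ θ = 12 ∧
      ∀ ψ' ∈ irr (⊤ : Subgroup X), ψ' ≠ ψ → mlt (D.B.comap π) ψ' (tw ωB 1 κ) = 0 := by
  classical
  have uT : u ∈ stq π θ := by rw [F.top]; trivial
  have hT : h ∈ stq π θ := by rw [F.top]; trivial
  obtain ⟨hk, hg⟩ := F.E.gram_fix hT D.hu F.fixh (fun q _ hq => D.nrm_u hq) D.hd_u
  have hc : Nat.card (stq π θ) = 660 := by rw [F.top, Subgroup.card_top, D.card]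
  rw [hc] at hg
  set U := (Subgroup.zpowers u).comap π with hU
  set BX := D.B.comap π with hBX
  have ev : ∀ i j n, ((Finset.range 5).filter (fun s => 9 ^ s * j ≡ i [MOD 11])).card = n →
      ∑ ψ ∈ irr (⊤ : Subgroup X), mlt U ψ (tw ω i lam) * mlt U ψ (tw ω j lam) = 5 + n := by
    intro i j n hn
    have := hg i j
    rw [hn] at this
    omega
  have ha : ∀ ψ ∈ irr (⊤ : Subgroup X), mlt U ψ (tw ω 0 lam) =
      mlt BX ψ (tw ωB 0 κ) + mlt BX ψ (tw ωB 1 κ) + mlt BX ψ (tw ωB 2 κ) + mlt BX ψ (tw ωB 3 κ) +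
        mlt BX ψ (tw ωB 4 κ) := by
    intro ψ hψ
    rw [tw_zero ω, mlt_sum_tw (p := 5) (by norm_num) (Subgroup.comap_mono D.zu_le) le_top
      (by rw [card_comap F.E.surj, card_comap F.E.surj, D.card_B, Nat.card_zpowers, D.ord_u]; ring)
      (F.L.linB D) F.E.hirr F.hκ F.κU (mem_irr.1 hψ)]
    simp only [Finset.sum_range_succ, Finset.sum_range_zero, zero_add, ← hBX]
  have g := F.gramB
  refine alg_full (α := fun j ψ => mlt BX ψ (tw ωB j κ)) (b := fun ψ => mlt U ψ (tw ω 1 lam))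
    (c := fun ψ => mlt U ψ (tw ω 2 lam))
    (g 0 0) (g 1 1) (g 2 2) (g 1 4) (g 4 4) (g 3 3) (g 2 3) (g 0 1) (g 0 2) (g 1 2)
    (F.gramE 0) (F.gramE 1) (F.gramE 2) (ev 1 1 _ rfl) (ev 2 2 _ rfl) (ev 1 2 _ rfl) ?_ ?_ ?_
  · intro ψ hψ
    rw [← ha ψ hψ, F.E.sum (mem_irr.1 hψ)]
    have hk' : ∀ i j, 9 * i ≡ j [MOD 11] → mlt U ψ (tw ω j lam) = mlt U ψ (tw ω i lam) := by
      intro i j hij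
      rw [← hk i ψ (mem_irr.1 hψ), F.E.lin.tw_mod F.E.hirr.1 hij]
    have k9 := hk' 1 9 rfl
    have k4 := hk' 9 4 rfl
    have k3 := hk' 4 3 rfl
    have k5 := hk' 3 5 rfl
    have k7 := hk' 2 7 rfl
    have k8 := hk' 7 8 rfl
    have k6 := hk' 8 6 rfl
    have k10 := hk' 6 10 rfl
    simp only [Finset.sum_range_succ, Finset.sum_range_zero, zero_add, ← hU]
    omega
  · refine Eq.trans ?_ (ev 0 1 0 rfl)
    exact Finset.sum_congr rfl fun ψ hψ => by rw [ha ψ hψ]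
  · refine Eq.trans ?_ (ev 0 2 0 rfl)
    exact Finset.sum_congr rfl fun ψ hψ => by rw [ha ψ hψ]
lemma exists_FD (hπ : Function.Surjective π) (D : QD Q u h w) (hθ : Irr π.ker θ) (top : stq π θ = ⊤) :
    ∃ ω lam ωB lamh κ, FD π θ D ω lam ωB lamh κ := by
  classical
  have uT : u ∈ stq π θ := by rw [top]; trivial
  have hT : h ∈ stq π θ := by rw [top]; trivial
  have wT : w ∈ stq π θ := by rw [top]; trivial
  obtain ⟨ω, lam, E, fixh, -⟩ := gram_t hπ (p := 11) (by norm_num) D.ord_u hθ uT hT D.hu (by decide)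
    (fun q _ hq => D.nrm_u hq) D.hd_u
  obtain ⟨ωB, L⟩ := D.ex_LB π
  -- extension to the preimage of ⟨h⟩
  obtain ⟨l0, h3, h4⟩ := exists_over (B := (Subgroup.zpowers h).comap π) (ker_le_comap _)
    (fun b _ x => ker_nrm b x) hθ
  have E0 : ED π θ h 5 ωB l0 := ⟨hπ, by norm_num, D.ord_h, hθ, hT, L.linH D, L.pw D, h3,
    (prime_ext (by norm_num) (ker_le_comap _) (fun b _ x => ker_nrm b x) (card_A hπ D.ord_h) (L.linH D) hθ
      (stab_A hθ hT) h3 h4).1⟩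
  have hw4 : w * h * w⁻¹ = h ^ 4 := by
    rw [D.wh]; exact inv_eq_of_mul_eq_one_left (by rw [← pow_succ, D.h5])
  obtain ⟨i, hi⟩ := E0.fix_twist wT hw4 (by decide)
  have EH := E0.twist i
  set lamh := tw ωB i l0
  have hinv : ∀ b ∈ D.B.comap π, cj b lam = lam := by
    rintro b ⟨i, j, hb⟩
    change π b = _ at hb
    obtain ⟨τ, hτ⟩ := hπ h
    have hs : b * (τ ^ j)⁻¹ ∈ (Subgroup.zpowers u).comap π := by
      rw [mem_comap_zp]; exact ⟨i, by simp [hb, hτ]⟩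
    have h1 : ∀ j, cj (τ ^ j) lam = lam := by
      intro j
      induction j with
      | zero => simp [cj_one]
      | succ j ih => rw [pow_succ, ← cj_cj, ih, fixh τ hτ]
    have h2 : b = (b * (τ ^ j)⁻¹) * τ ^ j := by group
    rw [h2, ← cj_cj, E.hirr.cj_mem hs, h1]
  have hUB : (Subgroup.zpowers u).comap π ≤ D.B.comap π := Subgroup.comap_mono D.zu_le
  have hHB : (Subgroup.zpowers h).comap π ≤ D.B.comap π := Subgroup.comap_mono D.zh_le
  have hnU : ∀ b ∈ D.B.comap π, ∀ x, b * x * b⁻¹ ∈ (Subgroup.zpowers u).comap π ↔ x ∈ (Subgroup.zpowers u).comap π := by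
    rintro b ⟨i, j, hb⟩
    change π b = _ at hb
    refine (nrm_comap hπ _ b).2 (nrm_of_le ?_)
    intro x hx
    rw [hb]
    obtain ⟨k, rfl⟩ := mem_comap_zp (π := MonoidHom.id Q).1 hx
    have : u ^ i * h ^ j * u ^ k * (u ^ i * h ^ j)⁻¹ = u ^ i * (h ^ j * u ^ k) * (h ^ j)⁻¹ * (u ^ i)⁻¹ := by group
    change u ^ i * h ^ j * u ^ k * (u ^ i * h ^ j)⁻¹ ∈ _
    rw [this, D.hpow]
    have hm := Subgroup.mem_zpowers u
    have : u ^ i * (u ^ (9 ^ j * k) * h ^ j) * (h ^ j)⁻¹ * (u ^ i)⁻¹ = u ^ i * u ^ (9 ^ j * k) * (u ^ i)⁻¹ := by group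
    rw [this]
    exact Subgroup.mul_mem _ (Subgroup.mul_mem _ (Subgroup.pow_mem _ hm _) (Subgroup.pow_mem _ hm _))
      (Subgroup.inv_mem _ (Subgroup.pow_mem _ hm _))
  obtain ⟨κ0, k1, k2⟩ := exists_over hUB hnU E.hirr
  have k3 := (prime_ext (p := 5) (by norm_num) hUB hnU
    (by rw [card_comap hπ, card_comap hπ, D.card_B, Nat.card_zpowers, D.ord_u]; ring) (L.linB D) E.hirr hinv k1 k2).1
  have k4 : ∀ x ∈ π.ker, κ0 x = θ x := fun x hx => by rw [k3 x (ker_le_comap _ hx), E.res x hx]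
  -- the restriction to HX
  have k5 : ∃ s, mlt ((Subgroup.zpowers h).comap π) κ0 (tw ωB s lamh) ≠ 0 := by
    by_contra hno
    push Not at hno
    have h1 := mlt_sum_tw (p := 5) (by norm_num) (ker_le_comap _) hHB (card_A hπ D.ord_h) (L.linH D) hθ EH.hirr EH.res k1
    rw [mlt_ext (A := D.B.comap π) (ker_le_comap _) hθ k4, Finset.sum_eq_zero (fun i _ => hno i)] at h1
    exact one_ne_zero h1
  obtain ⟨s, hs⟩ := k5
  have k6 := res_eq hHB k1 (EH.twist s).hirr hs (by rw [k4 1 (one_mem _), (EH.twist s).res 1 (one_mem _)])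
  refine ⟨ω, lam, ωB, lamh, tw ωB (4 * s) κ0, top, E, fixh, L, (L.linB D).twist k1 _, ?_, EH, ?_, hi⟩
  · intro x hx
    rw [(L.linB D).on_N hUB κ0 _ x hx, k3 x hx]
  · intro x hx
    have h1 : tw ωB (4 * s) κ0 x = tw ωB (4 * s) (tw ωB s lamh) x := by
      simp only [tw]; rw [k6 x hx]; rfl
    rw [h1, tw_tw]
    have h2 : tw ωB (4 * s + s) lamh = tw ωB 0 lamh :=
      EH.tw_iff.2 (by rw [show 4 * s + s = 5 * s by ring]; exact (Nat.modEq_zero_iff_dvd).2 ⟨s, rfl⟩)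
    rw [h2, tw_zero]
end Full

section AutQ
variable {Q : Type} [Group Q] [Fintype Q] {u h w : Q}
/-- conjugation applied after an automorphism -/
def cjA (q : Q) (Φ : Q ≃* Q) : Q ≃* Q := Φ.trans (MulAut.conj q)
lemma cjA_apply (q : Q) (Φ : Q ≃* Q) (x : Q) : cjA q Φ x = q * Φ x * q⁻¹ := rfl
/-- inner automorphisms -/
def Inn (Φ : Q ≃* Q) : Prop := ∃ q : Q, ∀ x, Φ x = q * x * q⁻¹
lemma Inn.of_cjA {q : Q} {Φ : Q ≃* Q} (hI : Inn (cjA q Φ)) : Inn Φ := by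
  obtain ⟨r, hr⟩ := hI
  refine ⟨q⁻¹ * r, fun x => ?_⟩
  have := hr x
  rw [cjA_apply] at this
  have h2 : Φ x = q⁻¹ * (q * Φ x * q⁻¹) * q := by group
  rw [h2, this]; group
lemma QD.aut_u (D : QD Q u h w) (Φ : Q ≃* Q) : ∃ q, ∃ k : ℕ, cjA q Φ u = u ^ k ∧ ¬ 11 ∣ k := by
  obtain ⟨q, hq⟩ := sylow_conj (p := 11) (c := Φ u) (c' := u) (by norm_num)
    ((orderOf_injective Φ.toMonoidHom Φ.injective u).trans D.ord_u) D.ord_u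
    (by rw [D.card]; norm_num)
  have h1 : cjA q Φ u ∈ Subgroup.zpowers u := by
    rw [← hq, cjA_apply]; exact Subgroup.mem_zpowers _
  obtain ⟨k, hk⟩ := mem_comap_zp (π := MonoidHom.id Q).1 h1
  refine ⟨q, k, hk, ?_⟩
  rintro ⟨m, rfl⟩
  have h2 : cjA q Φ u = 1 := by
    have hk' : cjA q Φ u = u ^ (11 * m) := hk
    rw [hk', pow_mul, D.u11, one_pow]
  have h3 : u = 1 := (cjA q Φ).injective (by rw [h2, map_one])
  have := D.ord_u
  rw [h3, orderOf_one] at this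
  omega
lemma nine_pow {j k : ℕ} (hk : ¬ 11 ∣ k) (h1 : 9 ^ j * k ≡ k * 9 [MOD 11]) : j ≡ 1 [MOD 5] := by
  have hc : Nat.Coprime 11 k := (Nat.Prime.coprime_iff_not_dvd (by norm_num)).2 hk
  rw [mul_comm] at h1
  have h2 : 9 ^ j ≡ 9 [MOD 11] := Nat.ModEq.cancel_left_of_coprime hc h1
  have h3 : 9 ^ j ≡ 9 ^ (j % 5) [MOD 11] := by
    conv_lhs => rw [← Nat.div_add_mod j 5, pow_add, pow_mul]
    have : (9 ^ 5) ^ (j / 5) ≡ 1 ^ (j / 5) [MOD 11] := Nat.ModEq.pow _ (by decide)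
    simpa using this.mul_right (9 ^ (j % 5))
  have h4 := h3.symm.trans h2
  have h5 : j % 5 < 5 := Nat.mod_lt _ (by norm_num)
  unfold Nat.ModEq
  interval_cases j % 5 <;> first | rfl | (exact absurd h4 (by decide))
lemma QD.aut_h (D : QD Q u h w) {Φ : Q ≃* Q} {k : ℕ} (hu : Φ u = u ^ k) (hk : ¬ 11 ∣ k) :
    ∃ i : ℕ, Φ h = u ^ i * h := by
  have h0 : Φ h * u ^ k * (Φ h)⁻¹ = (u ^ k) ^ 9 := by
    rw [← hu, ← map_inv, ← map_mul, ← map_mul, D.hu, map_pow]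
  have hz : Subgroup.zpowers (u ^ k) = Subgroup.zpowers u := by
    have h1 : orderOf (u ^ k) = 11 := by
      rw [← hu, ← D.ord_u]; exact orderOf_injective Φ.toMonoidHom Φ.injective u
    apply Subgroup.eq_of_le_of_card_ge
    · rw [Subgroup.zpowers_le]; exact Subgroup.pow_mem _ (Subgroup.mem_zpowers u) _
    · rw [Nat.card_zpowers, Nat.card_zpowers, h1, D.ord_u]
  have h1 : nrm (Subgroup.zpowers u) (Φ h) := by rw [← hz]; exact nrm_zp h0
  obtain ⟨i, j, hj, hij⟩ := D.nrm_u h1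
  refine ⟨i, ?_⟩
  rw [hij] at h0 ⊢
  have h2 : u ^ i * h ^ j * u ^ k * (u ^ i * h ^ j)⁻¹ = u ^ (9 ^ j * k) := by
    have : u ^ i * h ^ j * u ^ k * (u ^ i * h ^ j)⁻¹ = u ^ i * (h ^ j * u ^ k) * (h ^ j)⁻¹ * (u ^ i)⁻¹ := by group
    rw [this, D.hpow]; group
  rw [h2, ← pow_mul] at h0
  have h3 := (D.nf1 (i := 9 ^ j * k) (i' := k * 9) (j := 0) (j' := 0) (by rw [h0])).1
  have h4 := nine_pow hk h3
  rw [pow_congr_of D.h5 h4, pow_one]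
lemma QD.aut_id (D : QD Q u h w) {Φ : Q ≃* Q} (hu : Φ u = u) (hh : Φ h = h) : ∀ x, Φ x = x := by
  have hn : nrm (Subgroup.zpowers h) (Φ w) := by
    apply nrm_zp (k := 4)
    have : Φ (w * h * w⁻¹) = h⁻¹ := by rw [D.wh, map_inv, hh]
    rw [map_mul, map_mul, map_inv, hh] at this
    rw [this]; exact inv_eq_of_mul_eq_one_left (by rw [← pow_succ, D.h5])
  obtain ⟨x, s, hs, hx⟩ := D.nrm_h hn
  have hw : Φ w = w := by
    interval_cases s
    · exfalso
      rw [pow_zero, mul_one] at hx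
      have h1 : Φ w = Φ (h ^ x) := by rw [hx, map_pow, hh]
      have h2 := Φ.injective h1
      apply D.w_B
      exact ⟨0, x, by simpa using h2⟩
    · rw [pow_one] at hx
      have h1 : Φ w = w * h ^ (4 * x) := by
        rw [hx, D.whpow]
        congr 1
        apply pow_congr_of D.h5
        unfold Nat.ModEq; omega
      have h2 : (u * (w * h ^ (4 * x))) ^ 3 = 1 := by
        have h5 : (u * w) ^ 3 = 1 := by
          rw [← D.uw]; simp only [pow_succ, pow_zero, one_mul, mul_assoc]
        have h6 : Φ ((u * w) ^ 3) = (u * Φ w) ^ 3 := by rw [map_pow, map_mul, hu]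
        rw [← h1, ← h6, h5, map_one]
      have h3 := D.uwh _ h2
      obtain ⟨m, hm⟩ := h3
      rw [h1, hm, pow_mul, D.h5, one_pow, mul_one]
  intro q
  rcases D.bru q with ⟨i, j, rfl⟩ | ⟨i, j, k, rfl⟩
  · simp only [map_mul, map_pow, hu, hh]
  · simp only [map_mul, map_pow, hu, hh, hw]
lemma QD.aut_sq (D : QD Q u h w) {Φ : Q ≃* Q} {k : ℕ} (hu : Φ u = u ^ k)
    (hk : ∃ j, 9 ^ j * k ≡ 1 [MOD 11]) : Inn Φ := by
  obtain ⟨j, hj⟩ := hk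
  apply Inn.of_cjA (q := h ^ j)
  have h1 : cjA (h ^ j) Φ u = u ^ 1 := by
    rw [cjA_apply, hu, D.hpow, mul_inv_cancel_right]
    exact pow_congr_of D.u11 hj
  obtain ⟨i, hi⟩ := D.aut_h h1 (by norm_num)
  rw [pow_one] at h1
  set Φ' := cjA (h ^ j) Φ
  -- conjugate by a power of u
  apply Inn.of_cjA (q := u ^ (7 * i))
  refine ⟨1, fun x => ?_⟩
  rw [one_mul, inv_one, mul_one]
  refine D.aut_id ?_ ?_ x
  · rw [cjA_apply, h1]
    rw [← pow_succ, pow_succ', mul_inv_cancel_right]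
  · rw [cjA_apply, hi]
    have h2 : (u ^ (7 * i))⁻¹ = u ^ (4 * i) := by
      apply inv_eq_of_mul_eq_one_left
      rw [← pow_add, show 4 * i + 7 * i = 11 * i by ring, pow_mul, D.u11, one_pow]
    have h3 := D.hpow 1 (4 * i)
    rw [pow_one, pow_one] at h3
    rw [h2, ← mul_assoc, mul_assoc, h3, ← mul_assoc, ← pow_add, ← pow_add,
      show 7 * i + i + 9 * (4 * i) = 11 * (4 * i) by ring, pow_mul, D.u11, one_pow, one_mul]
lemma sq_cases {k : ℕ} (hk : ¬ 11 ∣ k) :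
    (∃ j, 9 ^ j * k ≡ 1 [MOD 11]) ∨ (∃ j, 9 ^ j * k ≡ 2 [MOD 11]) := by
  have h1 : ∀ j n, 9 ^ j * k ≡ n [MOD 11] ↔ 9 ^ j * (k % 11) ≡ n [MOD 11] := by
    intro j n
    have : 9 ^ j * (k % 11) ≡ 9 ^ j * k [MOD 11] := (Nat.mod_modEq k 11).mul_left _
    exact ⟨fun h => this.trans h, fun h => this.symm.trans h⟩
  simp only [h1]
  have h2 : k % 11 ≠ 0 := fun h => hk (Nat.dvd_of_mod_eq_zero h)
  have h3 : k % 11 < 11 := Nat.mod_lt _ (by norm_num)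
  have key : ∀ r < 11, r ≠ 0 → (∃ j < 5, 9 ^ j * r ≡ 1 [MOD 11]) ∨ (∃ j < 5, 9 ^ j * r ≡ 2 [MOD 11]) := by
    decide
  rcases key _ h3 h2 with ⟨j, -, hj⟩ | ⟨j, -, hj⟩
  · exact Or.inl ⟨j, hj⟩
  · exact Or.inr ⟨j, hj⟩
lemma QD.aut_two (D : QD Q u h w) (Φ Ψ : Q ≃* Q) : Inn Φ ∨ Inn Ψ ∨ Inn (Ψ.trans Φ) := by
  obtain ⟨q, k, hk, hk'⟩ := D.aut_u Φ
  obtain ⟨r, l, hl, hl'⟩ := D.aut_u Ψ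
  rcases sq_cases hk' with h1 | ⟨i, hi⟩
  · exact Or.inl (D.aut_sq hk h1).of_cjA
  rcases sq_cases hl' with h2 | ⟨j, hj⟩
  · exact Or.inr (Or.inl (D.aut_sq hl h2).of_cjA)
  right; right
  apply Inn.of_cjA (q := q * Φ r)
  refine D.aut_sq (k := k * l) ?_ ⟨i + j + 3, ?_⟩
  · have h3 : cjA (q * Φ r) (Ψ.trans Φ) u = cjA q Φ (cjA r Ψ u) := by
      simp only [cjA_apply, MulEquiv.trans_apply, map_mul, map_inv]; group
    rw [h3, hl, map_pow, hk, pow_mul]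
  · have h4 := (hi.mul hj).mul_left (9 ^ 3)
    have h5 : 9 ^ 3 * (9 ^ i * k * (9 ^ j * l)) = 9 ^ (i + j + 3) * (k * l) := by
      rw [pow_add, pow_add]; ring
    rw [h5] at h4
    exact h4.trans (by decide)
end AutQ

section Trivial
variable {X Q : Type} [Group X] [Fintype X] [Group Q] [Fintype Q] {π : X →* Q} {u h w : Q}
open Classical in
/-- indicator of a subgroup -/
noncomputable def ind (A : Subgroup X) : X → ℂ := fun x => if x ∈ A then 1 else 0
lemma ind_of_mem {A : Subgroup X} {x : X} (hx : x ∈ A) : ind A x = 1 := by simp [ind, hx]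
lemma ind_not_mem {A : Subgroup X} {x : X} (hx : x ∉ A) : ind A x = 0 := by simp [ind, hx]
lemma irr_ind (A : Subgroup X) : Irr A (ind A) := by
  classical
  refine ⟨fun x hx => ind_not_mem hx, ?_⟩
  have h1 := isIr_lin (H := A) 1
  convert h1 using 2 with a
  simp [ind]
lemma cj_ind {A : Subgroup X} {b : X} (hb : nrm A b) : cj b (ind A) = ind A := by
  ext x
  by_cases hx : x ∈ A
  · rw [ind_of_mem hx, cj, ind_of_mem ((hb x).2 hx)]
  · rw [ind_not_mem hx, cj, ind_not_mem (fun h1 => hx ((hb x).1 h1))]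
lemma stq_ind (hπ : Function.Surjective π) : stq π (ind π.ker) = ⊤ := by
  rw [eq_top_iff]
  rintro q -
  obtain ⟨b, rfl⟩ := hπ q
  rw [mem_stq (irr_ind _)]
  exact cj_ind (ker_nrm b)
lemma dg_ind (A : Subgroup X) : dg (ind A) = 1 := by
  have h1 := (irr_ind A).dg_spec.1
  rw [ind_of_mem A.one_mem] at h1
  exact_mod_cast h1.symm
lemma exists_FD1 (hπ : Function.Surjective π) (D : QD Q u h w) :
    ∃ ω ωB, FD π (ind π.ker) D ω (ind ((Subgroup.zpowers u).comap π)) ωB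
      (ind ((Subgroup.zpowers h).comap π)) (ind (D.B.comap π)) := by
  obtain ⟨ω, h1, h2⟩ := ex_lin (π := π) (p := 11) (by norm_num) D.ord_u
  obtain ⟨ωB, L⟩ := D.ex_LB π
  have ht := stq_ind hπ
  have hw4 : w * h * w⁻¹ = h ^ 4 := by
    rw [D.wh]; exact inv_eq_of_mul_eq_one_left (by rw [← pow_succ, D.h5])
  refine ⟨ω, ωB, ⟨ht, ⟨hπ, by norm_num, D.ord_u, irr_ind _, by rw [ht]; trivial, h1, h2, irr_ind _,
    ?_⟩, ?_, L, irr_ind _, ?_, ⟨hπ, by norm_num, D.ord_h, irr_ind _, by rw [ht]; trivial, L.linH D,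
    L.pw D, irr_ind _, ?_⟩, ?_, ?_⟩⟩
  · intro x hx
    rw [ind_of_mem hx, ind_of_mem (ker_le_comap _ hx)]
  · intro b hb
    apply cj_ind
    rw [nrm_comap hπ, hb]
    exact nrm_zp D.hu
  · intro x hx
    rw [ind_of_mem hx, ind_of_mem (Subgroup.comap_mono D.zu_le hx)]
  · intro x hx
    rw [ind_of_mem hx, ind_of_mem (ker_le_comap _ hx)]
  · intro x hx
    rw [ind_of_mem hx, ind_of_mem (Subgroup.comap_mono D.zh_le hx)]
  · intro b hb
    apply cj_ind
    rw [nrm_comap hπ, hb]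
    exact nrm_zp hw4
lemma irr_top_comp {ψ : X → ℂ} (hψ : Irr (⊤ : Subgroup X) ψ) (φ : X ≃* X) :
    Irr (⊤ : Subgroup X) (fun x => ψ (φ x)) := by
  classical
  refine ⟨fun x hx => absurd trivial hx, ?_⟩
  let φ' : (⊤ : Subgroup X) ≃* (⊤ : Subgroup X) :=
    Subgroup.topEquiv.trans (φ.trans Subgroup.topEquiv.symm)
  exact hψ.2.compEquiv φ'
lemma QD.uh_pow (D : QD Q u h w) (a j : ℕ) : ∃ b : ℕ, (u ^ a * h) ^ j = u ^ b * h ^ j := by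
  induction j with
  | zero => exact ⟨0, by simp⟩
  | succ j ih =>
    obtain ⟨b, hb⟩ := ih
    refine ⟨b + 9 ^ j * a, ?_⟩
    rw [pow_succ, hb, mul_assoc, ← mul_assoc (h ^ j), D.hpow, pow_add, pow_succ]
    simp only [mul_assoc]
lemma QD.aut_B (D : QD Q u h w) {Φ : Q ≃* Q} {k a : ℕ} (hu : Φ u = u ^ k) (hh : Φ h = u ^ a * h)
    (i j : ℕ) : ∃ b : ℕ, Φ (u ^ i * h ^ j) = u ^ b * h ^ j := by
  obtain ⟨b, hb⟩ := D.uh_pow a j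
  refine ⟨k * i + b, ?_⟩
  rw [map_mul, map_pow, map_pow, hu, hh, hb, pow_add, pow_mul, mul_assoc]
lemma QD.aut_B_iff (D : QD Q u h w) {Φ : Q ≃* Q} {k a : ℕ} (hu : Φ u = u ^ k)
    (hh : Φ h = u ^ a * h) (q : Q) : Φ q ∈ D.B ↔ q ∈ D.B := by
  have h1 : ∀ q ∈ D.B, Φ q ∈ D.B := by
    rintro q ⟨i, j, rfl⟩
    obtain ⟨b, hb⟩ := D.aut_B hu hh i j
    exact ⟨b, j, hb⟩
  refine ⟨fun h2 => ?_, h1 q⟩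
  have h3 : D.B.map Φ.toMonoidHom = D.B := by
    apply Subgroup.eq_of_le_of_card_ge
    · rintro _ ⟨x, hx, rfl⟩; exact h1 x hx
    · exact (Nat.card_congr (D.B.equivMapOfInjective Φ.toMonoidHom Φ.injective).toEquiv).le
  rw [← h3] at h2
  obtain ⟨x, hx, hxq⟩ := h2
  rwa [← Φ.injective hxq]
/-- the invariant character of degree 12 -/
lemma exists_psi12 (hπ : Function.Surjective π) (D : QD Q u h w) :
    ∃ ψ, Irr (⊤ : Subgroup X) ψ ∧ dg ψ = 12 ∧
      ∀ (φ : X ≃* X) (Φ : Q ≃* Q), (∀ x, π (φ x) = Φ (π x)) → ∀ x, ψ (φ x) = ψ x := by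
  classical
  obtain ⟨ω, ωB, F⟩ := exists_FD1 hπ D
  obtain ⟨-, ψ, hψ, h1, h12, huniq⟩ := F.main
  rw [mem_irr] at hψ
  refine ⟨ψ, hψ, ?_, ?_⟩
  · have := deg_top hπ (irr_ind π.ker) hψ (by rw [h12]; norm_num)
    rw [stq_ind hπ, Subgroup.card_top, h12, dg_ind, D.card] at this
    omega
  intro φ Φ hφ
  obtain ⟨q, k, hk, hk'⟩ := D.aut_u Φ
  obtain ⟨a, ha⟩ := D.aut_h hk hk'
  obtain ⟨y, hy⟩ := hπ q
  set φ' : X ≃* X := φ.trans (MulAut.conj y) with hφ'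
  have hv : ∀ x, φ' x = y * φ x * y⁻¹ := fun x => rfl
  have hπ' : ∀ x, π (φ' x) = cjA q Φ (π x) := by
    intro x; rw [hv, cjA_apply, map_mul, map_mul, map_inv, hφ, hy]
  set κ := tw ωB 1 (ind (D.B.comap π)) with hκ
  have hκφ : ∀ x, κ (φ' x) = κ x := by
    intro x
    have hiff : φ' x ∈ D.B.comap π ↔ x ∈ D.B.comap π := by
      rw [Subgroup.mem_comap, Subgroup.mem_comap, hπ', D.aut_B_iff hk ha]
    by_cases hx : x ∈ D.B.comap π
    · simp only [hκ, tw, ind_of_mem hx, ind_of_mem (hiff.2 hx)]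
      obtain ⟨i, j, hij⟩ := hx
      obtain ⟨b, hb⟩ := D.aut_B hk ha i j
      obtain ⟨ζ, -, hζ⟩ := F.L.val
      rw [hζ x i j hij, hζ (φ' x) b j]
      have hij' : π x = u ^ i * h ^ j := hij
      rw [hπ', hij', hb]
    · simp only [hκ, tw, ind_not_mem hx, ind_not_mem (fun h2 => hx (hiff.1 h2)), zero_mul]
  have hip : ip (fun x => ψ (φ' x)) κ = ip ψ κ := by
    have : ip (fun x => ψ (φ' x)) κ = ∑ x, (fun z => ψ z * κ z⁻¹) (φ' x) := by
      unfold ip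
      refine Finset.sum_congr rfl fun x _ => ?_
      simp only [← map_inv, hκφ]
    rw [this]
    exact Equiv.sum_comp φ'.toEquiv (fun z => ψ z * κ z⁻¹)
  have heq : (fun x => ψ (φ' x)) = ψ := by
    by_contra hne
    have h3 := huniq _ (mem_irr.2 (irr_top_comp hψ φ')) hne
    rw [mlt_congr (A := D.B.comap π) hip, h1] at h3
    exact one_ne_zero h3
  intro x
  have h4 := congrFun heq x
  have h5 := hψ.cls (b := y) trivial (φ x)
  rw [← h4, ← h5]; rfl
end Trivial

section MLevel
variable {X Q : Type} [Group X] [Fintype X] [Group Q] [Fintype Q] {π : X →* Q} {u h w : Q}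
lemma msum (hπ : Function.Surjective π) (D : QD Q u h w) {ψ : X → ℂ}
    (hψ : Irr (⊤ : Subgroup X) ψ) :
    (∃ m e : ℕ, 0 < m ∧ (e = 1 ∨ e = 5 ∨ e = 6 ∨ e = 10 ∨ e = 11 ∨ e = 12) ∧ dg ψ = e * m ∧
      ∃ ψ', Irr (⊤ : Subgroup X) ψ' ∧ dg ψ' = 12 * m) ∨
    12 ∣ dg ψ ∨ 110 ∣ dg ψ ∨ 165 ∣ dg ψ ∨ 66 ∣ dg ψ ∨
    (∃ m e : ℕ, 0 < m ∧ 0 < e ∧ e ≤ 3 ∧ dg ψ = 55 * e * m ∧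
      ∃ ψ', Irr (⊤ : Subgroup X) ψ' ∧ (dg ψ' = 110 * m ∨ dg ψ' = 165 * m)) ∨
    (∃ m e : ℕ, 0 < m ∧ 0 < e ∧ e ≤ 6 ∧ dg ψ = 11 * e * m ∧
      ∃ ψ', Irr (⊤ : Subgroup X) ψ' ∧ dg ψ' = 44 * m) := by
  obtain ⟨θ, hθ, he⟩ := exists_under (N := π.ker) le_top hψ
  have hm := hθ.dg_spec.2
  have hd := deg_top hπ hθ hψ he
  rw [D.card] at hd
  have hepos : 0 < mlt π.ker ψ θ := Nat.pos_of_ne_zero he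
  have hψi := mem_irr.2 hψ
  have hd' : ∀ ψ', Irr (⊤ : Subgroup X) ψ' → mlt π.ker ψ' θ ≠ 0 →
      dg ψ' * Nat.card (stq π θ) = mlt π.ker ψ' θ * 660 * dg θ := by
    intro ψ' h1 h2
    have := deg_top hπ hθ h1 h2
    rwa [D.card] at this
  set m := dg θ
  set e := mlt π.ker ψ θ with hedef
  rcases D.orders (stq π θ) with h1 | h1 | h1 | h1 | h1 | h1 | h1 | h1
  · left
    obtain ⟨ω, lam, ωB, lamh, κ, F⟩ := exists_FD hπ D hθ h1
    obtain ⟨f1, ψ', f2, -, f3, -⟩ := F.main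
    have h2 : Nat.card (stq π θ) = 660 := by rw [h1, Subgroup.card_top, D.card]
    rw [h2] at hd hd'
    refine ⟨m, e, hm, ?_, ?_, ψ', mem_irr.1 f2, ?_⟩
    · rcases f1 ψ hψi with h3 | h3
      · exact absurd h3 he
      · exact h3
    · have : e * 660 * m = e * m * 660 := by ring
      omega
    · have := hd' ψ' (mem_irr.1 f2) (by omega)
      rw [f3] at this
      omega
  · right; left
    obtain ⟨c, hc⟩ := h1
    have h2 : dg ψ * 55 = 660 * (e * m * c) := by
      rw [hc, ← mul_assoc, hd]; ring
    exact ⟨e * m * c, by omega⟩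
  · right; right; right; right; right; right
    obtain ⟨f1, ψ', f2, f3⟩ := case60 hπ D hθ h1
    rw [h1] at hd hd'
    refine ⟨m, e, hm, hepos, f1 ψ hψi, ?_, ψ', mem_irr.1 f2, ?_⟩
    · have : e * 660 * m = 11 * e * m * 60 := by ring
      omega
    · have := hd' ψ' (mem_irr.1 f2) (by omega)
      rw [f3] at this
      omega
  · right; right; right; right; right; left
    obtain ⟨f1, ψ', f2, f3⟩ := case12 hπ D hθ h1
    rw [h1] at hd hd'
    refine ⟨m, e, hm, hepos, f1 ψ hψi, ?_, ψ', mem_irr.1 f2, ?_⟩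
    · have : e * 660 * m = 55 * e * m * 12 := by ring
      omega
    · have := hd' ψ' (mem_irr.1 f2) (by omega)
      rcases f3 with f3 | f3
      · rw [f3] at this; omega
      · rw [f3] at this; omega
  · right; right; right; right; left
    rw [h1] at hd
    exact ⟨e * m, by have : e * 660 * m = 66 * (e * m) * 10 := by ring
                     omega⟩
  · right; right; right; left
    obtain ⟨c, hc⟩ := h1
    have h2 : dg ψ * 4 = 660 * (e * m * c) := by
      rw [hc, ← mul_assoc, hd]; ring
    exact ⟨e * m * c, by omega⟩
  · right; right; left
    rw [h1] at hd
    exact ⟨2 * (e * m), by have : e * 660 * m = 110 * (2 * (e * m)) * 3 := by ring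
                           omega⟩
  · right; right; left
    rw [h1] at hd
    exact ⟨e * m, by have : e * 660 * m = 110 * (e * m) * 6 := by ring
                     omega⟩
end MLevel

section Count
lemma three_primes {n p q r : ℕ} (hn : n ≠ 0) (hp : p.Prime) (hq : q.Prime) (hr : r.Prime)
    (h : p * q * r ∣ n) : ¬ n.primeFactorsList.length ≤ 2 := by
  have h1 := (Nat.primeFactorsList_sublist_of_dvd h hn).length_le
  have h2 : (p * q * r).primeFactorsList.length = 3 := by
    rw [← ArithmeticFunction.cardFactors_apply,
      ArithmeticFunction.cardFactors_mul (Nat.mul_ne_zero hp.ne_zero hq.ne_zero) hr.ne_zero,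
      ArithmeticFunction.cardFactors_mul hp.ne_zero hq.ne_zero,
      ArithmeticFunction.cardFactors_apply_prime hp, ArithmeticFunction.cardFactors_apply_prime hq,
      ArithmeticFunction.cardFactors_apply_prime hr]
  omega
lemma count18 (S : Set ℕ) (c : ℕ → Prop) (hpos : ∀ d ∈ S, 0 < d)
    (h2 : ∀ a ∈ S, ∀ b ∈ S, a ≠ b → (Nat.gcd a b).primeFactorsList.length ≤ 2)
    (hA : ∀ d ∈ S, ∃ n, c n ∧ (d = n ∨ d = 2 * n))
    (hB : ∀ n, c n → n ∈ S ∨ 2 * n ∈ S) (h12 : 12 ∈ S)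
    (hc : ∀ n, c n →
      (∃ m e : ℕ, 0 < m ∧ (e = 1 ∨ e = 5 ∨ e = 6 ∨ e = 10 ∨ e = 11 ∨ e = 12) ∧ n = e * m ∧
        c (12 * m)) ∨
      12 ∣ n ∨ 110 ∣ n ∨ 165 ∣ n ∨ 66 ∣ n ∨
      (∃ m e : ℕ, 0 < m ∧ 0 < e ∧ e ≤ 3 ∧ n = 55 * e * m ∧ (c (110 * m) ∨ c (165 * m))) ∨
      (∃ m e : ℕ, 0 < m ∧ 0 < e ∧ e ≤ 6 ∧ n = 11 * e * m ∧ c (44 * m))) :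
    S.ncard ≤ 18 := by
  classical
  have hu : ∀ {p q r : ℕ}, p.Prime → q.Prime → r.Prime → ∀ a ∈ S, ∀ b ∈ S,
      p * q * r ∣ a → p * q * r ∣ b → a = b := by
    intro p q r hp hq hr a ha b hb h3 h4
    by_contra hne
    refine three_primes ?_ hp hq hr (Nat.dvd_gcd h3 h4) (h2 a ha b hb hne)
    exact Nat.gcd_ne_zero_left (hpos a ha).ne'
  have h2p := Nat.prime_two
  have h3p := Nat.prime_three
  have h5p := Nat.prime_five
  have h11p : Nat.Prime 11 := by norm_num
  have u12 : ∀ a ∈ S, 12 ∣ a → a = 12 := fun a ha h =>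
    hu (p := 2) (q := 2) (r := 3) h2p h2p h3p a ha 12 h12 h (by norm_num)
  have ex : ∀ {p q r : ℕ}, p.Prime → q.Prime → r.Prime → ∃ s, ∀ a ∈ S, p * q * r ∣ a → a = s := by
    intro p q r hp hq hr
    by_cases he : ∃ s ∈ S, p * q * r ∣ s
    · obtain ⟨s, hs, hs'⟩ := he
      exact ⟨s, fun a ha h => hu hp hq hr a ha s hs h hs'⟩
    · exact ⟨0, fun a ha h => absurd ⟨a, ha, h⟩ he⟩
  obtain ⟨s44, h44⟩ := ex (p := 2) (q := 2) (r := 11) h2p h2p h11p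
  obtain ⟨s66, h66⟩ := ex (p := 2) (q := 3) (r := 11) h2p h3p h11p
  obtain ⟨s110, h110⟩ := ex (p := 2) (q := 5) (r := 11) h2p h5p h11p
  obtain ⟨s165, h165⟩ := ex (p := 3) (q := 5) (r := 11) h3p h5p h11p
  norm_num at h44 h66 h110 h165
  obtain ⟨z, hz⟩ : ∃ z : ℕ, (88 ∣ s44 ∧ s44 = 88 * z) ∨ (¬ 88 ∣ s44 ∧ z = s44 / 44) := by
    by_cases h : 88 ∣ s44
    · exact ⟨s44 / 88, Or.inl ⟨h, by omega⟩⟩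
    · exact ⟨s44 / 44, Or.inr ⟨h, rfl⟩⟩
  let l : List ℕ := [1, 2, 5, 6, 10, 11, 12, 20, 22, 55, 11 * z, 22 * z, 33 * z, 55 * z,
    s44, s66, s110, s165]
  have hsub : S ⊆ (l.toFinset : Set ℕ) := by
    intro d hd
    have hgoal : (d = 1 ∨ d = 2 ∨ d = 5 ∨ d = 6 ∨ d = 10 ∨ d = 11 ∨ d = 12 ∨ d = 20 ∨ d = 22) ∨
        d = 55 ∨ (d = 11 * z ∨ d = 22 * z ∨ d = 33 * z ∨ d = 55 * z) ∨
        (d = s44 ∨ d = s66 ∨ d = s110 ∨ d = s165) := by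
      have e12 := u12 d hd
      have e44 := h44 d hd
      have e66 := h66 d hd
      have e110 := h110 d hd
      have e165 := h165 d hd
      obtain ⟨n, hn, hdn⟩ := hA d hd
      rcases hc n hn with ⟨m, e, hm, he, hnm, hcm⟩ | h | h | h | h |
          ⟨m, e, hm, he0, he, hnm, hcm⟩ | ⟨m, e, hm, he0, he, hnm, hcm⟩
      · left
        have hm1 : m = 1 := by
          rcases hB _ hcm with h | h
          · have := u12 _ h ⟨m, rfl⟩; omega
          · have := u12 _ h ⟨2 * m, by ring⟩; omega
        subst hm1
        clear e44 e66 e110 e165 hz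
        rcases he with rfl | rfl | rfl | rfl | rfl | rfl <;> rcases hdn with rfl | rfl <;>
          subst hnm <;> revert e12 <;> norm_num
      · left
        have h1 : 12 ∣ d := by clear * - h hdn; omega
        have h2 := e12 h1
        simp [h2]
      · have h1 : 110 ∣ d := by clear * - h hdn; omega
        exact Or.inr (Or.inr (Or.inr (Or.inr (Or.inr (Or.inl (e110 h1))))))
      · have h1 : 165 ∣ d := by clear * - h hdn; omega
        exact Or.inr (Or.inr (Or.inr (Or.inr (Or.inr (Or.inr (e165 h1))))))
      · have h1 : 66 ∣ d := by clear * - h hdn; omega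
        exact Or.inr (Or.inr (Or.inr (Or.inr (Or.inl (e66 h1)))))
      · by_cases h55 : d = 55 * m
        · have hm1 : m = 1 := by
            by_contra hne
            obtain ⟨p, hp, hpm⟩ := Nat.exists_prime_and_dvd hne
            have key : ∀ b ∈ S, b ≠ 55 * m → ¬ 55 * m ∣ b := by
              intro b hb hbne hdiv
              have h5 : 5 * 11 * p ∣ 55 * m := by
                exact Nat.mul_dvd_mul (by norm_num) hpm
              exact hbne (hu h5p h11p hp b hb (55 * m) (h55 ▸ hd) (h5.trans hdiv) h5)
            clear e12 e44 e66 e110 e165 hz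
            rcases hcm with hcm | hcm <;> rcases hB _ hcm with h | h
            · exact key _ h (by clear * - hm; omega) ⟨2, by ring⟩
            · exact key _ h (by clear * - hm; omega) ⟨4, by ring⟩
            · exact key _ h (by clear * - hm; omega) ⟨3, by ring⟩
            · exact key _ h (by clear * - hm; omega) ⟨6, by ring⟩
          exact Or.inr (Or.inl (by rw [h55, hm1]))
        · have h1 : 110 ∣ d ∨ 165 ∣ d := by
            clear * - h55 hdn hnm he0 he
            interval_cases e <;> omega
          rcases h1 with h1 | h1
          · exact Or.inr (Or.inr (Or.inr (Or.inr (Or.inr (Or.inl (e110 h1))))))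
          · exact Or.inr (Or.inr (Or.inr (Or.inr (Or.inr (Or.inr (e165 h1))))))
      · have hz' : m = z ∨ m = 2 * z := by
          rcases hB _ hcm with h | h
          · have h1 := h44 _ h ⟨m, rfl⟩
            clear * - h1 hz
            omega
          · have h1 := h44 _ h ⟨2 * m, by ring⟩
            clear * - h1 hz
            omega
        have h1 : d = 11 * z ∨ d = 22 * z ∨ d = 33 * z ∨ d = 55 * z ∨ 44 ∣ d ∨ 66 ∣ d ∨
            110 ∣ d := by
          clear * - hz' hdn hnm he0 he
          rcases hz' with rfl | rfl <;> interval_cases e <;> omega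
        rcases h1 with h1 | h1 | h1 | h1 | h1 | h1 | h1
        · exact Or.inr (Or.inr (Or.inl (Or.inl h1)))
        · exact Or.inr (Or.inr (Or.inl (Or.inr (Or.inl h1))))
        · exact Or.inr (Or.inr (Or.inl (Or.inr (Or.inr (Or.inl h1)))))
        · exact Or.inr (Or.inr (Or.inl (Or.inr (Or.inr (Or.inr h1)))))
        · exact Or.inr (Or.inr (Or.inr (Or.inl (e44 h1))))
        · exact Or.inr (Or.inr (Or.inr (Or.inr (Or.inl (e66 h1)))))
        · exact Or.inr (Or.inr (Or.inr (Or.inr (Or.inr (Or.inl (e110 h1))))))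
    have hmem : d ∈ l := by
      simp only [l, List.mem_cons, List.not_mem_nil, or_false]
      simpa only [or_assoc] using hgoal
    simpa using hmem
  calc S.ncard ≤ (l.toFinset : Set ℕ).ncard := Set.ncard_le_ncard hsub (Finset.finite_toSet _)
    _ = l.toFinset.card := Set.ncard_coe_finset _
    _ ≤ l.length := List.toFinset_card_le l
    _ = 18 := rfl
end Count

section IndexTwo
variable {X : Type} [Group X] [Fintype X] {M : Subgroup X}
lemma idx_two (h2 : ∀ a b : X, a ∈ M ∨ b ∈ M ∨ a * b ∈ M) {c : X} (hc : c ∉ M) :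
    Nat.card X = 2 * Nat.card M := by
  have h3 : M.index = 2 := by
    rw [Subgroup.index_eq_two_iff]
    refine ⟨c, fun b => ?_⟩
    by_cases hb : b ∈ M
    · right
      exact ⟨hb, fun h4 => hc ((M.mul_mem_cancel_left hb).1 h4)⟩
    · left
      rcases h2 b c with h4 | h4 | h4
      · exact absurd h4 hb
      · exact absurd h4 hc
      · exact ⟨h4, hb⟩
  rw [← M.card_mul_index, h3, mul_comm]
lemma lin_two (h2 : ∀ a b : X, a ∈ M ∨ b ∈ M ∨ a * b ∈ M) : ∃ ω : X → ℂ, Lin ⊤ M 2 ω := by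
  classical
  refine ⟨fun x => if x ∈ M then 1 else -1, ?_, ?_, ?_⟩
  · intro a _ b _
    by_cases ha : a ∈ M
    · by_cases hb : b ∈ M
      · simp [ha, hb, M.mul_mem ha hb]
      · have : a * b ∉ M := fun h => hb ((M.mul_mem_cancel_left ha).1 h)
        simp [ha, hb, this]
    · by_cases hb : b ∈ M
      · have : a * b ∉ M := fun h => ha ((M.mul_mem_cancel_right hb).1 h)
        simp [ha, hb, this]
      · have : a * b ∈ M := by
          rcases h2 a b with h | h | h
          · exact absurd h ha
          · exact absurd h hb
          · exact h
        simp [ha, hb, this]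
  · intro a _
    by_cases ha : a ∈ M
    · simp [ha]
    · simp only [ha, if_false, iff_false]; norm_num
  · intro a _
    by_cases ha : a ∈ M <;> simp [ha]
lemma one_of_sum {S : Finset (X → ℂ)} {f : (X → ℂ) → ℕ} {χ : X → ℂ} (hχ : χ ∈ S)
    (h : ∑ x ∈ S, f x * f x = 1) (h0 : f χ ≠ 0) : f χ = 1 := by
  have h1 : f χ * f χ ≤ ∑ x ∈ S, f x * f x :=
    Finset.single_le_sum (f := fun x => f x * f x) (fun _ _ => Nat.zero_le _) hχ
  rw [h] at h1
  by_contra hne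
  have h2 : 2 ≤ f χ := by omega
  have := Nat.mul_le_mul h2 h2
  omega
lemma cliff2 [hM : M.Normal] (h2 : ∀ a b : X, a ∈ M ∨ b ∈ M ∨ a * b ∈ M) {ψ χ : X → ℂ}
    (hψ : Irr M ψ) (hχ : Irr (⊤ : Subgroup X) χ) (he : mlt M χ ψ ≠ 0) :
    (dg χ = dg ψ ∨ dg χ = 2 * dg ψ) ∧ ((∀ b, cj b ψ = ψ) → dg χ = dg ψ) := by
  classical
  have hN : ∀ b ∈ (⊤ : Subgroup X), ∀ x, b * x * b⁻¹ ∈ M ↔ x ∈ M := by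
    intro b _ x
    exact (hM.mem_comm_iff.trans (by rw [inv_mul_cancel_left]))
  have hdeg := clifford_deg le_top hN hψ hχ he
  have hsum := sum_sq_mlt le_top hN hψ
  have hMpos : 0 < Nat.card M := Nat.card_pos
  by_cases hall : ∀ b, b ∈ M
  · have hs : stc ⊤ ψ = Nat.card M := by
      rw [stc_inv _ _ (fun b _ => hψ.cj_mem (hall b))]
      have : M = ⊤ := by rw [eq_top_iff]; exact fun b _ => hall b
      rw [this]
    have hs' : Nat.card (⊤ : Subgroup X) = Nat.card M := by
      have : M = ⊤ := by rw [eq_top_iff]; exact fun b _ => hall b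
      rw [this]
    rw [hs] at hsum hdeg
    rw [hs'] at hdeg
    have h1 := Nat.eq_of_mul_eq_mul_right hMpos (hsum.trans (one_mul _).symm)
    have h3 := one_of_sum (mem_irr.2 hχ) h1 he
    rw [h3, one_mul, mul_comm] at hdeg
    have h4 := Nat.eq_of_mul_eq_mul_left hMpos hdeg
    exact ⟨Or.inl h4, fun _ => h4⟩
  · push Not at hall
    obtain ⟨c, hc⟩ := hall
    have hcard : Nat.card (⊤ : Subgroup X) = 2 * Nat.card M := by
      rw [Subgroup.card_top]; exact idx_two h2 hc
    by_cases hinv : ∀ b, cj b ψ = ψ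
    · obtain ⟨ω, hω⟩ := lin_two h2
      have h1 := (prime_ext Nat.prime_two le_top hN hcard hω hψ (fun b _ => hinv b) hχ he).1 1 M.one_mem
      rw [hχ.dg_spec.1, hψ.dg_spec.1] at h1
      have h3 : dg χ = dg ψ := by exact_mod_cast h1
      exact ⟨Or.inl h3, fun _ => h3⟩
    · have hstab : ∀ b, cj b ψ = ψ ↔ b ∈ M := by
        intro b
        refine ⟨fun hb => ?_, fun hb => hψ.cj_mem hb⟩
        by_contra hbM
        apply hinv
        intro a
        by_cases haM : a ∈ M
        · exact hψ.cj_mem haM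
        · have h3 : a * b⁻¹ ∈ M := by
            rcases h2 a b⁻¹ with h | h | h
            · exact absurd h haM
            · exact absurd (M.inv_mem_iff.1 h) hbM
            · exact h
          have h4 : a = (a * b⁻¹) * b := by group
          rw [h4, ← cj_cj, hψ.cj_mem h3, hb]
      have hs : stc ⊤ ψ = Nat.card M := by
        rw [← card_filter_mem (B := M)]
        unfold stc
        congr 1
        ext b
        simp [hstab b]
      rw [hs] at hsum hdeg
      rw [hcard] at hdeg
      have h1 := Nat.eq_of_mul_eq_mul_right hMpos (hsum.trans (one_mul _).symm)
      have h3 := one_of_sum (mem_irr.2 hχ) h1 he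
      rw [h3, one_mul] at hdeg
      have h4 : Nat.card M * dg χ = Nat.card M * (2 * dg ψ) := by linarith
      have h5 := Nat.eq_of_mul_eq_mul_left hMpos h4
      exact ⟨Or.inr h5, fun h => absurd h hinv⟩
lemma irr_transfer {f : M → ℂ} (hf : Irr (⊤ : Subgroup M) f) :
    ∃ ψ : X → ℂ, Irr M ψ ∧ (∀ a : M, ψ a = f a) ∧ dg ψ = dg f := by
  classical
  have h1 : IsIr M f := by
    have := hf.2.compEquiv (K := M) (Subgroup.topEquiv (G := M)).symm
    exact this
  obtain ⟨ψ, h3, h4⟩ := isIr_iff_irr f h1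
  refine ⟨ψ, h3, h4, ?_⟩
  have h5 := h4 1
  unfold dg
  rw [← h5]; rfl
lemma irr_transfer' {ψ : X → ℂ} (hψ : Irr M ψ) :
    Irr (⊤ : Subgroup M) (fun a : M => ψ a) ∧ dg (fun a : M => ψ a) = dg ψ := by
  classical
  refine ⟨⟨fun x hx => absurd trivial hx, ?_⟩, rfl⟩
  exact hψ.2.compEquiv (Subgroup.topEquiv (G := M))
lemma isIr_top {f : X → ℂ} : IsIr X f ↔ Irr (⊤ : Subgroup X) f := by
  classical
  constructor
  · intro h
    refine ⟨fun x hx => absurd trivial hx, ?_⟩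
    exact h.compEquiv (Subgroup.topEquiv (G := X))
  · intro h
    exact h.2.compEquiv (K := X) (Subgroup.topEquiv (G := X)).symm
lemma ir_degrees (n : ℕ) : (∃ V : FDRep ℂ X, Simple V ∧ Module.finrank ℂ V = n) ↔
    ∃ χ, Irr (⊤ : Subgroup X) χ ∧ dg χ = n := by
  constructor
  · rintro ⟨V, hV, rfl⟩
    have h1 : Irr (⊤ : Subgroup X) V.character := isIr_top.1 ⟨V, hV, rfl⟩
    refine ⟨_, h1, ?_⟩
    have h3 := h1.dg_spec.1
    rw [FDRep.char_one] at h3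
    exact_mod_cast h3.symm
  · rintro ⟨χ, hχ, rfl⟩
    obtain ⟨V, hV, hc⟩ := isIr_top.2 hχ
    refine ⟨V, hV, ?_⟩
    have h3 := hχ.dg_spec.1
    rw [← hc, FDRep.char_one] at h3
    rw [← hc]
    exact_mod_cast h3
end IndexTwo

/-- If `G` satisfies the two-prime hypothesis and has normal subgroups `N ≤ M` with
`M/N ≅ PSL₂(11)` and the centralizer of `M/N` in `G/N` trivial, then `|cd(G)| ≤ 18`. -/
theorem cd_bound_psl2_11
    (F : Type) [Field F] [Fintype F] (hF : Fintype.card F = 11)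
    (G : Type) [Group G] [Finite G] (hG : TwoPrimeHypothesis G)
    (N M : Subgroup G) [N.Normal] [M.Normal] (hNM : N ≤ M)
    (hiso : Nonempty ((M.map (QuotientGroup.mk' N)) ≃* PSL2 F))
    (hcent : Subgroup.centralizer ((M.map (QuotientGroup.mk' N)) : Set (G ⧸ N)) = ⊥) :
    (charDegrees G).ncard ≤ 18 := by
  classical
  obtain ⟨iso⟩ := hiso
  have fG : Fintype G := Fintype.ofFinite G
  have fM : Fintype M := Fintype.ofFinite M
  have fQ : Fintype (M.map (QuotientGroup.mk' N)) := Fintype.ofFinite _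
  obtain ⟨u, h, w, D⟩ := exists_QD F hF iso
  have hQn : (M.map (QuotientGroup.mk' N)).Normal :=
    Subgroup.Normal.map inferInstance _ (QuotientGroup.mk'_surjective N)
  let π : M →* M.map (QuotientGroup.mk' N) := (QuotientGroup.mk' N).subgroupMap M
  have hπ : Function.Surjective π := MonoidHom.subgroupMap_surjective _ M
  have hπv : ∀ x : M, ((π x : M.map (QuotientGroup.mk' N)) : G ⧸ N) = QuotientGroup.mk' N x :=
    fun x => rfl
  -- automorphisms of the section induced by elements of the whole group
  let Φ : G → (M.map (QuotientGroup.mk' N)) ≃* (M.map (QuotientGroup.mk' N)) :=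
    fun g => MulAut.conjNormal (QuotientGroup.mk' N g)
  have hΦ : ∀ g q, ((Φ g q : M.map (QuotientGroup.mk' N)) : G ⧸ N) =
      QuotientGroup.mk' N g * q * (QuotientGroup.mk' N g)⁻¹ :=
    fun g q => MulAut.conjNormal_apply _ _
  have hInn : ∀ g, Inn (Φ g) → g ∈ M := by
    rintro g ⟨q, hq⟩
    have h1 : (q : G ⧸ N)⁻¹ * QuotientGroup.mk' N g ∈
        Subgroup.centralizer ((M.map (QuotientGroup.mk' N)) : Set (G ⧸ N)) := by
      rw [Subgroup.mem_centralizer_iff]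
      intro x hx
      have h2 := congrArg Subtype.val (hq ⟨x, hx⟩)
      rw [hΦ] at h2
      have h3 : QuotientGroup.mk' N g * x * (QuotientGroup.mk' N g)⁻¹ =
        (q : G ⧸ N) * x * (q : G ⧸ N)⁻¹ := h2
      have h4 : QuotientGroup.mk' N g * x = (q : G ⧸ N) * x * (q : G ⧸ N)⁻¹ * QuotientGroup.mk' N g := by
        rw [← h3]; group
      rw [mul_assoc, h4]; group
    rw [hcent, Subgroup.mem_bot, inv_mul_eq_one] at h1
    have h5 : QuotientGroup.mk' N g ∈ M.map (QuotientGroup.mk' N) := h1 ▸ q.2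
    obtain ⟨m, hm, hmg⟩ := h5
    have h6 : m⁻¹ * g ∈ N := QuotientGroup.eq.1 hmg
    exact (M.mul_mem_cancel_left (M.inv_mem hm)).1 (hNM h6)
  have h2 : ∀ a b : G, a ∈ M ∨ b ∈ M ∨ a * b ∈ M := by
    intro a b
    rcases D.aut_two (Φ a) (Φ b) with h1 | h1 | h1
    · exact Or.inl (hInn a h1)
    · exact Or.inr (Or.inl (hInn b h1))
    · refine Or.inr (Or.inr (hInn _ ?_))
      obtain ⟨q, hq⟩ := h1
      refine ⟨q, fun x => ?_⟩
      rw [← hq x]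
      apply Subtype.ext
      rw [MulEquiv.trans_apply, hΦ, hΦ, hΦ, map_mul]
      group
  have hN : ∀ b ∈ (⊤ : Subgroup G), ∀ x, b * x * b⁻¹ ∈ M ↔ x ∈ M := by
    intro b _ x
    exact ((inferInstance : M.Normal).mem_comm_iff.trans (by rw [inv_mul_cancel_left]))
  have hcd : ∀ n, n ∈ charDegrees G ↔ ∃ χ, Irr (⊤ : Subgroup G) χ ∧ dg χ = n := fun n => ir_degrees n
  refine count18 (charDegrees G) (fun n => ∃ f, Irr (⊤ : Subgroup M) f ∧ dg f = n) ?_ hG ?_ ?_ ?_ ?_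
  · intro d hd
    obtain ⟨χ, h1, rfl⟩ := (hcd d).1 hd
    exact h1.dg_spec.2
  · intro d hd
    obtain ⟨χ, h1, rfl⟩ := (hcd d).1 hd
    obtain ⟨ψ, h3, h4⟩ := exists_under (N := M) le_top h1
    obtain ⟨h5, h6⟩ := irr_transfer' h3
    exact ⟨dg ψ, ⟨_, h5, h6⟩, (cliff2 h2 h3 h1 h4).1⟩
  · rintro n ⟨f, hf, rfl⟩
    obtain ⟨ψ, h3, -, h4⟩ := irr_transfer hf
    obtain ⟨χ, h5, h6⟩ := exists_over (B := ⊤) le_top hN h3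
    rcases (cliff2 h2 h3 h5 h6).1 with h7 | h7
    · exact Or.inl ((hcd _).2 ⟨χ, h5, by rw [h7, h4]⟩)
    · exact Or.inr ((hcd _).2 ⟨χ, h5, by rw [h7, h4]⟩)
  · obtain ⟨f, hf, h12, hinv⟩ := exists_psi12 hπ D
    obtain ⟨ψ, h3, h8, h4⟩ := irr_transfer hf
    obtain ⟨χ, h5, h6⟩ := exists_over (B := ⊤) le_top hN h3
    refine (hcd _).2 ⟨χ, h5, ?_⟩
    rw [(cliff2 h2 h3 h5 h6).2, h4, h12]
    intro b
    ext x
    by_cases hx : x ∈ M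
    · have h9 := hinv (MulAut.conjNormal b) (Φ b) (by
        intro y
        apply Subtype.ext
        rw [hπv, hΦ, hπv, MulAut.conjNormal_apply, map_mul, map_mul, map_inv]) ⟨x, hx⟩
      have h10 := h8 (MulAut.conjNormal b ⟨x, hx⟩)
      rw [MulAut.conjNormal_apply] at h10
      have h11 := h8 ⟨x, hx⟩
      rw [cj]
      exact h10.trans (h9.trans h11.symm)
    · rw [h3.1 x hx, cj]
      exact h3.1 _ (fun h => hx ((hN b trivial x).1 h))
  · rintro n ⟨f, hf, rfl⟩
    rcases msum hπ D hf with ⟨m, e, hm, he, h1, h3⟩ | h1 | h1 | h1 | h1 |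
        ⟨m, e, hm, he, he', h1, g, hg, h3⟩ | h1
    · exact Or.inl ⟨m, e, hm, he, h1, h3⟩
    · exact Or.inr (Or.inl h1)
    · exact Or.inr (Or.inr (Or.inl h1))
    · exact Or.inr (Or.inr (Or.inr (Or.inl h1)))
    · exact Or.inr (Or.inr (Or.inr (Or.inr (Or.inl h1))))
    · refine Or.inr (Or.inr (Or.inr (Or.inr (Or.inr (Or.inl ⟨m, e, hm, he, he', h1, ?_⟩)))))
      rcases h3 with h3 | h3
      · exact Or.inl ⟨g, hg, h3⟩
      · exact Or.inr ⟨g, hg, h3⟩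
    · exact Or.inr (Or.inr (Or.inr (Or.inr (Or.inr (Or.inr h1)))))
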